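/- There exists a constant c > 0 with the following property: for every integer N > 1 and every set P ⊆ ℝ² of N points, the distance set Δ(P) = {dist(p, q) : p, q ∈ P} satisfies |Δ(P)| ≥ c·N/log N. -/

import Mathlib

namespace ErdosDistance

/-- Sum of a functional over the faces (one entry deleted) of a list. -/
def faceSum {α : Type*} (G : List α → ZMod 2) : List α → ZMod 2
  | [] => 0
  | a :: l => G l + faceSum (fun l' => G (a :: l')) l

theorem faceSum_congr_sublist {α : Type*} (G G' : List α → ZMod 2) (l : List α)
    (h : ∀ l', l'.Sublist l → G l' = G' l') : faceSum G l = faceSum G' l := by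
  induction l generalizing G G' with
  | nil => rfl
  | cons a l ih =>
    simp only [faceSum]
    rw [h l (List.sublist_cons_self a l)]
    congr 1
    exact ih _ _ (fun l' hl' => h _ (hl'.cons_cons a))

theorem faceSum_perm {α : Type*} (G : List α → ZMod 2)
    (hG : ∀ l l' : List α, l.Perm l' → G l = G l') {l l' : List α} (h : l.Perm l') :
    faceSum G l = faceSum G l' := by
  induction h generalizing G with
  | nil => rfl
  | cons a hp ih =>
    simp only [faceSum]
    rw [hG _ _ hp, ih _ (fun l l' hl => hG _ _ (hl.cons a))]
  | swap a b l =>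
    simp only [faceSum]
    have : (fun l' => G (b :: a :: l')) = fun l' => G (a :: b :: l') := by
      funext l'; exact hG _ _ (List.Perm.swap _ _ _)
    rw [this]; ring
  | trans _ _ ih1 ih2 => rw [ih1 G hG, ih2 G hG]

/-- Indicator that a list of signs alternates, starting with `b`. -/
def altInd : Bool → List Bool → ZMod 2
  | _, [] => 1
  | b, c :: l => if c = b then altInd (!b) l else 0

theorem faceSum_altInd (b : Bool) (l : List Bool) :
    faceSum (altInd b) l = altInd b l + altInd (!b) l := by
  induction l generalizing b with
  | nil => simp [faceSum, altInd]; decide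
  | cons c l ih =>
    simp only [faceSum, altInd]
    by_cases h : c = b
    · subst h
      simp only [if_true]
      rw [ih]
      have h2 : ∀ x : ZMod 2, x + x = 0 := by decide
      have : (c = !c) = False := by simp
      simp only [this, if_false, Bool.not_not]
      linear_combination h2 (altInd c l)
    · have h3 : c = !b := by cases b <;> cases c <;> simp_all
      subst h3
      have h0 : ∀ l : List Bool, faceSum (fun _ => 0) l = 0 := by
        intro l; induction l with
        | nil => rfl
        | cons a l ih => simp [faceSum, ih]
      simp [h, h0]

theorem faceSum_map {α β : Type*} (G : List β → ZMod 2) (φ : α → β) (l : List α) :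
    faceSum (fun l' => G (l'.map φ)) l = faceSum G (l.map φ) := by
  induction l generalizing G with
  | nil => rfl
  | cons a l ih =>
    simp only [faceSum, List.map_cons]
    rw [ih (fun k => G (φ a :: k))]

/-- Indicator that the labels, sorted, have alternating signs starting with `b`. -/
noncomputable def altLabel {n : ℕ} (b : Bool) (l : List (Fin n ×ₗ Bool)) : ZMod 2 :=
  altInd b ((l.mergeSort (fun x y => decide (x ≤ y))).map (fun x => (ofLex x).2))

theorem mergeSort_perm_eq {α : Type*} [LinearOrder α] {l l' : List α} (h : l.Perm l') :
    l.mergeSort (fun x y => decide (x ≤ y)) = l'.mergeSort (fun x y => decide (x ≤ y)) := by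
  apply List.Perm.eq_of_pairwise (le := (· ≤ ·))
  · intro a b _ _ h1 h2; exact le_antisymm h1 h2
  · have := List.pairwise_mergeSort (le := fun x y : α => decide (x ≤ y))
      (by simpa using fun a b c => le_trans) (by simpa using le_total) l
    simpa using this
  · have := List.pairwise_mergeSort (le := fun x y : α => decide (x ≤ y))
      (by simpa using fun a b c => le_trans) (by simpa using le_total) l'
    simpa using this
  · exact ((List.mergeSort_perm _ _).trans h).trans (List.mergeSort_perm _ _).symm

theorem mergeSort_eq_self {α : Type*} [LinearOrder α] {l : List α} (h : l.Pairwise (· ≤ ·)) :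
    l.mergeSort (fun x y => decide (x ≤ y)) = l := by
  apply List.mergeSort_of_pairwise
  simpa using h

theorem pairwise_mergeSort_le {α : Type*} [LinearOrder α] (l : List α) :
    (l.mergeSort (fun x y => decide (x ≤ y))).Pairwise (· ≤ ·) := by
  have := List.pairwise_mergeSort (le := fun x y : α => decide (x ≤ y))
      (by simpa using fun a b c => le_trans) (by simpa using le_total) l
  simpa using this

theorem altLabel_perm {n : ℕ} (b : Bool) {l l' : List (Fin n ×ₗ Bool)} (h : l.Perm l') :
    altLabel b l = altLabel b l' := by
  rw [altLabel, altLabel, mergeSort_perm_eq h]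

theorem faceSum_altLabel {n : ℕ} (b : Bool) (l : List (Fin n ×ₗ Bool)) :
    faceSum (altLabel b) l = altLabel b l + altLabel (!b) l := by
  have hp := List.mergeSort_perm l (fun x y => decide (x ≤ y))
  rw [← faceSum_perm _ (fun _ _ h => altLabel_perm b h) hp]
  have hs := pairwise_mergeSort_le l
  rw [altLabel, altLabel]
  set m := l.mergeSort (fun x y => decide (x ≤ y)) with hm
  rw [← faceSum_altInd, ← faceSum_map]
  apply faceSum_congr_sublist
  intro l' hl'
  rw [altLabel, mergeSort_eq_self (hs.sublist hl')]

/-- Flip the sign of a label. -/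
def flipLabel {n : ℕ} (x : Fin n ×ₗ Bool) : Fin n ×ₗ Bool := toLex ((ofLex x).1, !(ofLex x).2)

theorem altInd_map_not (b : Bool) (l : List Bool) :
    altInd b (l.map (fun x => !x)) = altInd (!b) l := by
  induction l generalizing b with
  | nil => rfl
  | cons c l ih => cases b <;> cases c <;> simp [altInd, ih]

theorem altLabel_flip {n : ℕ} (b : Bool) (l : List (Fin n ×ₗ Bool))
    (h : ∀ x ∈ l, ∀ y ∈ l, (ofLex x).1 = (ofLex y).1 → x = y) :
    altLabel b (l.map flipLabel) = altLabel (!b) l := by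
  have hp := List.mergeSort_perm l (fun x y => decide (x ≤ y))
  have hs := pairwise_mergeSort_le l
  rw [altLabel_perm b (hp.symm.map flipLabel)]
  rw [altLabel, mergeSort_eq_self, altLabel, ← altInd_map_not, List.map_map, List.map_map]
  · rfl
  · rw [List.pairwise_map]
    refine hs.imp_of_mem ?_
    intro x y hx hy hxy
    rw [hp.mem_iff] at hx hy
    by_cases hi : (ofLex x).1 = (ofLex y).1
    · rw [h x hx y hy hi]
    · rw [Prod.Lex.le_iff] at hxy ⊢
      left
      rcases hxy with h1 | h1
      · exact h1
      · exact absurd h1.1 hi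

theorem length_le_of_altInd_sorted {n : ℕ} (b : Bool) (l : List (Fin n ×ₗ Bool))
    (hs : l.Pairwise (· ≤ ·)) (h : ∀ x ∈ l, ∀ y ∈ l, (ofLex x).1 = (ofLex y).1 → x = y)
    (ha : altInd b (l.map (fun x => (ofLex x).2)) ≠ 0) :
    (l.map (fun x => (ofLex x).1)).Pairwise (· < ·) := by
  rw [List.pairwise_map]
  have hch : l.IsChain (fun x y => (ofLex x).1 < (ofLex y).1) := by
    induction l generalizing b with
    | nil => exact List.IsChain.nil
    | cons x l ih =>
      cases l with
      | nil => exact List.IsChain.singleton _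
      | cons y l =>
        simp only [List.map_cons, altInd] at ha
        have hx : (ofLex x).2 = b := by by_contra hc; simp [hc] at ha
        have hy : (ofLex y).2 = !b := by by_contra hc; simp [hc] at ha
        refine List.IsChain.cons_cons ?_ (ih (!b) hs.of_cons ?_ ?_)
        · have hxy : x ≤ y := (List.pairwise_cons.1 hs).1 y (by simp)
          rw [Prod.Lex.le_iff] at hxy
          rcases hxy with h1 | h1
          · exact h1
          · have := h x (by simp) y (by simp) h1.1
            rw [this, hy] at hx
            simp at hx
        · intro x' hx' y' hy'
          exact h x' (List.mem_cons_of_mem _ hx') y' (List.mem_cons_of_mem _ hy')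
        · rw [if_pos hx] at ha
          simpa only [List.map_cons, altInd] using ha
  have : IsTrans (Fin n ×ₗ Bool) (fun x y => (ofLex x).1 < (ofLex y).1) :=
    ⟨fun a b c h1 h2 => lt_trans h1 h2⟩
  exact hch.pairwise

theorem length_le_of_altLabel {n : ℕ} (b : Bool) (l : List (Fin n ×ₗ Bool))
    (h : ∀ x ∈ l, ∀ y ∈ l, (ofLex x).1 = (ofLex y).1 → x = y)
    (ha : altLabel b l ≠ 0) : l.length ≤ n := by
  have hp := List.mergeSort_perm l (fun x y => decide (x ≤ y))
  have hs := pairwise_mergeSort_le l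
  have h2 := length_le_of_altInd_sorted b _ hs
    (fun x hx y hy => h x (hp.mem_iff.1 hx) y (hp.mem_iff.1 hy)) ha
  have h3 : (List.map (fun x => (ofLex x).1)
      (l.mergeSort (fun x y => decide (x ≤ y)))).Nodup := h2.imp (fun h => ne_of_lt h)
  have := h3.length_le_card
  simpa using this

/-- Mod 2 chains on ordered simplices with vertices in `W`. -/
abbrev Chain (W : Type*) := List W →₀ ZMod 2

/-- The cone operator with apex `a`. -/
noncomputable def cone {W : Type*} (a : W) : Chain W →ₗ[ZMod 2] Chain W :=
  Finsupp.lmapDomain (ZMod 2) (ZMod 2) (fun l => a :: l)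

/-- The boundary of an ordered simplex. -/
noncomputable def bdryList {W : Type*} : List W → Chain W
  | [] => 0
  | a :: l => Finsupp.single l 1 + cone a (bdryList l)

/-- The boundary operator. -/
noncomputable def bdry {W : Type*} : Chain W →ₗ[ZMod 2] Chain W :=
  Finsupp.linearCombination (ZMod 2) bdryList

theorem cone_single {W : Type*} (a : W) (l : List W) (c : ZMod 2) :
    cone a (Finsupp.single l c) = Finsupp.single (a :: l) c := by
  simp [cone]

theorem bdry_single {W : Type*} (l : List W) :
    bdry (Finsupp.single l 1) = bdryList l := by
  simp [bdry]

theorem bdry_cone {W : Type*} (a : W) (c : Chain W) :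
    bdry (cone a c) = c + cone a (bdry c) := by
  have : bdry ∘ₗ cone a = LinearMap.id + cone a ∘ₗ bdry := by
    apply Finsupp.lhom_ext'
    intro l
    ext
    simp [cone_single, bdry_single, bdryList]
  exact LinearMap.congr_fun this c

theorem chain_add_self {W : Type*} (c : Chain W) : c + c = 0 := by
  ext l
  have h2 : ∀ x : ZMod 2, x + x = 0 := by decide
  simp [h2]

theorem bdry_bdryList {W : Type*} (l : List W) : bdry (bdryList l) = 0 := by
  induction l with
  | nil => simp [bdryList]
  | cons a l ih =>
    rw [bdryList, map_add, bdry_cone, ih, map_zero, bdry_single, add_zero, chain_add_self]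

theorem linearMap_ext_single {W M : Type*} [AddCommMonoid M] [Module (ZMod 2) M]
    {f g : Chain W →ₗ[ZMod 2] M}
    (h : ∀ l, f (Finsupp.single l 1) = g (Finsupp.single l 1)) : f = g := by
  apply Finsupp.lhom_ext'
  intro l
  ext
  simpa using h l

/-- Push a chain forward along a map of vertices. -/
noncomputable def push {W W' : Type*} (φ : W → W') : Chain W →ₗ[ZMod 2] Chain W' :=
  Finsupp.lmapDomain (ZMod 2) (ZMod 2) (List.map φ)

theorem push_single {W W' : Type*} (φ : W → W') (l : List W) (c : ZMod 2) :
    push φ (Finsupp.single l c) = Finsupp.single (l.map φ) c := by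
  simp [push]

theorem push_cone {W W' : Type*} (φ : W → W') (a : W) (c : Chain W) :
    push φ (cone a c) = cone (φ a) (push φ c) := by
  have : push φ ∘ₗ cone a = cone (φ a) ∘ₗ push φ := by
    apply linearMap_ext_single
    intro l
    simp [push_single, cone_single]
  exact LinearMap.congr_fun this c

theorem push_bdryList {W W' : Type*} (φ : W → W') (l : List W) :
    push φ (bdryList l) = bdryList (l.map φ) := by
  induction l with
  | nil => simp [bdryList]
  | cons a l ih => simp [bdryList, push_single, push_cone, ih]

theorem push_bdry {W W' : Type*} (φ : W → W') (c : Chain W) :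
    push φ (bdry c) = bdry (push φ c) := by
  have : push φ ∘ₗ bdry = bdry ∘ₗ push φ := by
    apply linearMap_ext_single
    intro l
    simp [push_single, bdry_single, push_bdryList]
  exact LinearMap.congr_fun this c

/-- Evaluate a functional on ordered simplices on a chain. -/
noncomputable def evalChain {W : Type*} (G : List W → ZMod 2) : Chain W →ₗ[ZMod 2] ZMod 2 :=
  Finsupp.linearCombination (ZMod 2) G

theorem evalChain_single {W : Type*} (G : List W → ZMod 2) (l : List W) :
    evalChain G (Finsupp.single l 1) = G l := by
  simp [evalChain]

theorem evalChain_cone {W : Type*} (G : List W → ZMod 2) (a : W) (c : Chain W) :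
    evalChain G (cone a c) = evalChain (fun l => G (a :: l)) c := by
  have : evalChain G ∘ₗ cone a = evalChain (fun l => G (a :: l)) := by
    apply linearMap_ext_single
    intro l
    simp [cone_single, evalChain_single]
  exact LinearMap.congr_fun this c

theorem evalChain_bdryList {W : Type*} (G : List W → ZMod 2) (l : List W) :
    evalChain G (bdryList l) = faceSum G l := by
  induction l generalizing G with
  | nil => simp [bdryList, faceSum]
  | cons a l ih => simp [bdryList, faceSum, evalChain_single, evalChain_cone, ih]

theorem evalChain_bdry {W : Type*} (G : List W → ZMod 2) (c : Chain W) :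
    evalChain G (bdry c) = evalChain (faceSum G) c := by
  have : evalChain G ∘ₗ bdry = evalChain (faceSum G) := by
    apply linearMap_ext_single
    intro l
    simp [bdry_single, evalChain_single, evalChain_bdryList]
  exact LinearMap.congr_fun this c

/-- Every simplex occurring in the chain satisfies `p`. -/
def ChainAll {W : Type*} (p : List W → Prop) (c : Chain W) : Prop := ∀ l ∈ c.support, p l

theorem ChainAll.add {W : Type*} {p : List W → Prop} {c c' : Chain W}
    (h : ChainAll p c) (h' : ChainAll p c') : ChainAll p (c + c') := by
  classical
  intro l hl
  rcases Finset.mem_union.1 (Finsupp.support_add hl) with h1 | h1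
  · exact h l h1
  · exact h' l h1

theorem chainAll_single {W : Type*} {p : List W → Prop} {l : List W} (h : p l) :
    ChainAll p (Finsupp.single l 1) := by
  intro l' hl'
  have := Finsupp.support_single_subset hl'
  simp at this
  exact this ▸ h

theorem ChainAll.mono {W : Type*} {p q : List W → Prop} {c : Chain W}
    (h : ChainAll p c) (hpq : ∀ l, p l → q l) : ChainAll q c := fun l hl => hpq l (h l hl)

theorem ChainAll.cone {W : Type*} {p q : List W → Prop} {c : Chain W} {a : W}
    (h : ChainAll p c) (hpq : ∀ l, p l → q (a :: l)) : ChainAll q (cone a c) := by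
  classical
  intro l hl
  have := Finsupp.mapDomain_support (f := fun l => a :: l) (s := c) hl
  simp only [Finset.mem_image] at this
  obtain ⟨l', hl', rfl⟩ := this
  exact hpq l' (h l' hl')

theorem ChainAll.push {W W' : Type*} {p : List W → Prop} {q : List W' → Prop} {c : Chain W}
    {φ : W → W'} (h : ChainAll p c) (hpq : ∀ l, p l → q (l.map φ)) :
    ChainAll q (push φ c) := by
  classical
  intro l hl
  have := Finsupp.mapDomain_support (f := List.map φ) (s := c) hl
  simp only [Finset.mem_image] at this
  obtain ⟨l', hl', rfl⟩ := this
  exact hpq l' (h l' hl')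

theorem ChainAll.linearCombination {W W' : Type*} {p : List W → Prop} {q : List W' → Prop}
    {c : Chain W} {φ : List W → Chain W'} (h : ChainAll p c)
    (hpq : ∀ l, p l → ChainAll q (φ l)) :
    ChainAll q (Finsupp.linearCombination (ZMod 2) φ c) := by
  classical
  intro l hl
  rw [Finsupp.linearCombination_apply] at hl
  have h1 := Finsupp.support_sum hl
  simp only [Finset.mem_biUnion] at h1
  obtain ⟨l', hl', h2⟩ := h1
  exact hpq l' (h l' hl') l (Finsupp.support_smul h2)

theorem chainAll_bdryList {W : Type*} (l : List W) :
    ChainAll (fun l' => l'.Sublist l ∧ l'.length + 1 = l.length) (bdryList l) := by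
  induction l with
  | nil => intro l hl; simp [bdryList] at hl
  | cons a l ih =>
    rw [bdryList]
    refine ChainAll.add (chainAll_single ⟨List.sublist_cons_self _ _, rfl⟩) (ih.cone ?_)
    rintro l' ⟨h1, h2⟩
    exact ⟨h1.cons_cons a, by simp [h2]⟩

theorem evalChain_congr {W : Type*} {p : List W → Prop} {G G' : List W → ZMod 2} {c : Chain W}
    (h : ChainAll p c) (hG : ∀ l, p l → G l = G' l) : evalChain G c = evalChain G' c := by
  rw [evalChain, evalChain, Finsupp.linearCombination_apply, Finsupp.linearCombination_apply]
  apply Finsupp.sum_congr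
  intro l hl
  rw [hG l (h l hl)]

theorem evalChain_add {W : Type*} (G G' : List W → ZMod 2) (c : Chain W) :
    evalChain (fun l => G l + G' l) c = evalChain G c + evalChain G' c := by
  simp only [evalChain, Finsupp.linearCombination_apply]
  rw [← Finsupp.sum_add]
  simp [mul_add]

section Subdivision

variable {W : Type*} [NormedAddCommGroup W] [NormedSpace ℝ W]

/-- The barycentre of a list of points. -/
noncomputable def bary (l : List W) : W := ((l.length : ℝ)⁻¹) • l.sum

/-- Barycentric subdivision of ordered simplices with `k` vertices. -/
noncomputable def sd : ℕ → Chain W →ₗ[ZMod 2] Chain W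
  | 0 => LinearMap.id
  | k + 1 => Finsupp.linearCombination (ZMod 2) (fun l => cone (bary l) (sd k (bdryList l)))

theorem sd_succ_single (k : ℕ) (l : List W) :
    sd (k + 1) (Finsupp.single l 1) = cone (bary l) (sd k (bdryList l)) := by
  simp [sd]

theorem bdry_sd (k : ℕ) (c : Chain W) : bdry (sd (k + 1) c) = sd k (bdry c) := by
  induction k generalizing c with
  | zero =>
    have : bdry ∘ₗ sd (0 + 1) = sd 0 ∘ₗ bdry (W := W) := by
      apply linearMap_ext_single
      intro l
      simp only [LinearMap.comp_apply]
      rw [sd_succ_single, bdry_cone, bdry_single]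
      simp [sd, bdry_bdryList]
    exact LinearMap.congr_fun this c
  | succ k ih =>
    have : bdry ∘ₗ sd (k + 1 + 1) = sd (k + 1) ∘ₗ bdry (W := W) := by
      apply linearMap_ext_single
      intro l
      simp only [LinearMap.comp_apply]
      rw [sd_succ_single, bdry_cone, bdry_single, ih, bdry_bdryList, map_zero, map_zero, add_zero]
    exact LinearMap.congr_fun this c

theorem bary_map_neg (l : List W) : bary (l.map (fun x => -x)) = - bary l := by
  have : (l.map (fun x => -x)).sum = - l.sum := by
    induction l with
    | nil => simp
    | cons a l ih => simp [ih]; abel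
  simp [bary, this]

theorem push_neg_sd (k : ℕ) (c : Chain W) :
    push (fun x => -x) (sd k c) = sd k (push (fun x => -x) c) := by
  induction k generalizing c with
  | zero => rfl
  | succ k ih =>
    have : push (fun x => -x) ∘ₗ sd (k + 1) = sd (k + 1) ∘ₗ push (fun x : W => -x) := by
      apply linearMap_ext_single
      intro l
      simp only [LinearMap.comp_apply]
      rw [sd_succ_single, push_cone, ih, push_bdryList, push_single, sd_succ_single, bary_map_neg]
    exact LinearMap.congr_fun this c

theorem bary_mem_of_convex {K : Set W} (hK : Convex ℝ K) {l : List W} (hl : l ≠ [])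
    (h : ∀ x ∈ l, x ∈ K) : bary l ∈ K := by
  have h1 : bary l = ∑ i : Fin l.length, ((l.length : ℝ)⁻¹) • l[i] := by
    rw [bary, ← Finset.smul_sum]
    congr 1
    simp [Fin.sum_univ_getElem]
  rw [h1]
  have hpos : (0 : ℝ) < l.length := by
    exact_mod_cast List.length_pos_of_ne_nil hl
  apply hK.sum_mem
  · intro i _; positivity
  · simp; field_simp
  · intro i _; exact h _ (List.getElem_mem _)

/-- All pairwise distances in the list are at most `δ`. -/
def Mesh (δ : ℝ) (l : List W) : Prop := ∀ x ∈ l, ∀ y ∈ l, dist x y ≤ δ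

theorem dist_bary_le {δ : ℝ} {l : List W} {k : ℕ} (hk : l.length = k + 1) (hm : Mesh δ l) (y : W)
    (hy : y ∈ l) : dist y (bary l) ≤ k / (k + 1) * δ := by
  have h1 : bary l - y = ((k : ℝ) + 1)⁻¹ • (l.map (fun x => x - y)).sum := by
    have : (l.map (fun x => x - y)).sum = l.sum - (l.length : ℝ) • y := by
      clear hk hm hy
      induction l with
      | nil => simp
      | cons a l ih => simp [ih, add_smul]; abel
    rw [this, smul_sub, smul_smul, hk, bary, hk]
    have : ((k : ℝ) + 1) ≠ 0 := by positivity
    push_cast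
    rw [inv_mul_cancel₀ this, one_smul]
  obtain ⟨s, t, rfl⟩ := List.append_of_mem hy
  have hlen : (s ++ t).length = k := by simp at hk ⊢; omega
  have h2 : ((s ++ y :: t).map (fun x => x - y)).sum = ((s ++ t).map (fun x => x - y)).sum := by
    simp
  have h3 : ‖((s ++ t).map (fun x => x - y)).sum‖ ≤ k * δ := by
    have : ∀ u : List W, (∀ x ∈ u, dist x y ≤ δ) →
        ‖(u.map (fun x => x - y)).sum‖ ≤ u.length * δ := by
      intro u
      induction u with
      | nil => simp
      | cons a u ih =>
        intro hu
        simp only [List.map_cons, List.sum_cons, List.length_cons]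
        have ha := hu a (by simp)
        rw [dist_eq_norm] at ha
        have := ih (fun x hx => hu x (by simp [hx]))
        push_cast
        calc _ ≤ _ := norm_add_le _ _
          _ ≤ _ := by linarith
    have h4 := this (s ++ t) (fun x hx => hm x (by simp at hx ⊢; tauto) y (by simp))
    rwa [hlen] at h4
  rw [dist_comm, dist_eq_norm, h1, h2, norm_smul, Real.norm_of_nonneg (by positivity)]
  calc _ ≤ ((k : ℝ) + 1)⁻¹ * (k * δ) := by gcongr
    _ = _ := by field_simp

theorem chainAll_sd (k : ℕ) (l : List W) (hl : l.length = k) (δ : ℝ) (hδ : 0 ≤ δ)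
    (hm : Mesh δ l) : ChainAll (fun l' => l'.length = k ∧
      (∀ K : Set W, Convex ℝ K → (∀ x ∈ l, x ∈ K) → ∀ x ∈ l', x ∈ K) ∧
      Mesh ((k - 1 : ℕ) / ((k - 1 : ℕ) + 1) * δ) l') (sd k (Finsupp.single l 1)) := by
  induction k generalizing l with
  | zero =>
    rw [sd, LinearMap.id_apply]
    refine chainAll_single ⟨hl, fun K _ h => h, ?_⟩
    rw [List.length_eq_zero_iff] at hl
    subst hl
    intro x hx; simp at hx
  | succ k ih =>
    rw [sd_succ_single]
    have hdb : ChainAll (fun l' => l'.length = k ∧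
      (∀ K : Set W, Convex ℝ K → (∀ x ∈ l, x ∈ K) → ∀ x ∈ l', x ∈ K) ∧
      Mesh (k / (k + 1) * δ) l') (sd k (bdryList l)) := by
      have : sd k (bdryList l) = Finsupp.linearCombination (ZMod 2)
          (fun l' => sd k (Finsupp.single l' 1)) (bdryList l) := by
        have h1 : sd k = Finsupp.linearCombination (ZMod 2)
          (fun l' : List W => sd k (Finsupp.single l' 1)) := by
          apply linearMap_ext_single
          intro l; simp
        exact LinearMap.congr_fun h1 _
      rw [this]
      refine (chainAll_bdryList l).linearCombination ?_
      rintro l' ⟨h1, h2⟩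
      refine (ih l' (by omega) (fun x hx y hy => hm x (h1.subset hx) y (h1.subset hy))).mono ?_
      rintro l'' ⟨h3, h4, h5⟩
      refine ⟨h3, fun K hK hl => h4 K hK (fun x hx => hl x (h1.subset hx)), ?_⟩
      intro x hx y hy
      refine (h5 x hx y hy).trans ?_
      gcongr ?_ * _
      rw [div_le_div_iff₀ (by positivity) (by positivity)]
      have : ((k - 1 : ℕ) : ℝ) ≤ k := by exact_mod_cast Nat.sub_le k 1
      nlinarith
    refine hdb.cone ?_
    rintro l' ⟨h1, h2, h3⟩
    have hne : l ≠ [] := by rintro rfl; simp at hl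
    refine ⟨by simp [h1], ?_, ?_⟩
    · intro K hK hlK x hx
      rcases List.mem_cons.1 hx with rfl | hx
      · exact bary_mem_of_convex hK hne hlK
      · exact h2 K hK hlK x hx
    · have hb : ∀ x ∈ l', dist x (bary l) ≤ k / (k + 1) * δ := by
        intro x hx
        exact h2 (Metric.closedBall (bary l) (k / (k + 1) * δ)) (convex_closedBall _ _)
          (fun y hy => dist_bary_le hl hm y hy) x hx
      simp only [Nat.add_sub_cancel]
      intro x hx y hy
      rcases List.mem_cons.1 hx with rfl | hx <;> rcases List.mem_cons.1 hy with rfl | hy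
      · rw [dist_self]; positivity
      · rw [dist_comm]; exact hb y hy
      · exact hb x hx
      · exact h3 x hx y hy

theorem chainAll_sd_iterate (k : ℕ) (δ : ℝ) (hδ : 0 ≤ δ) (𝒦 : Set (Set W))
    (h𝒦 : ∀ K ∈ 𝒦, Convex ℝ K) (c : Chain W)
    (hc : ChainAll (fun l => l.length = k ∧ (∃ K ∈ 𝒦, ∀ x ∈ l, x ∈ K) ∧ Mesh δ l) c) (m : ℕ) :
    ChainAll (fun l => l.length = k ∧ (∃ K ∈ 𝒦, ∀ x ∈ l, x ∈ K) ∧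
      Mesh (((k - 1 : ℕ) / ((k - 1 : ℕ) + 1) : ℝ) ^ m * δ) l) ((sd k)^[m] c) := by
  induction m with
  | zero => simpa using hc
  | succ m ih =>
    rw [Function.iterate_succ_apply']
    set c' := (sd k)^[m] c
    have h1 : sd k = Finsupp.linearCombination (ZMod 2)
          (fun l' : List W => sd k (Finsupp.single l' 1)) := by
      apply linearMap_ext_single
      intro l; simp
    rw [h1]
    refine ih.linearCombination ?_
    rintro l ⟨h2, ⟨K, hK, hl⟩, h3⟩
    refine (chainAll_sd k l h2 _ (by positivity) h3).mono ?_
    rintro l' ⟨h4, h5, h6⟩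
    refine ⟨h4, ⟨K, hK, h5 K (h𝒦 K hK) hl⟩, ?_⟩
    rw [pow_succ']
    rwa [mul_assoc]

end Subdivision

theorem push_neg_neg {W : Type*} [InvolutiveNeg W] (c : Chain W) :
    push (fun x => -x) (push (fun x => -x) c) = c := by
  have : push (fun x : W => -x) ∘ₗ push (fun x : W => -x) = LinearMap.id := by
    apply linearMap_ext_single
    intro l
    simp [push_single]
  exact LinearMap.congr_fun this c

/-- Coordinate vectors indexed by natural numbers. -/
def unitVec (n : ℕ) (i : ℕ) : Fin (n + 1) → ℝ := fun j => if j.val = i then 1 else 0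

/-- Chains whose boundaries build up the cross-polytope sphere dimension by dimension. -/
noncomputable def hemi (n : ℕ) : ℕ → Chain (Fin (n + 1) → ℝ)
  | 0 => Finsupp.single [unitVec n 0] 1
  | i + 1 => cone (unitVec n (i + 1)) (hemi n i + push (fun x => -x) (hemi n i))

theorem bdry_hemi_symm (n i : ℕ) :
    bdry (hemi n i + push (fun x => -x) (hemi n i)) = 0 := by
  induction i with
  | zero =>
    simp only [hemi, push_single, map_add, bdry_single, List.map_cons, List.map_nil, bdryList,
      map_zero, add_zero]
    exact chain_add_self _
  | succ i ih =>
    rw [map_add, ← push_bdry]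
    have : bdry (hemi n (i + 1)) = hemi n i + push (fun x => -x) (hemi n i) := by
      rw [hemi, bdry_cone, ih, map_zero, add_zero]
    rw [this, map_add, push_neg_neg, add_comm (push _ _)]
    exact chain_add_self _

theorem bdry_hemi (n i : ℕ) :
    bdry (hemi n (i + 1)) = hemi n i + push (fun x => -x) (hemi n i) := by
  rw [hemi, bdry_cone, bdry_hemi_symm, map_zero, add_zero]

/-- The face of the cross-polytope with sign vector `s`. -/
def orthantFace {n : ℕ} (s : Fin (n + 1) → ℝ) : Set (Fin (n + 1) → ℝ) :=
  {x | (∀ i, 0 ≤ s i * x i) ∧ ∑ i, s i * x i = 1}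

/-- Sign vectors. -/
def IsSignVec {n : ℕ} (s : Fin (n + 1) → ℝ) : Prop := ∀ j, s j = 1 ∨ s j = -1

theorem convex_orthantFace {n : ℕ} (s : Fin (n + 1) → ℝ) : Convex ℝ (orthantFace s) := by
  rintro x ⟨hx1, hx2⟩ y ⟨hy1, hy2⟩ a b ha hb hab
  refine ⟨fun i => ?_, ?_⟩
  · have : s i * (a • x + b • y) i = a * (s i * x i) + b * (s i * y i) := by
      simp; ring
    rw [this]
    have := hx1 i; have := hy1 i
    positivity
  · have : ∀ i, s i * (a • x + b • y) i = a * (s i * x i) + b * (s i * y i) := by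
      intro i; simp; ring
    simp_rw [this]
    rw [Finset.sum_add_distrib, ← Finset.mul_sum, ← Finset.mul_sum, hx2, hy2]
    linarith

theorem chainAll_hemi (n i : ℕ) (hi : i ≤ n) :
    ChainAll (fun l => l.length = i + 1 ∧ ∃ s : Fin (n + 1) → ℝ, IsSignVec s ∧
      ∀ x ∈ l, x ∈ orthantFace s ∧ ∀ j : Fin (n + 1), i < j.val → x j = 0) (hemi n i) := by
  induction i with
  | zero =>
    rw [hemi]
    refine chainAll_single ⟨rfl, fun _ => 1, fun j => Or.inl rfl, ?_⟩
    intro x hx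
    simp only [List.mem_singleton] at hx
    subst hx
    refine ⟨⟨fun i => ?_, ?_⟩, fun j hj => ?_⟩
    · simp only [unitVec, one_mul]; split_ifs <;> norm_num
    · simp only [unitVec, one_mul]
      rw [Finset.sum_eq_single (0 : Fin (n + 1))]
      · simp
      · intro b _ hb
        have : b.val ≠ 0 := fun h => hb (Fin.ext h)
        simp [this]
      · simp
    · have : j.val ≠ 0 := Nat.pos_iff_ne_zero.1 hj
      simp [unitVec, this]
  | succ i ih =>
    rw [hemi]
    have h1 := ih (by omega)
    have h2 : ChainAll (fun l => l.length = i + 1 ∧ ∃ s : Fin (n + 1) → ℝ, IsSignVec s ∧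
      ∀ x ∈ l, x ∈ orthantFace s ∧ ∀ j : Fin (n + 1), i < j.val → x j = 0)
        (push (fun x => -x) (hemi n i)) := by
      refine h1.push ?_
      rintro l ⟨hl, s, hs, hx⟩
      refine ⟨by simp [hl], -s, ?_, ?_⟩
      · intro j; rcases hs j with h | h <;> simp [h]
      · intro x hx'
        simp only [List.mem_map] at hx'
        obtain ⟨y, hy, rfl⟩ := hx'
        obtain ⟨⟨h3, h4⟩, h5⟩ := hx y hy
        refine ⟨⟨fun i => by simpa using h3 i, by simpa using h4⟩, fun j hj => by simp [h5 j hj]⟩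
    refine (h1.add h2).cone ?_
    rintro l ⟨hl, s, hs, hx⟩
    set k : Fin (n + 1) := ⟨i + 1, by omega⟩ with hk
    refine ⟨by simp [hl], Function.update s k 1, ?_, ?_⟩
    · intro j
      by_cases hj : j = k
      · subst hj; simp
      · simpa [hj] using hs j
    · intro x hx'
      rcases List.mem_cons.1 hx' with rfl | hx'
      · refine ⟨⟨fun j => ?_, ?_⟩, fun j hj => ?_⟩
        · by_cases hj : j = k
          · rw [hj]; simp only [unitVec, Function.update_self]; split_ifs <;> norm_num
          · have : j.val ≠ i + 1 := fun h => hj (Fin.ext h)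
            simp [unitVec, this]
        · rw [Finset.sum_eq_single k]
          · simp [unitVec, hk]
          · intro j _ hj
            have : j.val ≠ i + 1 := fun h => hj (Fin.ext h)
            simp [unitVec, this]
          · simp
        · simp [unitVec]; omega
      · obtain ⟨⟨h3, h4⟩, h5⟩ := hx x hx'
        have hk0 : x k = 0 := h5 k (by simp [hk])
        have he : ∀ j, Function.update s k 1 j * x j = s j * x j := by
          intro j
          by_cases hj : j = k
          · subst hj; simp [hk0]
          · simp [hj]
        refine ⟨⟨fun j => ?_, ?_⟩, fun j hj => h5 j (by omega)⟩
        · rw [he]; exact h3 j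
        · simp_rw [he]; exact h4

theorem sum_abs_of_mem_orthantFace {n : ℕ} {s x : Fin (n + 1) → ℝ} (hs : IsSignVec s)
    (hx : x ∈ orthantFace s) : ∑ i, |x i| = 1 := by
  rw [← hx.2]
  apply Finset.sum_congr rfl
  intro i _
  have := hx.1 i
  rcases hs i with h | h <;> rw [h] at this ⊢
  · rw [abs_of_nonneg (by linarith)]; ring
  · rw [abs_of_nonpos (by linarith)]; ring

theorem dist_le_two_of_sum_abs {n : ℕ} {x y : Fin (n + 1) → ℝ} (hx : ∑ i, |x i| = 1)
    (hy : ∑ i, |y i| = 1) : dist x y ≤ 2 := by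
  rw [dist_pi_le_iff (by norm_num)]
  intro i
  have h1 := Finset.single_le_sum (f := fun i => |x i|)
    (fun i _ => abs_nonneg _) (Finset.mem_univ i)
  have h2 := Finset.single_le_sum (f := fun i => |y i|)
    (fun i _ => abs_nonneg _) (Finset.mem_univ i)
  rw [Real.dist_eq]
  have := abs_sub (x i) (y i)
  linarith

theorem bdry_sd_iterate {W : Type*} [NormedAddCommGroup W] [NormedSpace ℝ W] (k m : ℕ)
    (c : Chain W) : bdry ((sd (k + 1))^[m] c) = (sd k)^[m] (bdry c) := by
  induction m with
  | zero => rfl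
  | succ m ih => rw [Function.iterate_succ_apply', Function.iterate_succ_apply', bdry_sd, ih]

theorem push_neg_sd_iterate {W : Type*} [NormedAddCommGroup W] [NormedSpace ℝ W] (k m : ℕ)
    (c : Chain W) :
    push (fun x => -x) ((sd k)^[m] c) = (sd k)^[m] (push (fun x => -x) c) := by
  induction m with
  | zero => rfl
  | succ m ih => rw [Function.iterate_succ_apply', Function.iterate_succ_apply', push_neg_sd, ih]

/-- Existence of arbitrarily fine hemisphere chains. -/
theorem exists_fine_hemispheres (n : ℕ) (δ : ℝ) (hδ : 0 < δ) :
    ∃ g : ℕ → Chain (Fin (n + 1) → ℝ),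
      (∀ i, bdry (g (i + 1)) = g i + push (fun x => -x) (g i)) ∧
      g 0 = Finsupp.single [unitVec n 0] 1 ∧
      ∀ i ≤ n, ChainAll (fun l => l.length = i + 1 ∧ (∀ x ∈ l, ∑ j, |x j| = 1) ∧ Mesh δ l)
        (g i) := by
  obtain ⟨m, hm⟩ : ∃ m : ℕ, ((n : ℝ) / (n + 1)) ^ m * 2 < δ := by
    have h1 : (n : ℝ) / (n + 1) < 1 := by rw [div_lt_one (by positivity)]; linarith
    obtain ⟨m, hm⟩ := exists_pow_lt_of_lt_one (show (0 : ℝ) < δ / 2 by positivity) h1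
    exact ⟨m, by linarith⟩
  refine ⟨fun i => (sd (i + 1))^[m] (hemi n i), ?_, ?_, ?_⟩
  · intro i
    simp only
    rw [bdry_sd_iterate, bdry_hemi, push_neg_sd_iterate]
    exact iterate_map_add (sd (i + 1)) m _ _
  · simp only [hemi]
    have : sd 1 (Finsupp.single [unitVec n 0] 1) = Finsupp.single [unitVec n 0] 1 := by
      rw [sd_succ_single]
      simp [sd, bdryList, bary, cone_single]
    induction m with
    | zero => rfl
    | succ m ih => exact (Function.iterate_fixed this _)
  · intro i hi
    have h1 := chainAll_sd_iterate (i + 1) 2 (by norm_num)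
      {K | ∃ s : Fin (n + 1) → ℝ, IsSignVec s ∧ K = orthantFace s}
      (by rintro K ⟨s, _, rfl⟩; exact convex_orthantFace s) (hemi n i)
      ((chainAll_hemi n i hi).mono ?_) m
    · refine h1.mono ?_
      rintro l ⟨h2, ⟨K, ⟨s, hs, rfl⟩, h3⟩, h4⟩
      refine ⟨h2, fun x hx => sum_abs_of_mem_orthantFace hs (h3 x hx), ?_⟩
      intro x hx y hy
      refine (h4 x hx y hy).trans (le_trans ?_ hm.le)
      simp only [Nat.add_sub_cancel]
      have : (i : ℝ) ≤ n := by exact_mod_cast hi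
      gcongr ?_ ^ m * _
      rw [div_le_div_iff₀ (by positivity) (by positivity)]
      nlinarith
    · rintro l ⟨h2, s, hs, h3⟩
      refine ⟨h2, ⟨_, ⟨s, hs, rfl⟩, fun x hx => (h3 x hx).1⟩, ?_⟩
      intro x hx y hy
      exact dist_le_two_of_sum_abs (sum_abs_of_mem_orthantFace hs (h3 x hx).1)
        (sum_abs_of_mem_orthantFace hs (h3 y hy).1)

/-- Tucker-type statement: antipodal labels on the fine sphere must have a complementary pair. -/
theorem exists_complementary (n : ℕ) (δ : ℝ) (hδ : 0 < δ)
    (lab : (Fin (n + 1) → ℝ) → Fin n ×ₗ Bool)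
    (hanti : ∀ x, ∑ j, |x j| = 1 → lab (-x) = flipLabel (lab x)) :
    ∃ x y : Fin (n + 1) → ℝ, ∑ j, |x j| = 1 ∧ ∑ j, |y j| = 1 ∧ dist x y ≤ δ ∧
      (ofLex (lab x)).1 = (ofLex (lab y)).1 ∧ lab x ≠ lab y := by
  by_contra! hcon
  obtain ⟨g, hg1, hg2, hg3⟩ := exists_fine_hemispheres n δ hδ
  have hgood : ∀ l : List (Fin (n + 1) → ℝ), (∀ x ∈ l, ∑ j, |x j| = 1) → Mesh δ l →
      ∀ x ∈ l.map lab, ∀ y ∈ l.map lab, (ofLex x).1 = (ofLex y).1 → x = y := by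
    intro l h1 h2 x hx y hy hxy
    simp only [List.mem_map] at hx hy
    obtain ⟨u, hu, rfl⟩ := hx
    obtain ⟨v, hv, rfl⟩ := hy
    exact hcon u v (h1 u hu) (h1 v hv) (h2 u hu v hv) hxy
  set F : Bool → Chain (Fin (n + 1) → ℝ) →ₗ[ZMod 2] ZMod 2 :=
    fun b => evalChain (fun l => altLabel b (l.map lab)) with hF
  have hbd : ∀ b c, F b (bdry c) = F b c + F (!b) c := by
    intro b c
    simp only [hF]
    rw [evalChain_bdry, ← evalChain_add]
    congr 1
    congr 1
    funext l
    rw [faceSum_map (altLabel b), faceSum_altLabel]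
  have hneg : ∀ i ≤ n, F true (push (fun x => -x) (g i)) = F false (g i) := by
    intro i hi
    have hcomp : F true (push (fun x => -x) (g i)) =
        evalChain (fun l => altLabel true ((l.map (fun x => -x)).map lab)) (g i) := by
      have : F true ∘ₗ push (fun x => -x) =
          evalChain (fun l => altLabel true ((l.map (fun x => -x)).map lab)) := by
        apply linearMap_ext_single
        intro l
        simp only [hF, LinearMap.comp_apply]
        rw [push_single, evalChain_single, evalChain_single]
      exact LinearMap.congr_fun this _
    rw [hcomp]
    refine evalChain_congr (hg3 i hi) ?_
    rintro l ⟨h1, h2, h3⟩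
    have : (l.map (fun x => -x)).map lab = (l.map lab).map flipLabel := by
      rw [List.map_map, List.map_map]
      apply List.map_congr_left
      intro x hx
      simp [hanti x (h2 x hx)]
    rw [this, altLabel_flip _ _ (hgood l h2 h3)]
    rfl
  have hone : ∀ i ≤ n, F true (g i) + F false (g i) = 1 := by
    intro i
    induction i with
    | zero =>
      intro _
      rw [hg2]
      simp only [hF]
      rw [evalChain_single, evalChain_single]
      simp only [List.map_cons, List.map_nil, altLabel, List.mergeSort_singleton, altInd]
      cases (ofLex (lab (unitVec n 0))).2 <;> simp
    | succ i ih =>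
      intro hi
      have h1 := hbd true (g (i + 1))
      rw [hg1, map_add, hneg i (by omega), ih (by omega)] at h1
      exact h1.symm
  have h1 := hone n le_rfl
  have h2 : ∃ b, F b (g n) ≠ 0 := by
    by_contra! hc
    rw [hc, hc] at h1
    simp at h1
  obtain ⟨b, hb⟩ := h2
  apply hb
  simp only [hF]
  rw [evalChain_congr (G' := fun _ => 0) (hg3 n le_rfl)]
  · simp [evalChain, Finsupp.linearCombination_apply]
  · rintro l ⟨h3, h4, h5⟩
    by_contra hne
    have := length_le_of_altLabel b (l.map lab) (hgood l h4 h5) hne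
    simp [h3] at this

/-- The **Borsuk–Ulam theorem** on the cross-polytope sphere. -/
theorem borsuk_ulam (n : ℕ) (f : (Fin (n + 1) → ℝ) → (Fin n → ℝ)) (hf : Continuous f)
    (hodd : ∀ x, f (-x) = - f x) : ∃ x, ∑ j, |x j| = 1 ∧ f x = 0 := by
  classical
  by_contra! hne
  set K : Set (Fin (n + 1) → ℝ) := {x | ∑ j, |x j| = 1} with hK
  have hKc : IsCompact K := by
    apply Metric.isCompact_of_isClosed_isBounded
    · exact isClosed_eq (by fun_prop) continuous_const
    · rw [Metric.isBounded_iff]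
      exact ⟨2, fun x hx y hy => dist_le_two_of_sum_abs hx hy⟩
  have hKne : K.Nonempty := by
    refine ⟨unitVec n 0, ?_⟩
    simp only [hK, Set.mem_ofPred_eq, unitVec]
    rw [Finset.sum_eq_single (0 : Fin (n + 1))]
    · simp
    · intro b _ hb
      have : b.val ≠ 0 := fun h => hb (Fin.ext h)
      simp [this]
    · simp
  obtain ⟨x₀, hx₀, hmin⟩ := hKc.exists_isMinOn hKne (f := fun x => ‖f x‖) (by fun_prop)
  set ε := ‖f x₀‖ with hε
  have hεpos : 0 < ε := norm_pos_iff.2 (hne x₀ hx₀)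
  have hge : ∀ x ∈ K, ε ≤ ‖f x‖ := fun x hx => hmin hx
  have hcoord : ∀ x ∈ K, ∃ i, ε ≤ |f x i| := by
    intro x hx
    by_contra! hc
    have := (pi_norm_lt_iff hεpos).2 (fun i => by rw [Real.norm_eq_abs]; exact hc i)
    exact absurd (hge x hx) (not_le.2 this)
  have hn : Nonempty (Fin n) := ⟨(hcoord x₀ hx₀).choose⟩
  set idx : (Fin (n + 1) → ℝ) → Fin n := fun x =>
    if h : ∃ i, ε ≤ |f x i| then h.choose else Classical.arbitrary _ with hidx
  have hidx1 : ∀ x ∈ K, ε ≤ |f x (idx x)| := by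
    intro x hx
    simp only [hidx]
    rw [dif_pos (hcoord x hx)]
    exact (hcoord x hx).choose_spec
  have hidx2 : ∀ x, idx (-x) = idx x := by
    intro x
    have : (fun i => ε ≤ |f (-x) i|) = fun i => ε ≤ |f x i| := by
      funext i; rw [hodd]; simp
    simp only [hidx, this]
  have hu := hKc.uniformContinuousOn_of_continuous hf.continuousOn
  rw [Metric.uniformContinuousOn_iff] at hu
  obtain ⟨δ, hδ, hu⟩ := hu ε hεpos
  obtain ⟨x, y, hx, hy, hxy, h1, h2⟩ := exists_complementary n (δ / 2) (by positivity)
    (fun x => toLex (idx x, decide (0 < f x (idx x)))) (by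
      intro x hx
      have h3 := hidx1 x hx
      simp only [flipLabel, hidx2, ofLex_toLex]
      congr 2
      rw [hodd]
      simp only [Pi.neg_apply, Left.neg_pos_iff]
      rcases lt_trichotomy (f x (idx x)) 0 with h | h | h
      · simp [h, h.le]
      · rw [h] at h3; simp at h3; linarith
      · simp [h, h.le])
  have h1' : idx x = idx y := h1
  have h3 := hu x hx y hy (by linarith)
  have h4 := hidx1 x hx
  have h5 := hidx1 y hy
  rw [← h1'] at h5
  have h6 : |f x (idx x) - f y (idx x)| < ε := by
    have := dist_le_pi_dist (f x) (f y) (idx x)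
    rw [Real.dist_eq] at this
    linarith
  apply h2
  rw [← h1']
  congr 2
  rw [abs_lt] at h6
  rw [decide_eq_decide]
  constructor
  · intro h; rw [abs_of_pos h] at h4; linarith
  · intro h; rw [abs_of_pos h] at h5; linarith

open Finset Filter Topology

/-- Truncation of a real number to `[-1, 1]`. -/
noncomputable def clamp (t : ℝ) : ℝ := max (-1) (min 1 t)

theorem clamp_neg (t : ℝ) : clamp (-t) = - clamp t := by
  simp only [clamp]
  rcases le_total t (-1) with h | h <;> rcases le_total t 1 with h' | h'
  all_goals
    simp only [max_def, min_def]; split_ifs <;> linarith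

theorem continuous_clamp : Continuous clamp := by unfold clamp; fun_prop

theorem neg_one_le_clamp (t : ℝ) : -1 ≤ clamp t := by simp [clamp]

theorem clamp_of_one_le {t : ℝ} (h : 1 ≤ t) : clamp t = 1 := by
  simp [clamp, h]

theorem card_pos_le_of_tendsto {X : Type*} {n : ℕ} (g : X → Fin n → ℝ) (S : Finset X)
    {v : ℕ → Fin n → ℝ} {w : Fin n → ℝ} (hlim : Tendsto v atTop (𝓝 w)) {φ : ℕ → ℕ}
    (hφ : Tendsto φ atTop atTop)
    (hv2 : ∀ m, ∑ x ∈ S, clamp ((φ m : ℝ) * ∑ j, v m j * g x j) = 0) :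
    2 * #{x ∈ S | 0 < ∑ j, w j * g x j} ≤ #S := by
  have hpos : ∀ x ∈ S, ∀ᶠ m in atTop, 0 < ∑ j, w j * g x j →
      clamp ((φ m : ℝ) * ∑ j, v m j * g x j) = 1 := by
    intro x _
    by_cases h : 0 < ∑ j, w j * g x j
    · have h1 : Tendsto (fun m => ∑ j, v m j * g x j) atTop (𝓝 (∑ j, w j * g x j)) := by
        refine tendsto_finsetSum _ fun j _ => ?_
        exact ((tendsto_pi_nhds.1 hlim) j).mul_const _
      have h2 : Tendsto (fun m => (φ m : ℝ)) atTop atTop :=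
        tendsto_natCast_atTop_atTop.comp hφ
      filter_upwards [(h2.atTop_mul_pos h h1).eventually_ge_atTop 1] with m hm _
      exact clamp_of_one_le hm
    · exact Eventually.of_forall fun m h' => absurd h' h
  obtain ⟨m, hm⟩ := ((eventually_all_finset S).2 hpos).exists
  have hz := hv2 m
  rw [← Finset.sum_filter_add_sum_filter_not S (fun x => 0 < ∑ j, w j * g x j)] at hz
  have h1 : ∑ x ∈ S with 0 < ∑ j, w j * g x j, clamp ((φ m : ℝ) * ∑ j, v m j * g x j)
      = #{x ∈ S | 0 < ∑ j, w j * g x j} := by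
    rw [Finset.sum_congr rfl (g := fun _ => (1 : ℝ))]
    · simp
    · intro x hx
      rw [Finset.mem_filter] at hx
      exact hm x hx.1 hx.2
  have h2 : -(#{x ∈ S | ¬ 0 < ∑ j, w j * g x j} : ℝ) ≤
      ∑ x ∈ S with ¬ 0 < ∑ j, w j * g x j, clamp ((φ m : ℝ) * ∑ j, v m j * g x j) := by
    have := Finset.card_nsmul_le_sum {x ∈ S | ¬ 0 < ∑ j, w j * g x j}
      (fun x => clamp ((φ m : ℝ) * ∑ j, v m j * g x j)) (-1) (fun x _ => neg_one_le_clamp _)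
    simpa using this
  have h3 := Finset.card_filter_add_card_filter_not (s := S) (fun x => 0 < ∑ j, w j * g x j)
  have h4 : (#{x ∈ S | 0 < ∑ j, w j * g x j} : ℝ) ≤
      #{x ∈ S | ¬ 0 < ∑ j, w j * g x j} := by linarith
  have h5 : #{x ∈ S | 0 < ∑ j, w j * g x j} ≤ #{x ∈ S | ¬ 0 < ∑ j, w j * g x j} := by
    exact_mod_cast h4
  omega

/-- Ham-sandwich theorem for finite point sets, for the linear combinations of `n + 1` functions. -/
theorem exists_bisecting {X : Type*} {n : ℕ} (g : X → Fin (n + 1) → ℝ) (S : Fin n → Finset X) :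
    ∃ v : Fin (n + 1) → ℝ, v ≠ 0 ∧ ∀ i,
      2 * #{x ∈ S i | 0 < ∑ j, v j * g x j} ≤ #(S i) ∧
      2 * #{x ∈ S i | ∑ j, v j * g x j < 0} ≤ #(S i) := by
  classical
  have hK : IsCompact {x : Fin (n + 1) → ℝ | ∑ j, |x j| = 1} := by
    apply Metric.isCompact_of_isClosed_isBounded
    · exact isClosed_eq (by fun_prop) continuous_const
    · rw [Metric.isBounded_iff]
      exact ⟨2, fun x hx y hy => dist_le_two_of_sum_abs hx hy⟩
  have hbu : ∀ m : ℕ, ∃ v : Fin (n + 1) → ℝ, ∑ j, |v j| = 1 ∧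
      (fun i => ∑ x ∈ S i, clamp ((m : ℝ) * ∑ j, v j * g x j)) = 0 := by
    intro m
    refine borsuk_ulam n (fun v i => ∑ x ∈ S i, clamp ((m : ℝ) * ∑ j, v j * g x j)) ?_ ?_
    · refine continuous_pi fun i => continuous_finsetSum _ fun x _ => continuous_clamp.comp ?_
      fun_prop
    · intro v
      funext i
      simp only [Pi.neg_apply, ← Finset.sum_neg_distrib]
      refine Finset.sum_congr rfl fun x _ => ?_
      rw [← clamp_neg]
      simp
  choose v hv1 hv2 using hbu
  obtain ⟨w, hw, φ, hφ, hlim⟩ := hK.tendsto_subseq hv1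
  refine ⟨w, ?_, ?_⟩
  · rintro rfl
    simp at hw
  · intro i
    have hz := fun m => congrFun (hv2 (φ m)) i
    simp only [Pi.zero_apply] at hz
    refine ⟨card_pos_le_of_tendsto g (S i) hlim hφ.tendsto_atTop hz, ?_⟩
    have := card_pos_le_of_tendsto g (S i) hlim.neg hφ.tendsto_atTop (fun m => by
      have h := hz m
      simp only [Function.comp_apply, Pi.neg_apply, neg_mul, Finset.sum_neg_distrib, mul_neg,
        clamp_neg, h, neg_zero])
    simpa using this

/-- Points of three-space, as coordinate triples. -/
abbrev Pt := Fin 3 → ℝ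

/-- Real polynomials in three variables. -/
abbrev Poly := MvPolynomial (Fin 3) ℝ

theorem exists_bisecting_poly (M : ℕ) {k : ℕ} (hk : k < M ^ 3) (S : Fin k → Finset Pt) :
    ∃ f : Poly, f ≠ 0 ∧ f.totalDegree ≤ 3 * M ∧ ∀ i,
      2 * #{x ∈ S i | 0 < MvPolynomial.eval x f} ≤ #(S i) ∧
      2 * #{x ∈ S i | MvPolynomial.eval x f < 0} ≤ #(S i) := by
  classical
  have hc : Fintype.card (Fin (k + 1)) ≤ Fintype.card (Fin 3 → Fin M) := by simp; omega
  obtain ⟨e⟩ := Function.Embedding.nonempty_of_card_le hc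
  set m : Fin (k + 1) → (Fin 3 →₀ ℕ) := fun j => Finsupp.equivFunOnFinite.symm fun i => (e j i : ℕ)
    with hm
  have hminj : Function.Injective m := by
    intro a b h
    apply e.injective
    funext i
    have := DFunLike.congr_fun h i
    simp only [hm, Finsupp.equivFunOnFinite_symm_apply_apply] at this
    exact Fin.ext this
  obtain ⟨v, hv, hS⟩ := exists_bisecting (fun (x : Pt) j => ∏ i, x i ^ (m j i)) S
  set f : Poly := ∑ j, MvPolynomial.monomial (m j) (v j) with hf
  have heval : ∀ x, MvPolynomial.eval x f = ∑ j, v j * ∏ i, x i ^ (m j i) := by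
    intro x
    simp only [hf, map_sum, MvPolynomial.eval_monomial]
    refine Finset.sum_congr rfl fun j _ => ?_
    rw [Finsupp.prod_fintype]
    simp
  refine ⟨f, ?_, ?_, ?_⟩
  · intro h0
    apply hv
    funext j
    have : MvPolynomial.coeff (m j) f = 0 := by rw [h0]; simp
    simpa [hf, MvPolynomial.coeff_sum, MvPolynomial.coeff_monomial, hminj.eq_iff] using this
  · refine (MvPolynomial.totalDegree_finsetSum _ _).trans (Finset.sup_le fun j _ => ?_)
    refine (MvPolynomial.totalDegree_monomial_le _ _).trans ?_
    rw [Finsupp.sum_fintype _ _ (by simp), Fin.sum_univ_three]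
    have h := fun i => (e j i).2
    have h0 := h 0
    have h1 := h 1
    have h2 := h 2
    simp only [hm, Finsupp.equivFunOnFinite_symm_apply_apply, id]
    omega
  · simpa only [heval] using hS

theorem sign_eq_of_segment {f : Poly} {x y : Pt}
    (h : ∀ z ∈ segment ℝ x y, MvPolynomial.eval z f ≠ 0) (hx : 0 < MvPolynomial.eval x f) :
    0 < MvPolynomial.eval y f := by
  by_contra! hy
  have hpc : IsPreconnected (segment ℝ x y) := (convex_segment x y).isPreconnected
  obtain ⟨z, hz, hz0⟩ := hpc.intermediate_value (right_mem_segment ℝ x y) (left_mem_segment ℝ x y)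
    (f := fun z => MvPolynomial.eval z f) (MvPolynomial.continuous_eval f).continuousOn
    (show (0 : ℝ) ∈ Set.Icc _ _ from ⟨hy, hx.le⟩)
  exact h z hz hz0

theorem partition_step (M : ℕ) {j : ℕ} (hj : 2 ^ j < M ^ 3) (S : Finset Pt) {F : Poly} (hF : F ≠ 0)
    {lab : Pt → ℕ} (hlt : ∀ x, lab x < 2 ^ j)
    (hseg : ∀ x y, (∀ z ∈ segment ℝ x y, MvPolynomial.eval z F ≠ 0) → lab x = lab y)
    (hcard : ∀ c, 2 ^ j * #{x ∈ S | MvPolynomial.eval x F ≠ 0 ∧ lab x = c} ≤ #S) :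
    ∃ F' : Poly, F' ≠ 0 ∧ F'.totalDegree ≤ F.totalDegree + 3 * M ∧ ∃ lab' : Pt → ℕ,
      (∀ x, lab' x < 2 ^ (j + 1)) ∧
      (∀ x y, (∀ z ∈ segment ℝ x y, MvPolynomial.eval z F' ≠ 0) → lab' x = lab' y) ∧
      ∀ c, 2 ^ (j + 1) * #{x ∈ S | MvPolynomial.eval x F' ≠ 0 ∧ lab' x = c} ≤ #S := by
  classical
  obtain ⟨f, hf0, hfd, hf⟩ := exists_bisecting_poly M hj
    (fun c : Fin (2 ^ j) => {x ∈ S | MvPolynomial.eval x F ≠ 0 ∧ lab x = c})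
  refine ⟨F * f, mul_ne_zero hF hf0, (MvPolynomial.totalDegree_mul _ _).trans (by omega),
    fun x => 2 * lab x + if 0 < MvPolynomial.eval x f then 1 else 0, ?_, ?_, ?_⟩
  · intro x
    have := hlt x
    rw [pow_succ]
    beta_reduce
    split_ifs <;> omega
  · intro x y h
    have h1 := hseg x y fun z hz h0 => h z hz (by simp [h0])
    have h2 : 0 < MvPolynomial.eval x f ↔ 0 < MvPolynomial.eval y f := by
      constructor
      · exact sign_eq_of_segment fun z hz h0 => h z hz (by simp [h0])
      · exact sign_eq_of_segment fun z hz h0 => h z (by rwa [segment_symm]) (by simp [h0])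
    simp only [h1, h2]
  · intro c
    by_cases hc : c / 2 < 2 ^ j
    · have h1 := hf ⟨c / 2, hc⟩
      have h2 := hcard (c / 2)
      simp only [Finset.filter_filter] at h1
      have h3 : 2 * #{x ∈ S | MvPolynomial.eval x (F * f) ≠ 0 ∧
          (2 * lab x + if 0 < MvPolynomial.eval x f then 1 else 0) = c} ≤
          #{x ∈ S | MvPolynomial.eval x F ≠ 0 ∧ lab x = c / 2} := by
        rcases Nat.mod_two_eq_zero_or_one c with h | h
        · refine le_trans (Nat.mul_le_mul_left _ (Finset.card_le_card ?_)) h1.2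
          intro x hx
          simp only [Finset.mem_filter, map_mul, mul_ne_zero_iff] at hx ⊢
          obtain ⟨a, ⟨b, d⟩, e⟩ := hx
          split_ifs at e with h0
          · omega
          · exact ⟨a, ⟨b, by omega⟩, lt_of_le_of_ne (not_lt.1 h0) d⟩
        · refine le_trans (Nat.mul_le_mul_left _ (Finset.card_le_card ?_)) h1.1
          intro x hx
          simp only [Finset.mem_filter, map_mul, mul_ne_zero_iff] at hx ⊢
          obtain ⟨a, ⟨b, d⟩, e⟩ := hx
          split_ifs at e with h0
          · exact ⟨a, ⟨b, by omega⟩, h0⟩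
          · omega
      rw [pow_succ, mul_assoc]
      exact (Nat.mul_le_mul_left _ h3).trans h2
    · have : #{x ∈ S | MvPolynomial.eval x (F * f) ≠ 0 ∧
          (2 * lab x + if 0 < MvPolynomial.eval x f then 1 else 0) = c} = 0 := by
        rw [Finset.card_eq_zero, Finset.filter_eq_empty_iff]
        rintro x hx ⟨-, h⟩
        have := hlt x
        split_ifs at h <;> omega
      rw [this]; omega

/-- **Polynomial partitioning** in three-space. -/
theorem exists_partition (S : Finset Pt) (I : ℕ) :
    ∃ F : Poly, F ≠ 0 ∧ F.totalDegree ≤ 18 * 2 ^ I ∧ ∃ lab : Pt → ℕ,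
      (∀ x, lab x < 2 ^ (3 * I)) ∧
      (∀ x y, (∀ z ∈ segment ℝ x y, MvPolynomial.eval z F ≠ 0) → lab x = lab y) ∧
      ∀ c, 2 ^ (3 * I) * #{x ∈ S | MvPolynomial.eval x F ≠ 0 ∧ lab x = c} ≤ #S := by
  induction I with
  | zero =>
    refine ⟨1, one_ne_zero, by simp, fun _ => 0, by simp, by simp, fun c => ?_⟩
    simpa using Finset.card_le_card (Finset.filter_subset (fun _ => 0 = c) S)
  | succ I ih =>
    obtain ⟨F, hF, hd, lab, h1, h2, h3⟩ := ih
    have hM : ∀ r, r < 3 → 2 ^ (3 * I + r) < (2 * 2 ^ I) ^ 3 := by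
      intro r hr
      rw [show (2 * 2 ^ I) ^ 3 = 2 ^ (3 * I + 3) by rw [← pow_succ', ← pow_mul]; congr 1; ring]
      exact Nat.pow_lt_pow_right (by norm_num) (by omega)
    obtain ⟨F, hF, hd1, lab, h1, h2, h3⟩ := partition_step _ (hM 0 (by norm_num)) S hF h1 h2 h3
    obtain ⟨F, hF, hd2, lab, h1, h2, h3⟩ := partition_step _ (hM 1 (by norm_num)) S hF h1 h2 h3
    obtain ⟨F, hF, hd3, lab, h1, h2, h3⟩ := partition_step _ (hM 2 (by norm_num)) S hF h1 h2 h3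
    refine ⟨F, hF, ?_, lab, h1, h2, h3⟩
    rw [pow_succ]
    omega

/-- Restriction of a polynomial to the parametrized line `t ↦ p + t • v`. -/
noncomputable def restr (p v : Pt) : Poly →ₐ[ℝ] Polynomial ℝ :=
  MvPolynomial.aeval fun i => Polynomial.C (p i) + Polynomial.C (v i) * Polynomial.X

theorem restr_X (p v : Pt) (i : Fin 3) : restr p v (MvPolynomial.X i) =
    Polynomial.C (p i) + Polynomial.C (v i) * Polynomial.X := by simp [restr]

theorem restr_C (p v : Pt) (a : ℝ) : restr p v (MvPolynomial.C a) = Polynomial.C a := by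
  simp [restr]

theorem eval_restr (p v : Pt) (f : Poly) (t : ℝ) :
    (restr p v f).eval t = MvPolynomial.eval (p + t • v) f := by
  induction f using MvPolynomial.induction_on with
  | C a => simp [restr]
  | add f g hf hg => simp [hf, hg]
  | mul_X f i hf =>
    rw [map_mul, Polynomial.eval_mul, hf, restr_X]
    simp only [Polynomial.eval_add, Polynomial.eval_mul, Polynomial.eval_C, Polynomial.eval_X,
      map_mul, MvPolynomial.eval_X, Pi.add_apply, Pi.smul_apply, smul_eq_mul, mul_comm t]

theorem natDegree_restr_le (p v : Pt) (f : Poly) : (restr p v f).natDegree ≤ f.totalDegree := by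
  have h1 : ∀ i, (Polynomial.C (p i) + Polynomial.C (v i) * Polynomial.X).natDegree ≤ 1 := by
    intro i
    refine (Polynomial.natDegree_add_le _ _).trans ?_
    simpa using Polynomial.natDegree_C_mul_le (v i) Polynomial.X
  rw [restr, MvPolynomial.aeval_def, MvPolynomial.eval₂_eq]
  refine Polynomial.natDegree_sum_le_of_forall_le _ _ fun d hd => ?_
  refine (Polynomial.natDegree_C_mul_le _ _).trans ?_
  refine (Polynomial.natDegree_prod_le _ _).trans ?_
  refine le_trans (Finset.sum_le_sum fun i _ => ?_) (MvPolynomial.le_totalDegree hd)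
  refine Polynomial.natDegree_pow_le.trans ?_
  simpa using Nat.mul_le_mul_left (d i) (h1 i)

theorem restr_eq_zero_iff (p v : Pt) (f : Poly) :
    restr p v f = 0 ↔ ∀ t : ℝ, MvPolynomial.eval (p + t • v) f = 0 := by
  constructor
  · intro h t; rw [← eval_restr, h]; simp
  · intro h
    apply Polynomial.funext
    intro t; rw [eval_restr, h]; simp

/-- The set of points of an affine line in three-space. -/
def lineSet (p v : Pt) : Set Pt := Set.range fun t : ℝ => p + t • v

/-- A set is an affine line. -/
def IsLine (l : Set Pt) : Prop := ∃ p v : Pt, v ≠ 0 ∧ l = lineSet p v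

/-- A polynomial vanishes on a set. -/
def VanishOn (f : Poly) (l : Set Pt) : Prop := ∀ x ∈ l, MvPolynomial.eval x f = 0

theorem vanishOn_lineSet (p v : Pt) (f : Poly) : VanishOn f (lineSet p v) ↔ restr p v f = 0 := by
  rw [restr_eq_zero_iff]
  simp [VanishOn, lineSet]

theorem lineSet_eq_of_mem {p v q : Pt} (h : q ∈ lineSet p v) : lineSet p v = lineSet q v := by
  obtain ⟨s, rfl⟩ := h
  ext x
  constructor
  · rintro ⟨t, rfl⟩; exact ⟨t - s, by simp only; module⟩
  · rintro ⟨t, rfl⟩; exact ⟨t + s, by simp only; module⟩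

theorem lineSet_smul (p v : Pt) {c : ℝ} (hc : c ≠ 0) : lineSet p (c • v) = lineSet p v := by
  ext x
  constructor
  · rintro ⟨t, rfl⟩; exact ⟨t * c, by simp only; module⟩
  · rintro ⟨t, rfl⟩; exact ⟨t / c, by simp only [smul_smul]; rw [div_mul_cancel₀ _ hc]⟩

theorem self_mem_lineSet (p v : Pt) : p ∈ lineSet p v := ⟨0, by simp⟩

theorem IsLine.exists_dir {l : Set Pt} (hl : IsLine l) {x : Pt} (hx : x ∈ l) :
    ∃ v : Pt, v ≠ 0 ∧ l = lineSet x v := by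
  obtain ⟨p, v, hv, rfl⟩ := hl
  exact ⟨v, hv, lineSet_eq_of_mem hx⟩

theorem IsLine.eq_lineSet_sub {l : Set Pt} (hl : IsLine l) {x y : Pt} (hx : x ∈ l) (hy : y ∈ l)
    (hxy : x ≠ y) : l = lineSet x (y - x) := by
  obtain ⟨v, hv, rfl⟩ := hl.exists_dir hx
  obtain ⟨t, rfl⟩ := hy
  have ht : t ≠ 0 := by rintro rfl; simp at hxy
  simp only [add_sub_cancel_left]
  rw [lineSet_smul _ _ ht]

theorem IsLine.eq_of_mem {l l' : Set Pt} (hl : IsLine l) (hl' : IsLine l') {x y : Pt}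
    (hx : x ∈ l) (hy : y ∈ l) (hx' : x ∈ l') (hy' : y ∈ l') (hxy : x ≠ y) : l = l' := by
  rw [hl.eq_lineSet_sub hx hy hxy, hl'.eq_lineSet_sub hx' hy' hxy]

theorem IsLine.nonempty {l : Set Pt} (hl : IsLine l) : l.Nonempty := by
  obtain ⟨p, v, -, rfl⟩ := hl
  exact ⟨p, self_mem_lineSet p v⟩

theorem lineSet_injective (p : Pt) {v : Pt} (hv : v ≠ 0) :
    Function.Injective fun t : ℝ => p + t • v := by
  intro s t h
  simp only [add_right_inj] at h
  exact smul_left_injective ℝ hv h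

theorem IsLine.infinite {l : Set Pt} (hl : IsLine l) : l.Infinite := by
  obtain ⟨p, v, hv, rfl⟩ := hl
  exact Set.infinite_range_of_injective (lineSet_injective p hv)

theorem IsLine.vanishOn_of_card {l : Set Pt} (hl : IsLine l) {f : Poly} {T : Finset Pt}
    (hT : ∀ x ∈ T, x ∈ l ∧ MvPolynomial.eval x f = 0) (hcard : f.totalDegree < #T) :
    VanishOn f l := by
  classical
  obtain ⟨p, v, hv, rfl⟩ := hl
  rw [vanishOn_lineSet]
  by_contra h0
  have hsub : T ⊆ ((restr p v f).roots.toFinset).image fun t : ℝ => p + t • v := by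
    intro x hx
    obtain ⟨⟨t, rfl⟩, h2⟩ := hT x hx
    refine Finset.mem_image.2 ⟨t, ?_, rfl⟩
    rw [Multiset.mem_toFinset, Polynomial.mem_roots h0, Polynomial.IsRoot, eval_restr]
    exact h2
  have h1 := (Finset.card_le_card hsub).trans Finset.card_image_le
  have h2 := Multiset.toFinset_card_le (restr p v f).roots
  have h3 := Polynomial.card_roots' (restr p v f)
  have h4 := natDegree_restr_le p v f
  omega

theorem VanishOn.mul_right {l : Set Pt} {f : Poly} (h : VanishOn f l) (g : Poly) :
    VanishOn (f * g) l := fun x hx => by simp [h x hx]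

theorem VanishOn.of_dvd {l : Set Pt} {f g : Poly} (h : VanishOn f l) (hfg : f ∣ g) :
    VanishOn g l := by
  obtain ⟨k, rfl⟩ := hfg
  exact h.mul_right k

theorem IsLine.vanishOn_prod {l : Set Pt} (hl : IsLine l) {ι : Type*} {s : Finset ι}
    {f : ι → Poly} (h : VanishOn (∏ i ∈ s, f i) l) : ∃ i ∈ s, VanishOn (f i) l := by
  obtain ⟨p, v, hv, rfl⟩ := hl
  simp only [vanishOn_lineSet, map_prod] at h ⊢
  exact Finset.prod_eq_zero_iff.1 h

/-- Distinct lines are separated by a polynomial of degree at most one. -/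
theorem exists_separating {l l' : Set Pt} (hl : IsLine l) (hl' : IsLine l') (hne : l ≠ l') :
    ∃ h : Poly, h.totalDegree ≤ 1 ∧ VanishOn h l' ∧ ¬ VanishOn h l := by
  obtain ⟨x, hx, hx'⟩ : ∃ x ∈ l, x ∉ l' := by
    by_contra! hc
    obtain ⟨x, hx, y, hy, hxy⟩ := hl.infinite.nontrivial
    exact hne (hl.eq_of_mem hl' hx hy (hc x hx) (hc y hy) hxy)
  obtain ⟨p, v, hv, rfl⟩ := hl'
  let h : Fin 3 → Fin 3 → Poly := fun j k =>
    MvPolynomial.C (v k) * (MvPolynomial.X j - MvPolynomial.C (p j)) -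
      MvPolynomial.C (v j) * (MvPolynomial.X k - MvPolynomial.C (p k))
  have hdeg : ∀ j k, (h j k).totalDegree ≤ 1 := by
    have h1 : ∀ a b k, (MvPolynomial.C a * (MvPolynomial.X k - MvPolynomial.C b) :
        Poly).totalDegree ≤ 1 := by
      intro a b k
      refine (MvPolynomial.totalDegree_mul _ _).trans ?_
      rw [MvPolynomial.totalDegree_C, zero_add]
      refine (MvPolynomial.totalDegree_sub _ _).trans ?_
      simp [MvPolynomial.totalDegree_X]
    intro j k
    exact (MvPolynomial.totalDegree_sub _ _).trans (max_le (h1 _ _ _) (h1 _ _ _))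
  have hvan : ∀ j k, VanishOn (h j k) (lineSet p v) := by
    rintro j k _ ⟨t, rfl⟩
    simp [h]; ring
  by_contra! hc
  have hx0 : ∀ j k, v k * (x j - p j) = v j * (x k - p k) := by
    intro j k
    have := hc _ (hdeg j k) (hvan j k) x hx
    simp only [h, map_sub, map_mul, MvPolynomial.eval_C, MvPolynomial.eval_X] at this
    linarith
  obtain ⟨k, hk⟩ := Function.ne_iff.1 hv
  simp only [Pi.zero_apply] at hk
  apply hx'
  refine ⟨(x k - p k) / v k, ?_⟩
  funext j
  have := hx0 j k
  simp only [Pi.add_apply, Pi.smul_apply, smul_eq_mul]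
  field_simp
  linarith

theorem finrank_restrictTotalDegree (m : ℕ) :
    6 * Module.finrank ℝ (MvPolynomial.restrictTotalDegree (Fin 3) ℝ m) =
      (m + 1) * (m + 2) * (m + 3) := by
  classical
  have h1 : ({n | (n.sum fun _ e => e) ≤ m} : Set (Fin 3 →₀ ℕ)) =
      ((Finset.range (m + 1)).biUnion fun k => Finset.finsuppAntidiag Finset.univ k :
        Finset (Fin 3 →₀ ℕ)) := by
    ext n
    simp [Finsupp.sum_fintype]
  have h2 : Module.finrank ℝ (MvPolynomial.restrictTotalDegree (Fin 3) ℝ m) =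
      Nat.card ({n | (n.sum fun _ e => e) ≤ m} : Set (Fin 3 →₀ ℕ)) :=
    Module.finrank_eq_nat_card_basis (MvPolynomial.basisRestrictSupport ℝ _)
  rw [h2, h1]
  rw [Nat.card_coe_set_eq, Set.ncard_coe_finset, Finset.card_biUnion]
  · simp_rw [Finset.card_finsuppAntidiag_nat_eq_choose]
    simp only [Finset.card_univ, Fintype.card_fin]
    have h3 : ∀ k, (3 + k - 1).choose k = (k + 2).choose 2 := by
      intro k
      rw [show 3 + k - 1 = k + 2 by omega, Nat.choose_symm_add]
    simp_rw [h3]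
    induction m with
    | zero => simp
    | succ m ih =>
      have := ih (by ext n; simp [Finsupp.sum_fintype])
        (Module.finrank_eq_nat_card_basis (MvPolynomial.basisRestrictSupport ℝ _))
      rw [Finset.sum_range_succ, mul_add, this]
      have h4 : 2 * (m + 1 + 2).choose 2 = (m + 3) * (m + 2) := by
        rw [Nat.choose_two_right]
        exact Nat.mul_div_cancel' (Nat.even_mul_pred_self _).two_dvd
      linarith
  · intro i _ j _ hij
    rw [Function.onFun, Finset.disjoint_left]
    intro n hi hj
    simp at hi hj
    exact hij (hi.symm.trans hj)

/-- The dimension count behind `card_lines_le`. -/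
theorem card_lines_mul_le {f g : Poly} (hf : Irreducible f) (hfg : ¬ f ∣ g) {L : Finset (Set Pt)}
    (hL : ∀ l ∈ L, IsLine l ∧ VanishOn f l ∧ VanishOn g l) (n K : ℕ)
    (hK : K + #L ≤ f.totalDegree + g.totalDegree + n + 2) :
    let V := fun m => Module.finrank ℝ (MvPolynomial.restrictTotalDegree (Fin 3) ℝ m)
    V (n + g.totalDegree) + V (n + f.totalDegree) + #L * K ≤
      V (f.totalDegree + g.totalDegree + n) + V n := by
  classical
  intro V
  have hsep : ∀ l l' : L, l ≠ l' → ∃ h : Poly, h.totalDegree ≤ 1 ∧ VanishOn h l'.1 ∧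
      ¬ VanishOn h l.1 := fun l l' h => exists_separating (hL l l.2).1 (hL l' l'.2).1
        (fun h' => h (Subtype.ext h'))
  choose! s hs1 hs2 hs3 using hsep
  have hpar : ∀ l : L, ∃ p v : Pt, v ≠ 0 ∧ l.1 = lineSet p v := fun l => (hL l l.2).1
  choose p v hv hl using hpar
  have hk : ∀ l : L, ∃ k, v l k ≠ 0 := fun l => Function.ne_iff.1 (hv l)
  choose k hk using hk
  let P : L → Poly := fun l => ∏ l' ∈ Finset.univ.erase l, s l l'
  have hP1 : ∀ l, ¬ VanishOn (P l) l.1 := by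
    intro l h
    obtain ⟨l', hl', h'⟩ := (hL l l.2).1.vanishOn_prod h
    exact hs3 l l' (Finset.ne_of_mem_erase hl').symm h'
  have hP2 : ∀ l l', l ≠ l' → VanishOn (P l) l'.1 := by
    intro l l' h
    exact (hs2 l l' h).of_dvd (Finset.dvd_prod_of_mem _ (by simp [h.symm]))
  have hP3 : ∀ l, (P l).totalDegree + 1 ≤ #L := by
    intro l
    have h1 : (P l).totalDegree ≤ ∑ l' ∈ Finset.univ.erase l, 1 :=
      (MvPolynomial.totalDegree_finsetProd _ _).trans
        (Finset.sum_le_sum fun l' hl' => hs1 l l' (Finset.ne_of_mem_erase hl').symm)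
    have h2 : 0 < #L := Finset.card_pos.2 ⟨l, l.2⟩
    rw [Finset.sum_const, Finset.card_erase_of_mem (Finset.mem_univ _)] at h1
    simp at h1
    omega
  let W := fun m => MvPolynomial.restrictTotalDegree (Fin 3) ℝ m
  let D := Polynomial.degreeLT ℝ K
  have : Module.Finite ℝ D := Module.Finite.equiv (Polynomial.degreeLTEquiv ℝ K).symm
  have hD : Module.finrank ℝ D = K := by
    rw [(Polynomial.degreeLTEquiv ℝ K).finrank_eq]; simp
  let ψ : (W (n + g.totalDegree) × W (n + f.totalDegree) × (L → D)) →ₗ[ℝ] Poly :=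
    ((LinearMap.mulLeft ℝ f) ∘ₗ (W _).subtype).coprod
      (((LinearMap.mulLeft ℝ g) ∘ₗ (W _).subtype).coprod
        (∑ l : L, (LinearMap.mulLeft ℝ (P l)) ∘ₗ
          (Polynomial.aeval (MvPolynomial.X (k l) : Poly)).toLinearMap ∘ₗ D.subtype ∘ₗ
            LinearMap.proj l))
  have hψ : ∀ a b h, ψ (a, b, h) = f * a + (g * b +
      ∑ l : L, P l * Polynomial.aeval (MvPolynomial.X (k l) : Poly) (h l : Polynomial ℝ)) := by
    intro a b h
    simp [ψ]
  have hrange : LinearMap.range ψ ≤ W (f.totalDegree + g.totalDegree + n) := by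
    rintro _ ⟨⟨a, b, h⟩, rfl⟩
    rw [hψ]
    have ha := (MvPolynomial.mem_restrictTotalDegree _ _ _).1 a.2
    have hb := (MvPolynomial.mem_restrictTotalDegree _ _ _).1 b.2
    refine (W _).add_mem ?_ ((W _).add_mem ?_ ((W _).sum_mem fun l _ => ?_))
    · rw [MvPolynomial.mem_restrictTotalDegree]
      have := MvPolynomial.totalDegree_mul f a
      omega
    · rw [MvPolynomial.mem_restrictTotalDegree]
      have := MvPolynomial.totalDegree_mul g b
      omega
    · rw [MvPolynomial.mem_restrictTotalDegree]
      by_cases h0 : (h l : Polynomial ℝ) = 0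
      · simp [h0]
      have h1 : (Polynomial.aeval (MvPolynomial.X (k l) : Poly) (h l : Polynomial ℝ)).totalDegree
          ≤ (h l : Polynomial ℝ).natDegree := by
        rw [Polynomial.aeval_eq_sum_range]
        refine (MvPolynomial.totalDegree_finsetSum _ _).trans (Finset.sup_le fun i hi => ?_)
        refine (MvPolynomial.totalDegree_smul_le _ _).trans ?_
        rw [MvPolynomial.totalDegree_X_pow]
        simpa [Nat.lt_succ_iff] using hi
      have h2 := MvPolynomial.totalDegree_mul (P l)
        (Polynomial.aeval (MvPolynomial.X (k l) : Poly) (h l : Polynomial ℝ))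
      have h3 := Polynomial.mem_degreeLT.1 (h l).2
      rw [← Polynomial.natDegree_lt_iff_degree_lt h0] at h3
      have h4 := hP3 l
      omega
  have hkey : ∀ a b h, ψ (a, b, h) = 0 → h = 0 ∧ f * a + g * b = 0 := by
    intro a b h h0
    rw [hψ] at h0
    have hh : h = 0 := by
      funext l
      have h1 := congrArg (restr (p l) (v l)) h0
      have h2 := (hL l l.2).2
      rw [hl l, vanishOn_lineSet, vanishOn_lineSet] at h2
      rw [map_add, map_mul, h2.1, map_add, map_mul, h2.2, zero_mul, zero_mul, zero_add, zero_add,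
        map_sum, map_zero, Finset.sum_eq_single l] at h1
      · rw [map_mul] at h1
        rcases mul_eq_zero.1 h1 with h3 | h3
        · rw [← vanishOn_lineSet, ← hl l] at h3
          exact absurd h3 (hP1 l)
        · have h4 : (h l : Polynomial ℝ).comp
              (Polynomial.C (p l (k l)) + Polynomial.C (v l (k l)) * Polynomial.X) = 0 := by
            rw [← h3, ← restr_X, ← Polynomial.aeval_algHom_apply]
            rfl
          rcases Polynomial.comp_eq_zero_iff.1 h4 with h5 | ⟨-, h5⟩
          · exact Subtype.ext h5
          · have h6 := congrArg (fun q => Polynomial.coeff q 1) h5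
            simp [Polynomial.coeff_C] at h6
            exact absurd h6 (hk l)
      · intro l' _ hne
        have := hP2 l' l hne
        rw [hl l, vanishOn_lineSet] at this
        rw [map_mul, this, zero_mul]
      · simp
    refine ⟨hh, ?_⟩
    simpa [hh] using h0
  let E : Submodule ℝ Poly := (W n).map (LinearMap.mulLeft ℝ f)
  have hker : ∀ x : LinearMap.ker ψ, (x.1.2.1 : Poly) ∈ E := by
    rintro ⟨⟨a, b, h⟩, hx⟩
    obtain ⟨-, h1⟩ := hkey a b h hx
    have h2 : f ∣ g * b := ⟨-a, by linear_combination h1⟩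
    obtain ⟨c, hc⟩ := ((hf.prime.dvd_or_dvd h2).resolve_left hfg)
    refine ⟨c, ?_, by simp [hc]⟩
    have hb := (MvPolynomial.mem_restrictTotalDegree _ _ _).1 b.2
    show c ∈ W n
    rw [MvPolynomial.mem_restrictTotalDegree]
    by_cases hc0 : c = 0
    · simp [hc0]
    · rw [hc, MvPolynomial.totalDegree_mul_of_isDomain hf.ne_zero hc0] at hb
      omega
  let θ : LinearMap.ker ψ →ₗ[ℝ] E :=
    LinearMap.codRestrict E ((W _).subtype ∘ₗ LinearMap.fst ℝ _ _ ∘ₗ LinearMap.snd ℝ _ _ ∘ₗ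
      (LinearMap.ker ψ).subtype) hker
  have hθ : Function.Injective θ := by
    rintro ⟨⟨a, b, h⟩, hx⟩ ⟨⟨a', b', h'⟩, hx'⟩ h0
    have hb : (b : Poly) = b' := congrArg (fun z : E => (z : Poly)) h0
    have hsub : ψ (a - a', b - b', h - h') = 0 := by
      have h3 := ψ.map_sub (a, b, h) (a', b', h')
      rw [LinearMap.mem_ker.1 hx, LinearMap.mem_ker.1 hx', sub_zero] at h3
      exact h3
    obtain ⟨h1, h2⟩ := hkey _ _ _ hsub
    have hb' : b = b' := Subtype.ext hb
    subst hb'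
    simp only [sub_self, ZeroMemClass.coe_zero, mul_zero, add_zero] at h2
    have ha := (mul_eq_zero.1 h2).resolve_left hf.ne_zero
    have ha' : a = a' := sub_eq_zero.1 (Subtype.ext ha)
    have hh' := sub_eq_zero.1 h1
    subst ha' hh'
    rfl
  have : Module.Finite ℝ (W n) := inferInstanceAs
    (Module.Finite ℝ (MvPolynomial.restrictTotalDegree (Fin 3) ℝ n))
  have h1 := LinearMap.finrank_le_finrank_of_injective hθ
  have h2 : Module.finrank ℝ E ≤ V n := Submodule.finrank_map_le _ _
  have h3 := LinearMap.finrank_range_add_finrank_ker ψ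
  have h4 := Submodule.finrank_mono hrange
  rw [Module.finrank_prod, Module.finrank_prod, Module.finrank_pi_fintype] at h3
  simp only [hD, Finset.sum_const, Finset.card_univ, Fintype.card_coe, smul_eq_mul] at h3
  change _ ≤ V _ at h4
  change _ = V _ + (V _ + _) at h3
  omega

/-- A **Bézout** bound for the number of common lines of two surfaces. -/
theorem card_lines_le {f g : Poly} (hf : Irreducible f) (hfg : ¬ f ∣ g) {L : Finset (Set Pt)}
    (hL : ∀ l ∈ L, IsLine l ∧ VanishOn f l ∧ VanishOn g l) :
    #L ≤ f.totalDegree * g.totalDegree := by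
  by_contra! hlt
  set a := f.totalDegree
  set b := g.totalDegree
  set n := #L * #L + a * b * (a + b) with hn
  have hnl : #L ≤ n := by
    have : #L ≤ #L * #L := Nat.le_mul_self _
    omega
  have h := card_lines_mul_le hf hfg hL n (a + b + n + 2 - #L) (by omega)
  have h1 := finrank_restrictTotalDegree (n + b)
  have h2 := finrank_restrictTotalDegree (n + a)
  have h3 := finrank_restrictTotalDegree (a + b + n)
  have h4 := finrank_restrictTotalDegree n
  simp only at h
  obtain ⟨K, hK⟩ : ∃ K, a + b + n + 2 = K + #L := ⟨a + b + n + 2 - #L, by omega⟩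
  change _ + _ + #L * (a + b + n + 2 - #L) ≤ _ at h
  rw [show a + b + n + 2 - #L = K by omega] at h
  have h5 : 2 * (#L * K) ≤ a * b * (2 * n + 4 + (a + b)) := by
    change 6 * _ = _ at h1 h2 h3 h4
    nlinarith [h, h1, h2, h3, h4]
  clear_value a b
  generalize #L = M at *
  have h6 : M * K + M * M = M * (a + b + n + 2) := by rw [hK]; ring
  have h7 : (a * b + 1) * (n + 2) ≤ M * (n + 2) := Nat.mul_le_mul_right _ hlt
  nlinarith [Nat.zero_le (M * (a + b)), Nat.zero_le (a * b * (a + b))]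

section algebra
variable {R : Type*} [CommRing R]

/-- Linear form with coefficients `g`. -/
def lin1 (g u : Fin 3 → R) : R := ∑ i, g i * u i

/-- Bilinear form with matrix `H`. -/
def bil (H : Fin 3 → Fin 3 → R) (u v : Fin 3 → R) : R := ∑ i, ∑ j, H i j * u i * v j

/-- Trilinear form with coefficients `T`. -/
def tri (T : Fin 3 → Fin 3 → Fin 3 → R) (u v w : Fin 3 → R) : R :=
  ∑ i, ∑ j, ∑ k, T i j k * u i * v j * w k

/-- Cross product. -/
def crs (e g : Fin 3 → R) : Fin 3 → R :=
  ![e 1 * g 2 - e 2 * g 1, e 2 * g 0 - e 0 * g 2, e 0 * g 1 - e 1 * g 0]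

theorem lin1_crs_self (e g : Fin 3 → R) : lin1 g (crs e g) = 0 := by
  simp [lin1, crs, Fin.sum_univ_three]; ring

theorem lin1_crs_left (e g : Fin 3 → R) : lin1 e (crs e g) = 0 := by
  simp [lin1, crs, Fin.sum_univ_three]; ring

theorem frame_identity (e e' g v : Fin 3 → R) (i : Fin 3) :
    lin1 g (crs e e') * v i = -lin1 e' v * crs e g i + lin1 e v * crs e' g i +
      lin1 g v * crs e e' i := by
  fin_cases i <;> simp [lin1, crs, Fin.sum_univ_three] <;> ring

theorem bil_add_smul (H : Fin 3 → Fin 3 → R) (x w : Fin 3 → R) (c : R) :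
    bil H (fun i => x i + c * w i) (fun i => x i + c * w i) =
      bil H x x + c * (bil H x w + bil H w x + c * bil H w w) := by
  simp only [bil, Fin.sum_univ_three]; ring

theorem bil_comb (H : Fin 3 → Fin 3 → R) (hH : ∀ i j, H i j = H j i) (a b : Fin 3 → R) (l m : R) :
    bil H (fun i => l * a i + m * b i) (fun i => l * a i + m * b i) =
      bil H a a * l ^ 2 + 2 * bil H a b * l * m + bil H b b * m ^ 2 := by
  simp only [bil, Fin.sum_univ_three]
  rw [hH 1 0, hH 2 0, hH 2 1]; ring

theorem bil_smul (H : Fin 3 → Fin 3 → R) (v : Fin 3 → R) (c : R) :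
    bil H (fun i => c * v i) (fun i => c * v i) = c ^ 2 * bil H v v := by
  simp only [bil, Fin.sum_univ_three]; ring

theorem tri_smul (T : Fin 3 → Fin 3 → Fin 3 → R) (v : Fin 3 → R) (c : R) :
    tri T (fun i => c * v i) (fun i => c * v i) (fun i => c * v i) = c ^ 3 * tri T v v v := by
  simp only [tri, Finset.mul_sum]
  refine Finset.sum_congr rfl fun i _ => Finset.sum_congr rfl fun j _ =>
    Finset.sum_congr rfl fun k _ => by ring

theorem tri_add (T : Fin 3 → Fin 3 → Fin 3 → R) (x y : Fin 3 → R) :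
    tri T (fun i => x i + y i) (fun i => x i + y i) (fun i => x i + y i) =
      tri T x x x + tri T x x y + tri T x y x + tri T y x x + tri T x y y + tri T y x y +
        tri T y y x + tri T y y y := by
  simp only [tri, ← Finset.sum_add_distrib]
  refine Finset.sum_congr rfl fun i _ => Finset.sum_congr rfl fun j _ =>
    Finset.sum_congr rfl fun k _ => by ring

theorem tri_smul₃ (T : Fin 3 → Fin 3 → Fin 3 → R) (x y z : Fin 3 → R) (a b c : R) :
    tri T (fun i => a * x i) (fun i => b * y i) (fun i => c * z i) = a * b * c * tri T x y z := by
  simp only [tri, Finset.mul_sum]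
  refine Finset.sum_congr rfl fun i _ => Finset.sum_congr rfl fun j _ =>
    Finset.sum_congr rfl fun k _ => by ring

theorem tri_smul_right (T : Fin 3 → Fin 3 → Fin 3 → R) (x y z : Fin 3 → R) (c : R) :
    tri T x y (fun i => c * z i) = c * tri T x y z := by
  simpa using tri_smul₃ T x y z 1 1 c

theorem tri_smul_mid (T : Fin 3 → Fin 3 → Fin 3 → R) (x y z : Fin 3 → R) (c : R) :
    tri T x (fun i => c * y i) z = c * tri T x y z := by
  simpa using tri_smul₃ T x y z 1 c 1

theorem tri_smul_left (T : Fin 3 → Fin 3 → Fin 3 → R) (x y z : Fin 3 → R) (c : R) :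
    tri T (fun i => c * x i) y z = c * tri T x y z := by
  simpa using tri_smul₃ T x y z c 1 1

theorem tri_add_smul (T : Fin 3 → Fin 3 → Fin 3 → R) (x w : Fin 3 → R) (c : R) :
    ∃ k, tri T (fun i => x i + c * w i) (fun i => x i + c * w i) (fun i => x i + c * w i) =
      tri T x x x + c * k := by
  refine ⟨tri T x x w + tri T x w x + tri T w x x + c * (tri T x w w + tri T w x w + tri T w w x +
    c * tri T w w w), ?_⟩
  rw [tri_add]
  simp only [tri_smul_left, tri_smul_mid, tri_smul_right]
  ring

theorem tri_comb (T : Fin 3 → Fin 3 → Fin 3 → R) (h1 : ∀ i j k, T i j k = T j i k)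
    (h2 : ∀ i j k, T i j k = T i k j) (a b : Fin 3 → R) (l m : R) :
    tri T (fun i => l * a i + m * b i) (fun i => l * a i + m * b i)
      (fun i => l * a i + m * b i) =
      tri T a a a * l ^ 3 + 3 * tri T a a b * l ^ 2 * m + 3 * tri T a b b * l * m ^ 2 +
        tri T b b b * m ^ 3 := by
  have s1 : ∀ x y z, tri T x y z = tri T y x z := by
    intro x y z
    simp only [tri]
    rw [Finset.sum_comm]
    refine Finset.sum_congr rfl fun i _ => Finset.sum_congr rfl fun j _ =>
      Finset.sum_congr rfl fun k _ => by rw [h1]; ring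
  have s2 : ∀ x y z, tri T x y z = tri T x z y := by
    intro x y z
    simp only [tri]
    refine Finset.sum_congr rfl fun i _ => ?_
    rw [Finset.sum_comm]
    refine Finset.sum_congr rfl fun j _ =>
      Finset.sum_congr rfl fun k _ => by rw [h2]; ring
  rw [tri_add]
  simp only [tri_smul_left, tri_smul_mid, tri_smul_right]
  rw [s2 a b a, s1 b a a, s2 a b a, s1 b a b, s2 b b a, s1 b a b]
  ring

/-- First coefficient of the remainder of the cubic form `(p, 3 * q, 3 * r, s)` modulo the
quadratic form `(α, 2 * β, γ)`. -/
def rem₁ (α β γ p q r : R) : R := α * (3 * α * r - γ * p) - 2 * β * (3 * α * q - 2 * β * p)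

/-- Second coefficient of the remainder of the cubic form `(p, 3 * q, 3 * r, s)` modulo the
quadratic form `(α, 2 * β, γ)`. -/
def rem₂ (α β γ p q s : R) : R := α ^ 2 * s - γ * (3 * α * q - 2 * β * p)

theorem cubic_division (α β γ p q r s l m : R) :
    α ^ 2 * (p * l ^ 3 + 3 * q * l ^ 2 * m + 3 * r * l * m ^ 2 + s * m ^ 3) =
      (α * p * l + (3 * α * q - 2 * β * p) * m) * (α * l ^ 2 + 2 * β * l * m + γ * m ^ 2) +
        rem₁ α β γ p q r * l * m ^ 2 + rem₂ α β γ p q s * m ^ 3 := by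
  simp only [rem₁, rem₂]; ring

theorem bil_frame (e e' g v : Fin 3 → R) (H : Fin 3 → Fin 3 → R) (hH : ∀ i j, H i j = H j i) :
    ∃ c, lin1 g (crs e e') ^ 2 * bil H v v =
      bil H (crs e g) (crs e g) * (-lin1 e' v) ^ 2 +
        2 * bil H (crs e g) (crs e' g) * (-lin1 e' v) * lin1 e v +
        bil H (crs e' g) (crs e' g) * lin1 e v ^ 2 + lin1 g v * c := by
  rw [← bil_smul, ← bil_comb H hH]
  simp only [frame_identity]
  exact ⟨_, bil_add_smul H _ _ _⟩

theorem tri_frame (e e' g v : Fin 3 → R) (T : Fin 3 → Fin 3 → Fin 3 → R)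
    (h1 : ∀ i j k, T i j k = T j i k) (h2 : ∀ i j k, T i j k = T i k j) :
    ∃ c, lin1 g (crs e e') ^ 3 * tri T v v v =
      tri T (crs e g) (crs e g) (crs e g) * (-lin1 e' v) ^ 3 +
        3 * tri T (crs e g) (crs e g) (crs e' g) * (-lin1 e' v) ^ 2 * lin1 e v +
        3 * tri T (crs e g) (crs e' g) (crs e' g) * (-lin1 e' v) * lin1 e v ^ 2 +
        tri T (crs e' g) (crs e' g) (crs e' g) * lin1 e v ^ 3 + lin1 g v * c := by
  rw [← tri_smul, ← tri_comb T h1 h2]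
  simp only [frame_identity]
  exact tri_add_smul T _ _ _

theorem map_lin1 {S : Type*} [CommRing S] (φ : R →+* S) (g u : Fin 3 → R) :
    φ (lin1 g u) = lin1 (fun i => φ (g i)) (fun i => φ (u i)) := by simp [lin1]

theorem map_bil {S : Type*} [CommRing S] (φ : R →+* S) (H : Fin 3 → Fin 3 → R) (u v : Fin 3 → R) :
    φ (bil H u v) = bil (fun i j => φ (H i j)) (fun i => φ (u i)) (fun i => φ (v i)) := by
  simp [bil]

theorem map_tri {S : Type*} [CommRing S] (φ : R →+* S) (T : Fin 3 → Fin 3 → Fin 3 → R)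
    (u v w : Fin 3 → R) : φ (tri T u v w) =
      tri (fun i j k => φ (T i j k)) (fun i => φ (u i)) (fun i => φ (v i)) (fun i => φ (w i)) := by
  simp [tri]

theorem map_crs {S : Type*} [CommRing S] (φ : R →+* S) (e g : Fin 3 → R) :
    (fun i => φ (crs e g i)) = crs (fun i => φ (e i)) (fun i => φ (g i)) := by
  funext i; fin_cases i <;> simp [crs]

end algebra

open MvPolynomial in
theorem pderiv_comm' (i j : Fin 3) (f : Poly) : pderiv i (pderiv j f) = pderiv j (pderiv i f) := by
  ext m
  simp only [coeff_pderiv]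
  by_cases h : i = j
  · rw [h]
  · have h' : j ≠ i := fun h' => h h'.symm
    rw [add_right_comm]
    simp [h, h']
    ring

theorem totalDegree_pderiv_le (i : Fin 3) (f : Poly) :
    (MvPolynomial.pderiv i f).totalDegree ≤ f.totalDegree - 1 := by
  rw [MvPolynomial.totalDegree]
  refine Finset.sup_le fun m hm => ?_
  rw [MvPolynomial.mem_support_iff, MvPolynomial.coeff_pderiv] at hm
  have h1 : m + Finsupp.single i 1 ∈ f.support := by
    rw [MvPolynomial.mem_support_iff]
    exact left_ne_zero_of_mul hm
  have h2 := MvPolynomial.le_totalDegree h1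
  rw [Finsupp.sum_add_index' (by simp) (by simp), Finsupp.sum_single_index rfl] at h2
  omega

theorem exists_pderiv_ne_zero {f : Poly} (hf : 0 < f.totalDegree) :
    ∃ i, MvPolynomial.pderiv i f ≠ 0 := by
  by_contra! hc
  refine hf.ne' (Nat.le_zero.1 ?_)
  rw [MvPolynomial.totalDegree]
  refine Finset.sup_le fun m hm => ?_
  have hm0 : m = 0 := by
    ext i
    by_contra hi
    have h := congrArg (MvPolynomial.coeff (m - Finsupp.single i 1)) (hc i)
    rw [MvPolynomial.coeff_pderiv] at h
    have h3 : m - Finsupp.single i 1 + Finsupp.single i 1 = m := by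
      apply tsub_add_cancel_of_le
      rw [Finsupp.single_le_iff]
      exact Nat.one_le_iff_ne_zero.2 hi
    rw [h3] at h
    simp only [MvPolynomial.coeff_zero, mul_eq_zero] at h
    rcases h with h | h
    · exact MvPolynomial.mem_support_iff.1 hm h
    · have : (0 : ℝ) ≤ ((m - Finsupp.single i 1 : Fin 3 →₀ ℕ) i : ℝ) := Nat.cast_nonneg _
      linarith
  simp [hm0]

/-- Gradient of a polynomial. -/
noncomputable def gr (f : Poly) : Fin 3 → Poly := fun i => MvPolynomial.pderiv i f

/-- Hessian of a polynomial. -/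
noncomputable def hs (f : Poly) : Fin 3 → Fin 3 → Poly :=
  fun i j => MvPolynomial.pderiv i (MvPolynomial.pderiv j f)

/-- Third derivatives of a polynomial. -/
noncomputable def th (f : Poly) : Fin 3 → Fin 3 → Fin 3 → Poly :=
  fun i j k => MvPolynomial.pderiv i (MvPolynomial.pderiv j (MvPolynomial.pderiv k f))

theorem hs_symm (f : Poly) (i j : Fin 3) : hs f i j = hs f j i := pderiv_comm' i j f

theorem th_symm₁ (f : Poly) (i j k : Fin 3) : th f i j k = th f j i k := pderiv_comm' i j _

theorem th_symm₂ (f : Poly) (i j k : Fin 3) : th f i j k = th f i k j := by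
  simp only [th]; rw [pderiv_comm' j k]

/-- A constant vector, as a polynomial vector. -/
noncomputable def cv (v : Pt) : Fin 3 → Poly := fun i => MvPolynomial.C (v i)

/-- Directional derivative. -/
noncomputable def dd (v : Pt) (f : Poly) : Poly := lin1 (gr f) (cv v)

theorem dd_dd (v : Pt) (f : Poly) : dd v (dd v f) = bil (hs f) (cv v) (cv v) := by
  simp only [dd, lin1, gr, cv, bil, hs, Fin.sum_univ_three, MvPolynomial.pderiv_mul,
    MvPolynomial.pderiv_C, mul_zero, add_zero, map_add]
  ring

theorem dd_dd_dd (v : Pt) (f : Poly) :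
    dd v (dd v (dd v f)) = tri (th f) (cv v) (cv v) (cv v) := by
  rw [dd_dd]
  simp only [dd, lin1, gr, cv, bil, hs, tri, th, Fin.sum_univ_three,
    MvPolynomial.pderiv_mul, MvPolynomial.pderiv_C, mul_zero, add_zero, map_add]
  ring

theorem dd_add (v : Pt) (f g : Poly) : dd v (f + g) = dd v f + dd v g := by
  simp only [dd, lin1, Fin.sum_univ_three, gr, map_add]
  ring

theorem dd_mul (v : Pt) (f g : Poly) : dd v (f * g) = dd v f * g + f * dd v g := by
  simp only [dd, lin1, Fin.sum_univ_three, gr, MvPolynomial.pderiv_mul]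
  ring

theorem dd_X (v : Pt) (i : Fin 3) : dd v (MvPolynomial.X i) = MvPolynomial.C (v i) := by
  simp only [dd, lin1, gr, cv]
  rw [Finset.sum_eq_single i]
  · simp
  · intro j _ hj
    rw [MvPolynomial.pderiv_X_of_ne hj.symm, zero_mul]
  · simp

theorem dd_C (v : Pt) (a : ℝ) : dd v (MvPolynomial.C a) = 0 := by
  simp [dd, gr, lin1]

theorem derivative_restr (p v : Pt) (f : Poly) :
    Polynomial.derivative (restr p v f) = restr p v (dd v f) := by
  induction f using MvPolynomial.induction_on with
  | C a => rw [restr_C, dd_C, map_zero, Polynomial.derivative_C]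
  | add f g hf hg =>
    rw [map_add, Polynomial.derivative_add, hf, hg, dd_add, map_add]
  | mul_X f i hf =>
    rw [map_mul, Polynomial.derivative_mul, hf, restr_X, dd_mul, dd_X,
      map_add (restr p v), map_mul (restr p v), map_mul (restr p v), restr_X, restr_C]
    simp

theorem X_pow_succ_dvd_of_derivative {φ : Polynomial ℝ} {k : ℕ}
    (h : Polynomial.X ^ k ∣ Polynomial.derivative φ) (h0 : φ.coeff 0 = 0) :
    Polynomial.X ^ (k + 1) ∣ φ := by
  rw [Polynomial.X_pow_dvd_iff] at h ⊢
  intro d hd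
  rcases d with _ | d
  · exact h0
  · have := h d (by omega)
    rw [Polynomial.coeff_derivative] at this
    rcases mul_eq_zero.1 this with h | h
    · exact h
    · have : (0 : ℝ) ≤ d := Nat.cast_nonneg _
      linarith

theorem X_pow_dvd_derivative {φ : Polynomial ℝ} {k : ℕ} (h : Polynomial.X ^ (k + 1) ∣ φ) :
    Polynomial.X ^ k ∣ Polynomial.derivative φ := by
  rw [Polynomial.X_pow_dvd_iff] at h ⊢
  intro d hd
  rw [Polynomial.coeff_derivative, h (d + 1) (by omega), zero_mul]

theorem eq_zero_of_linear_ode {φ c A B E : Polynomial ℝ} (hc : c.eval 0 ≠ 0)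
    (h : c * Polynomial.derivative (Polynomial.derivative (Polynomial.derivative φ)) =
      A * φ + B * Polynomial.derivative φ + E * Polynomial.derivative (Polynomial.derivative φ))
    (h0 : φ.eval 0 = 0) (h1 : (Polynomial.derivative φ).eval 0 = 0)
    (h2 : (Polynomial.derivative (Polynomial.derivative φ)).eval 0 = 0) : φ = 0 := by
  rw [← Polynomial.coeff_zero_eq_eval_zero] at h0 h1 h2
  have key : ∀ m : ℕ, Polynomial.X ^ (m + 3) ∣ φ := by
    intro m
    induction m with
    | zero =>
      exact X_pow_succ_dvd_of_derivative (X_pow_succ_dvd_of_derivative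
        (X_pow_succ_dvd_of_derivative (by simp) h2) h1) h0
    | succ m ih =>
      have d1 := X_pow_dvd_derivative ih
      have d2 := X_pow_dvd_derivative d1
      have hdvd : Polynomial.X ^ (m + 1) ∣
          c * Polynomial.derivative (Polynomial.derivative (Polynomial.derivative φ)) := by
        rw [h]
        refine dvd_add (dvd_add ?_ ?_) (d2.mul_left _)
        · exact ((pow_dvd_pow _ (by omega)).trans ih).mul_left _
        · exact ((pow_dvd_pow _ (by omega)).trans d1).mul_left _
      have d3 := Polynomial.prime_X.pow_dvd_of_dvd_mul_left (m + 1) (by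
        rw [Polynomial.X_dvd_iff, Polynomial.coeff_zero_eq_eval_zero]; exact hc) hdvd
      exact X_pow_succ_dvd_of_derivative (X_pow_succ_dvd_of_derivative
        (X_pow_succ_dvd_of_derivative d3 h2) h1) h0
  ext n
  exact (Polynomial.X_pow_dvd_iff.1 (key n)) n (by omega)

theorem eq_zero_of_linear_ode₂ {φ c A B : Polynomial ℝ} (hc : c.eval 0 ≠ 0)
    (h : c * Polynomial.derivative (Polynomial.derivative φ) =
      A * φ + B * Polynomial.derivative φ)
    (h0 : φ.eval 0 = 0) (h1 : (Polynomial.derivative φ).eval 0 = 0) : φ = 0 := by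
  have h2 : (Polynomial.derivative (Polynomial.derivative φ)).eval 0 = 0 := by
    have := congrArg (Polynomial.eval 0) h
    simp only [Polynomial.eval_mul, Polynomial.eval_add, h0, h1, mul_zero, add_zero] at this
    exact (mul_eq_zero.1 this).resolve_left hc
  refine eq_zero_of_linear_ode (A := Polynomial.derivative A)
    (B := A + Polynomial.derivative B) (E := B - Polynomial.derivative c) hc ?_ h0 h1 h2
  have := congrArg Polynomial.derivative h
  simp only [Polynomial.derivative_mul, Polynomial.derivative_add] at this
  linear_combination this

/-- If the third directional derivative is a combination of the lower ones, then a line of third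
order contact is contained in the surface. -/
theorem vanishOn_of_relation {f c A B E : Poly} {v p : Pt}
    (h : c * dd v (dd v (dd v f)) = A * f + B * dd v f + E * dd v (dd v f))
    (hc : MvPolynomial.eval p c ≠ 0) (h0 : MvPolynomial.eval p f = 0)
    (h1 : MvPolynomial.eval p (dd v f) = 0) (h2 : MvPolynomial.eval p (dd v (dd v f)) = 0) :
    VanishOn f (lineSet p v) := by
  rw [vanishOn_lineSet]
  have := congrArg (restr p v) h
  simp only [map_mul, map_add, ← derivative_restr] at this
  refine eq_zero_of_linear_ode (c := restr p v c) ?_ this ?_ ?_ ?_ <;>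
    simp only [derivative_restr, eval_restr, zero_smul, add_zero] <;> assumption

theorem vanishOn_of_relation₂ {f c A B : Poly} {v p : Pt}
    (h : c * dd v (dd v f) = A * f + B * dd v f)
    (hc : MvPolynomial.eval p c ≠ 0) (h0 : MvPolynomial.eval p f = 0)
    (h1 : MvPolynomial.eval p (dd v f) = 0) : VanishOn f (lineSet p v) := by
  rw [vanishOn_lineSet]
  have := congrArg (restr p v) h
  simp only [map_mul, map_add, ← derivative_restr] at this
  refine eq_zero_of_linear_ode₂ (c := restr p v c) ?_ this ?_ ?_ <;>
    simp only [derivative_restr, eval_restr, zero_smul, add_zero] <;> assumption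

theorem VanishOn.eval_dd {f : Poly} {p v : Pt} (h : VanishOn f (lineSet p v)) :
    VanishOn (dd v f) (lineSet p v) := by
  rw [vanishOn_lineSet] at h ⊢
  rw [← derivative_restr, h, map_zero]

theorem totalDegree_le_of_dvd {f g : Poly} (h : f ∣ g) (hg : g ≠ 0) :
    f.totalDegree ≤ g.totalDegree := by
  obtain ⟨k, rfl⟩ := h
  rw [MvPolynomial.totalDegree_mul_of_isDomain (left_ne_zero_of_mul hg) (right_ne_zero_of_mul hg)]
  exact Nat.le_add_right _ _

theorem exists_quadric (S : Finset Pt) (hS : #S ≤ 9) :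
    ∃ q : Poly, q ≠ 0 ∧ q.totalDegree ≤ 2 ∧ ∀ x ∈ S, MvPolynomial.eval x q = 0 := by
  classical
  let V := MvPolynomial.restrictTotalDegree (Fin 3) ℝ 2
  have hV : Module.finrank ℝ V = 10 := by
    have := finrank_restrictTotalDegree 2
    change Module.finrank ℝ (MvPolynomial.restrictTotalDegree (Fin 3) ℝ 2) = 10
    omega
  let ev : V →ₗ[ℝ] (S → ℝ) := LinearMap.pi fun x =>
    (MvPolynomial.aeval (R := ℝ) (x : Pt)).toLinearMap ∘ₗ V.subtype
  have hker : LinearMap.ker ev ≠ ⊥ := by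
    apply LinearMap.ker_ne_bot_of_finrank_lt
    rw [hV, Module.finrank_fintype_fun_eq_card, Fintype.card_coe]
    omega
  obtain ⟨q, hq, hq0⟩ := Submodule.exists_mem_ne_zero_of_ne_bot hker
  refine ⟨q, fun h => hq0 (Subtype.ext h), ?_, fun x hx => ?_⟩
  · exact (MvPolynomial.mem_restrictTotalDegree _ _ _).1 q.2
  · have := congrFun (LinearMap.mem_ker.1 hq) ⟨x, hx⟩
    simpa [ev, MvPolynomial.aeval_def, MvPolynomial.eval₂_eq_eval_map] using this

theorem exists_quadric_vanishOn (l : Fin 3 → Set Pt) (hl : ∀ i, IsLine (l i)) :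
    ∃ q : Poly, q ≠ 0 ∧ q.totalDegree ≤ 2 ∧ ∀ i, VanishOn q (l i) := by
  classical
  have h := fun i => (hl i).infinite.exists_subset_card_eq 3
  choose T hT hT3 using h
  obtain ⟨q, hq0, hq2, hq⟩ := exists_quadric (Finset.univ.biUnion T)
    (Finset.card_biUnion_le.trans (by simp [hT3]))
  refine ⟨q, hq0, hq2, fun i => (hl i).vanishOn_of_card (T := T i) (fun x hx => ⟨hT i hx, ?_⟩) ?_⟩
  · exact hq x (Finset.mem_biUnion.2 ⟨i, Finset.mem_univ _, hx⟩)
  · rw [hT3]; omega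

theorem dvd_of_infinite_lines {f g : Poly} (hf : Irreducible f) {L : Set (Set Pt)}
    (hL : L.Infinite) (h : ∀ l ∈ L, IsLine l ∧ VanishOn f l ∧ VanishOn g l) : f ∣ g := by
  by_contra hfg
  obtain ⟨S, hS, hcard⟩ := hL.exists_subset_card_eq (f.totalDegree * g.totalDegree + 1)
  have := card_lines_le hf hfg (L := S) fun l hl => h l (hS hl)
  omega

theorem mem_lineSet {p v : Pt} (t : ℝ) : p + t • v ∈ lineSet p v := ⟨t, rfl⟩

/-- An irreducible surface with two continuous families of lines near a point is a quadric. -/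
theorem totalDegree_le_two_of_double_ruling {f : Poly} (hf : Irreducible f) {p0 : Pt}
    (h0 : MvPolynomial.eval p0 f = 0) (φ ψ : Pt →ₗ[ℝ] ℝ) (V W : Pt → Pt)
    (hV : ContinuousAt V p0) (hW : ContinuousAt W p0)
    (hψ : ∀ᶠ x in 𝓝 p0, ψ (V x) = 1 ∧ ψ (W x) = 1) (hne : φ (V p0) ≠ φ (W p0))
    (hruled : ∀ᶠ x in 𝓝 p0, MvPolynomial.eval x f = 0 →
      VanishOn f (lineSet x (V x)) ∧ VanishOn f (lineSet x (W x)))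
    (hU : ∃ U ∈ 𝓝 p0, ∀ x ∈ U, ∀ y ∈ U, MvPolynomial.eval x f = 0 → MvPolynomial.eval y f = 0 →
      φ x = φ y → ψ x = ψ y → x = y) : f.totalDegree ≤ 2 := by
  classical
  obtain ⟨U, hU0, hU⟩ := hU
  have hφc : Continuous φ := φ.continuous_of_finiteDimensional
  have hψ0 := hψ.self_of_nhds
  have hr0 := hruled.self_of_nhds h0
  set a := φ (V p0) with ha
  set b := φ (W p0) with hb
  let y : ℝ → Pt := fun τ => p0 + τ • V p0
  let z : ℝ → Pt := fun s => p0 + s • W p0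
  have hyc : Continuous y := by fun_prop
  have hzc : Continuous z := by fun_prop
  have hy0 : y 0 = p0 := by simp [y]
  have hz0 : z 0 = p0 := by simp [z]
  have hyZ : ∀ τ, MvPolynomial.eval (y τ) f = 0 := fun τ => hr0.1 _ (mem_lineSet τ)
  have hzZ : ∀ s, MvPolynomial.eval (z s) f = 0 := fun s => hr0.2 _ (mem_lineSet s)
  have hyt : Tendsto y (𝓝 0) (𝓝 p0) := by simpa [hy0] using hyc.tendsto 0
  have hzt : Tendsto z (𝓝 0) (𝓝 p0) := by simpa [hz0] using hzc.tendsto 0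
  have hWy : Tendsto (fun τ => W (y τ)) (𝓝 0) (𝓝 (W p0)) := hW.tendsto.comp hyt
  have hVz : Tendsto (fun s => V (z s)) (𝓝 0) (𝓝 (V p0)) := hV.tendsto.comp hzt
  have hφWy : Tendsto (fun τ => φ (W (y τ))) (𝓝 0) (𝓝 b) := (hφc.tendsto _).comp hWy
  have hφVz : Tendsto (fun s => φ (V (z s))) (𝓝 0) (𝓝 a) := (hφc.tendsto _).comp hVz
  let t : ℝ → ℝ → ℝ := fun τ s =>
    (s * b - τ * a - (s - τ) * φ (W (y τ))) / (φ (W (y τ)) - φ (V (z s)))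
  let Q : ℝ → ℝ → Pt := fun τ s => z s + t τ s • V (z s)
  let R : ℝ → ℝ → Pt := fun τ s => y τ + (s + t τ s - τ) • W (y τ)
  have f1 : Tendsto (fun p : ℝ × ℝ => p.1) (𝓝 0 ×ˢ 𝓝 0) (𝓝 0) := tendsto_fst
  have f2 : Tendsto (fun p : ℝ × ℝ => p.2) (𝓝 0 ×ˢ 𝓝 0) (𝓝 0) := tendsto_snd
  have ht : Tendsto (fun p : ℝ × ℝ => t p.1 p.2) (𝓝 0 ×ˢ 𝓝 0) (𝓝 0) := by
    have := (((f2.mul_const b).sub (f1.mul_const a)).sub ((f2.sub f1).mul (hφWy.comp f1))).div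
      ((hφWy.comp f1).sub (hφVz.comp f2)) (sub_ne_zero.2 hne.symm)
    have e : (0 * b - 0 * a - (0 - 0) * b) / (b - a) = 0 := by simp
    rw [e] at this
    exact this
  have hQ : Tendsto (fun p : ℝ × ℝ => Q p.1 p.2) (𝓝 0 ×ˢ 𝓝 0) (𝓝 p0) := by
    simpa using (hzt.comp f2).add (ht.smul (hVz.comp f2))
  have hR : Tendsto (fun p : ℝ × ℝ => R p.1 p.2) (𝓝 0 ×ˢ 𝓝 0) (𝓝 p0) := by
    simpa using (hyt.comp f1).add (((f2.add ht).sub f1).smul (hWy.comp f1))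
  have hQR : ∀ᶠ p : ℝ × ℝ in 𝓝 0 ×ˢ 𝓝 0, Q p.1 p.2 = R p.1 p.2 := by
    have hden := ((hφWy.comp f1).sub (hφVz.comp f2)).eventually_ne (sub_ne_zero.2 hne.symm)
    filter_upwards [hQ.eventually_mem hU0, hR.eventually_mem hU0, hden,
      f1.eventually (hyt.eventually hruled), f2.eventually (hzt.eventually hruled),
      f1.eventually (hyt.eventually hψ), f2.eventually (hzt.eventually hψ)]
      with p hp1 hp2 hp3 hp4 hp5 hp6 hp7
    have hteq : t p.1 p.2 * (φ (W (y p.1)) - φ (V (z p.2))) =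
      p.2 * b - p.1 * a - (p.2 - p.1) * φ (W (y p.1)) := div_mul_cancel₀ _ hp3
    refine hU _ hp1 _ hp2 ((hp5 (hzZ _)).1 _ (mem_lineSet _)) ((hp4 (hyZ _)).2 _ (mem_lineSet _))
      ?_ ?_
    · simp only [Q, R, map_add, map_smul, smul_eq_mul, y, z, ← ha, ← hb] at hteq ⊢
      linarith
    · simp only [Q, R, map_add, map_smul, smul_eq_mul, hp6.2, hp7.1]
      simp only [y, z, map_add, map_smul, smul_eq_mul, hψ0.1, hψ0.2]
      ring
  have hG := (hQR.curry).and ((hyt.eventually hψ).and ((hyt.eventually hruled).and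
    (hφWy.eventually_ne hne.symm)))
  have h2 : Tendsto (fun τ : ℝ => 2 * τ) (𝓝 0) (𝓝 0) := by
    simpa using (tendsto_id (α := ℝ) (x := 𝓝 0)).const_mul 2
  obtain ⟨τ, ⟨⟨hτ1, hτψ, hτr, hτne⟩, hτ1', hτψ', hτr', hτne'⟩, hτ0⟩ :=
    (((hG.and (h2.eventually hG)).filter_mono nhdsWithin_le_nhds).and
      (self_mem_nhdsWithin : {x : ℝ | x ≠ 0} ∈ 𝓝[≠] (0 : ℝ))).exists
  have htc : ∀ τ : ℝ, φ (W (y τ)) ≠ a → Tendsto (t τ) (𝓝 0) (𝓝 τ) := by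
    intro τ hτ
    have h1 : Tendsto (fun s : ℝ => s) (𝓝 0) (𝓝 0) := tendsto_id
    have := (((h1.mul_const b).sub_const (τ * a)).sub
      ((h1.sub_const τ).mul_const (φ (W (y τ))))).div
      (hφVz.const_sub (φ (W (y τ)))) (sub_ne_zero.2 hτ)
    have e : (0 * b - τ * a - (0 - τ) * φ (W (y τ))) / (φ (W (y τ)) - a) = τ := by
      rw [div_eq_iff (sub_ne_zero.2 hτ)]; ring
    rw [e] at this
    exact this
  have ht1 := htc τ hτne
  have ht2 := htc (2 * τ) hτne'
  have hWne : ∀ x, ψ (W x) = 1 → W x ≠ 0 := by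
    intro x hx h
    rw [h, map_zero] at hx; exact zero_ne_one hx
  have hVne : ∀ x, ψ (V x) = 1 → V x ≠ 0 := by
    intro x hx h
    rw [h, map_zero] at hx; exact zero_ne_one hx
  obtain ⟨q, hq0, hq2, hq⟩ := exists_quadric_vanishOn
    ![lineSet p0 (W p0), lineSet (y τ) (W (y τ)), lineSet (y (2 * τ)) (W (y (2 * τ)))] (by
      intro i
      fin_cases i
      · exact ⟨_, _, hWne _ hψ0.2, rfl⟩
      · exact ⟨_, _, hWne _ hτψ.2, rfl⟩
      · exact ⟨_, _, hWne _ hτψ'.2, rfl⟩)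
  have hgood : ∀ᶠ s in 𝓝 (0 : ℝ), ψ (V (z s)) = 1 ∧ φ (V (z s)) ≠ b ∧
      VanishOn f (lineSet (z s) (V (z s))) ∧ VanishOn q (lineSet (z s) (V (z s))) := by
    filter_upwards [hτ1, hτ1', hzt.eventually hψ, hzt.eventually hruled,
      hφVz.eventually_ne hne, ht1.eventually_ne hτ0,
      ht2.eventually_ne (show 2 * τ ≠ 0 from mul_ne_zero two_ne_zero hτ0),
      (ht2.sub ht1).eventually_ne
        (show 2 * τ - τ ≠ 0 by rw [two_mul, add_sub_cancel_right]; exact hτ0)]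
      with s e1 e2 e3 e4 e5 e6 e7 e8
    refine ⟨e3.1, e5, (e4 (hzZ s)).1, ?_⟩
    have hinj := lineSet_injective (z s) (hVne _ e3.1)
    refine IsLine.vanishOn_of_card ⟨_, _, hVne _ e3.1, rfl⟩
      (T := {z s + (0 : ℝ) • V (z s), Q τ s, Q (2 * τ) s}) ?_ ?_
    · intro x hx
      simp only [Finset.mem_insert, Finset.mem_singleton] at hx
      rcases hx with rfl | rfl | rfl
      · refine ⟨mem_lineSet _, ?_⟩
        rw [zero_smul, add_zero]
        exact hq 0 _ (mem_lineSet s)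
      · refine ⟨mem_lineSet _, ?_⟩
        rw [e1]
        exact hq 1 _ (mem_lineSet _)
      · refine ⟨mem_lineSet _, ?_⟩
        rw [e2]
        exact hq 2 _ (mem_lineSet _)
    · rw [Finset.card_eq_three.2 ⟨_, _, _, ?_, ?_, ?_, rfl⟩]
      · omega
      · exact fun h => e6 (hinj h).symm
      · exact fun h => e7 (hinj h).symm
      · exact fun h => e8 (sub_eq_zero.2 (hinj h).symm)
  have hinf : {s : ℝ | ψ (V (z s)) = 1 ∧ φ (V (z s)) ≠ b ∧
      VanishOn f (lineSet (z s) (V (z s))) ∧ VanishOn q (lineSet (z s) (V (z s)))}.Infinite :=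
    infinite_of_mem_nhds 0 hgood
  have hdvd : f ∣ q := by
    refine dvd_of_infinite_lines hf (hinf.image (f := fun s => lineSet (z s) (V (z s))) ?_) ?_
    · intro s hs s' _ heq
      have hmem : z s' ∈ lineSet (z s) (V (z s)) := by
        simp only at heq
        rw [heq]
        exact ⟨0, by simp⟩
      obtain ⟨u, hu⟩ := hmem
      have hu1 := congrArg ψ hu
      have hu2 := congrArg φ hu
      simp only [map_add, map_smul, smul_eq_mul, hs.1] at hu1 hu2
      simp only [z, map_add, map_smul, smul_eq_mul, hψ0.2, ← hb] at hu1 hu2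
      by_contra hss
      apply hs.2.1
      have : u ≠ 0 := by
        rintro rfl
        apply hss; linarith
      apply mul_left_cancel₀ this
      have e : u = s' - s := by linarith
      simp only [z]
      calc _ = (s' - s) * b := by linarith
        _ = u * b := by rw [e]
    · rintro l ⟨s, hs, rfl⟩
      exact ⟨⟨_, _, hVne _ hs.1, rfl⟩, hs.2.2.1, hs.2.2.2⟩
  exact (totalDegree_le_of_dvd hdvd hq0).trans hq2

section pointwise
variable (e e' g : Fin 3 → ℝ) (H : Fin 3 → Fin 3 → ℝ) (T : Fin 3 → Fin 3 → Fin 3 → ℝ)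

theorem frame_eq {v : Pt} (hv : lin1 g v = 0) :
    lin1 g (crs e e') • v = (-lin1 e' v) • crs e g + lin1 e v • crs e' g := by
  funext i
  have := frame_identity e e' g v i
  rw [hv, zero_mul, add_zero] at this
  simpa using this

theorem bil_frame_real (hH : ∀ i j, H i j = H j i) {v : Pt} (hv : lin1 g v = 0) :
    lin1 g (crs e e') ^ 2 * bil H v v =
      bil H (crs e g) (crs e g) * (-lin1 e' v) ^ 2 +
        2 * bil H (crs e g) (crs e' g) * (-lin1 e' v) * lin1 e v +
        bil H (crs e' g) (crs e' g) * lin1 e v ^ 2 := by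
  obtain ⟨c, hc⟩ := bil_frame e e' g v H hH
  rw [hc, hv]; ring

theorem tri_frame_real (h1 : ∀ i j k, T i j k = T j i k) (h2 : ∀ i j k, T i j k = T i k j)
    {v : Pt} (hv : lin1 g v = 0) : lin1 g (crs e e') ^ 3 * tri T v v v =
      tri T (crs e g) (crs e g) (crs e g) * (-lin1 e' v) ^ 3 +
        3 * tri T (crs e g) (crs e g) (crs e' g) * (-lin1 e' v) ^ 2 * lin1 e v +
        3 * tri T (crs e g) (crs e' g) (crs e' g) * (-lin1 e' v) * lin1 e v ^ 2 +
        tri T (crs e' g) (crs e' g) (crs e' g) * lin1 e v ^ 3 := by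
  obtain ⟨c, hc⟩ := tri_frame e e' g v T h1 h2
  rw [hc, hv]; ring

variable {e e' g H}

theorem lin1_ne_zero_of_asymptotic (hH : ∀ i j, H i j = H j i) (hn : lin1 g (crs e e') ≠ 0)
    (hα : bil H (crs e g) (crs e g) ≠ 0) {v : Pt} (hv0 : v ≠ 0) (hv : lin1 g v = 0)
    (hvv : bil H v v = 0) : lin1 e v ≠ 0 := by
  intro hμ
  have h := bil_frame_real e e' g H hH hv
  rw [hvv, hμ] at h
  have hl : lin1 e' v = 0 := by
    by_contra hl
    have : bil H (crs e g) (crs e g) * (-lin1 e' v) ^ 2 ≠ 0 :=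
      mul_ne_zero hα (pow_ne_zero _ (neg_ne_zero.2 hl))
    apply this; linarith
  have h3 := frame_eq e e' g hv
  rw [hμ, hl, neg_zero, zero_smul, zero_smul, add_zero] at h3
  exact (smul_ne_zero hn hv0) h3

theorem det_ne_zero_of_not_parallel (hn : lin1 g (crs e e') ≠ 0) {v w : Pt}
    (hv : lin1 g v = 0) (hw : lin1 g w = 0) (hv' : lin1 e v ≠ 0) (hw' : lin1 e w ≠ 0)
    (hp : ∀ c d : ℝ, c ≠ 0 → d ≠ 0 → c • v ≠ d • w) :
    -lin1 e' v * lin1 e w ≠ -lin1 e' w * lin1 e v := by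
  intro hdet
  refine hp (lin1 e w) (lin1 e v) hw' hv' ?_
  have h1 := frame_eq e e' g hv
  have h2 := frame_eq e e' g hw
  apply smul_right_injective Pt hn
  change lin1 g (crs e e') • lin1 e w • v = lin1 g (crs e e') • lin1 e v • w
  rw [smul_comm _ (lin1 e w), smul_comm _ (lin1 e v), h1, h2]
  rw [smul_add, smul_add, smul_smul, smul_smul, smul_smul, smul_smul, mul_comm (lin1 e w), hdet]
  rw [mul_comm (lin1 e v) (-_), mul_comm (lin1 e v) (lin1 e w)]

theorem rem_eq_zero_of_two_lines (hH : ∀ i j, H i j = H j i) (h1 : ∀ i j k, T i j k = T j i k)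
    (h2 : ∀ i j k, T i j k = T i k j) (hn : lin1 g (crs e e') ≠ 0)
    (hα : bil H (crs e g) (crs e g) ≠ 0) {v w : Pt} (hv0 : v ≠ 0) (hw0 : w ≠ 0)
    (hv : lin1 g v = 0) (hw : lin1 g w = 0) (hvv : bil H v v = 0) (hww : bil H w w = 0)
    (hvvv : tri T v v v = 0) (hwww : tri T w w w = 0)
    (hp : ∀ c d : ℝ, c ≠ 0 → d ≠ 0 → c • v ≠ d • w) :
    rem₁ (bil H (crs e g) (crs e g)) (bil H (crs e g) (crs e' g)) (bil H (crs e' g) (crs e' g))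
      (tri T (crs e g) (crs e g) (crs e g)) (tri T (crs e g) (crs e g) (crs e' g))
      (tri T (crs e g) (crs e' g) (crs e' g)) = 0 ∧
    rem₂ (bil H (crs e g) (crs e g)) (bil H (crs e g) (crs e' g)) (bil H (crs e' g) (crs e' g))
      (tri T (crs e g) (crs e g) (crs e g)) (tri T (crs e g) (crs e g) (crs e' g))
      (tri T (crs e' g) (crs e' g) (crs e' g)) = 0 := by
  have key : ∀ u : Pt, u ≠ 0 → lin1 g u = 0 → bil H u u = 0 → tri T u u u = 0 →
    rem₁ (bil H (crs e g) (crs e g)) (bil H (crs e g) (crs e' g)) (bil H (crs e' g) (crs e' g))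
      (tri T (crs e g) (crs e g) (crs e g)) (tri T (crs e g) (crs e g) (crs e' g))
      (tri T (crs e g) (crs e' g) (crs e' g)) * (-lin1 e' u) +
    rem₂ (bil H (crs e g) (crs e g)) (bil H (crs e g) (crs e' g)) (bil H (crs e' g) (crs e' g))
      (tri T (crs e g) (crs e g) (crs e g)) (tri T (crs e g) (crs e g) (crs e' g))
      (tri T (crs e' g) (crs e' g) (crs e' g)) * lin1 e u = 0 := by
    intro u hu0 hu huu huuu
    have hμ := lin1_ne_zero_of_asymptotic hH hn hα hu0 hu huu
    have hb := bil_frame_real e e' g H hH hu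
    have ht := tri_frame_real e e' g T h1 h2 hu
    rw [huu, mul_zero] at hb
    rw [huuu, mul_zero] at ht
    have hc := cubic_division (bil H (crs e g) (crs e g)) (bil H (crs e g) (crs e' g))
      (bil H (crs e' g) (crs e' g)) (tri T (crs e g) (crs e g) (crs e g))
      (tri T (crs e g) (crs e g) (crs e' g)) (tri T (crs e g) (crs e' g) (crs e' g))
      (tri T (crs e' g) (crs e' g) (crs e' g)) (-lin1 e' u) (lin1 e u)
    rw [← ht, ← hb] at hc
    have : lin1 e u ^ 2 ≠ 0 := pow_ne_zero _ hμ
    apply mul_left_cancel₀ this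
    linear_combination -hc
  have kv := key v hv0 hv hvv hvvv
  have kw := key w hw0 hw hww hwww
  have hdet := det_ne_zero_of_not_parallel hn hv hw
    (lin1_ne_zero_of_asymptotic hH hn hα hv0 hv hvv)
    (lin1_ne_zero_of_asymptotic hH hn hα hw0 hw hww) hp
  have hdet' := sub_ne_zero.2 hdet
  constructor
  · refine (mul_eq_zero.1 ?_).resolve_right hdet'
    linear_combination lin1 e w * kv - lin1 e v * kw
  · refine (mul_eq_zero.1 ?_).resolve_right hdet'
    linear_combination lin1 e' w * kv - lin1 e' v * kw

end pointwise

/-- Derivative of `f` along the kernel of the projection attached to the frame `u, v`. -/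
noncomputable def fn (f : Poly) (u v : Pt) : Poly := lin1 (gr f) (crs (cv u) (cv v))

/-- Coefficients of the second fundamental form in the frame attached to `u, v`. -/
noncomputable def sff (f : Poly) (u v : Pt) : Poly :=
  bil (hs f) (crs (cv u) (gr f)) (crs (cv v) (gr f))

/-- Coefficients of the third fundamental form in the frame attached to `e₁, e₂, e₃`. -/
noncomputable def tff (f : Poly) (e₁ e₂ e₃ : Pt) : Poly :=
  tri (th f) (crs (cv e₁) (gr f)) (crs (cv e₂) (gr f)) (crs (cv e₃) (gr f))

noncomputable def frem₁ (f : Poly) (e e' : Pt) : Poly :=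
  rem₁ (sff f e e) (sff f e e') (sff f e' e') (tff f e e e) (tff f e e e') (tff f e e' e')

noncomputable def frem₂ (f : Poly) (e e' : Pt) : Poly :=
  rem₂ (sff f e e) (sff f e e') (sff f e' e') (tff f e e e) (tff f e e e') (tff f e' e' e')

theorem relation_of_dvd_sff {f : Poly} {e e' : Pt} (h1 : f ∣ sff f e e) (h2 : f ∣ sff f e e')
    (h3 : f ∣ sff f e' e') (v : Pt) :
    ∃ A B, fn f e e' ^ 2 * dd v (dd v f) = A * f + B * dd v f := by
  obtain ⟨c, hc⟩ := bil_frame (cv e) (cv e') (gr f) (cv v) (hs f) (hs_symm f)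
  obtain ⟨k1, hk1⟩ := h1
  obtain ⟨k2, hk2⟩ := h2
  obtain ⟨k3, hk3⟩ := h3
  simp only [sff] at hk1 hk2 hk3
  rw [hk1, hk2, hk3] at hc
  refine ⟨k1 * (-lin1 (cv e') (cv v)) ^ 2 + 2 * k2 * (-lin1 (cv e') (cv v)) * lin1 (cv e) (cv v) +
    k3 * lin1 (cv e) (cv v) ^ 2, c, ?_⟩
  rw [dd_dd, fn, hc, dd]
  ring

theorem relation_of_dvd_rem {f : Poly} {e e' : Pt} (h1 : f ∣ frem₁ f e e') (h2 : f ∣ frem₂ f e e')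
    (v : Pt) : ∃ A B E, (sff f e e ^ 2 * fn f e e' ^ 3) * dd v (dd v (dd v f)) =
      A * f + B * dd v f + E * dd v (dd v f) := by
  obtain ⟨c, hc⟩ := bil_frame (cv e) (cv e') (gr f) (cv v) (hs f) (hs_symm f)
  obtain ⟨c', hc'⟩ := tri_frame (cv e) (cv e') (gr f) (cv v) (th f) (th_symm₁ f) (th_symm₂ f)
  obtain ⟨k1, hk1⟩ := h1
  obtain ⟨k2, hk2⟩ := h2
  have hd := cubic_division (sff f e e) (sff f e e') (sff f e' e') (tff f e e e) (tff f e e e')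
    (tff f e e' e') (tff f e' e' e') (-lin1 (cv e') (cv v)) (lin1 (cv e) (cv v))
  rw [← frem₁, ← frem₂, hk1, hk2] at hd
  rw [← dd_dd_dd] at hc'
  rw [← dd_dd] at hc
  change fn f e e' ^ 2 * _ = sff f e e * _ + 2 * sff f e e' * _ * _ + sff f e' e' * _ +
    dd v f * c at hc
  change fn f e e' ^ 3 * _ = tff f e e e * _ + 3 * tff f e e e' * _ * _ +
    3 * tff f e e' e' * _ * _ + tff f e' e' e' * _ + dd v f * c' at hc'
  generalize -lin1 (cv e') (cv v) = l at *
  generalize lin1 (cv e) (cv v) = m at *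
  refine ⟨k1 * l * m ^ 2 + k2 * m ^ 3,
    sff f e e ^ 2 * c' - (sff f e e * tff f e e e * l +
      (3 * sff f e e * tff f e e e' - 2 * sff f e e' * tff f e e e) * m) * c,
    (sff f e e * tff f e e e * l +
      (3 * sff f e e * tff f e e e' - 2 * sff f e e' * tff f e e e) * m) * fn f e e' ^ 2, ?_⟩
  linear_combination hd + sff f e e ^ 2 * hc' - (sff f e e * tff f e e e * l +
      (3 * sff f e e * tff f e e e' - 2 * sff f e e' * tff f e e e) * m) * hc

section degree

theorem totalDegree_sum_le_of_forall {ι : Type*} (s : Finset ι) (f : ι → Poly) {m : ℕ}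
    (h : ∀ i ∈ s, (f i).totalDegree ≤ m) : (∑ i ∈ s, f i).totalDegree ≤ m :=
  (MvPolynomial.totalDegree_finsetSum s f).trans (Finset.sup_le h)

theorem totalDegree_mul_le_of {f g : Poly} {a b : ℕ} (hf : f.totalDegree ≤ a)
    (hg : g.totalDegree ≤ b) : (f * g).totalDegree ≤ a + b :=
  (MvPolynomial.totalDegree_mul f g).trans (add_le_add hf hg)

theorem totalDegree_sub_le_of {f g : Poly} {a : ℕ} (hf : f.totalDegree ≤ a)
    (hg : g.totalDegree ≤ a) : (f - g).totalDegree ≤ a :=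
  (MvPolynomial.totalDegree_sub f g).trans (max_le hf hg)

theorem totalDegree_lin1_le {g u : Fin 3 → Poly} {a b : ℕ} (hg : ∀ i, (g i).totalDegree ≤ a)
    (hu : ∀ i, (u i).totalDegree ≤ b) : (lin1 g u).totalDegree ≤ a + b :=
  totalDegree_sum_le_of_forall _ _ fun i _ => totalDegree_mul_le_of (hg i) (hu i)

theorem totalDegree_bil_le {H : Fin 3 → Fin 3 → Poly} {u v : Fin 3 → Poly} {a b c : ℕ}
    (hH : ∀ i j, (H i j).totalDegree ≤ a) (hu : ∀ i, (u i).totalDegree ≤ b)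
    (hv : ∀ i, (v i).totalDegree ≤ c) : (bil H u v).totalDegree ≤ a + b + c :=
  totalDegree_sum_le_of_forall _ _ fun i _ => totalDegree_sum_le_of_forall _ _ fun j _ =>
    totalDegree_mul_le_of (totalDegree_mul_le_of (hH i j) (hu i)) (hv j)

theorem totalDegree_tri_le {T : Fin 3 → Fin 3 → Fin 3 → Poly} {u v w : Fin 3 → Poly} {a b c d : ℕ}
    (hT : ∀ i j k, (T i j k).totalDegree ≤ a) (hu : ∀ i, (u i).totalDegree ≤ b)
    (hv : ∀ i, (v i).totalDegree ≤ c) (hw : ∀ i, (w i).totalDegree ≤ d) :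
    (tri T u v w).totalDegree ≤ a + b + c + d :=
  totalDegree_sum_le_of_forall _ _ fun i _ => totalDegree_sum_le_of_forall _ _ fun j _ =>
    totalDegree_sum_le_of_forall _ _ fun k _ => totalDegree_mul_le_of
      (totalDegree_mul_le_of (totalDegree_mul_le_of (hT i j k) (hu i)) (hv j)) (hw k)

theorem totalDegree_crs_le {e g : Fin 3 → Poly} {a b : ℕ} (he : ∀ i, (e i).totalDegree ≤ a)
    (hg : ∀ i, (g i).totalDegree ≤ b) (i : Fin 3) : (crs e g i).totalDegree ≤ a + b := by
  fin_cases i <;>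
  exact totalDegree_sub_le_of (totalDegree_mul_le_of (he _) (hg _))
    (totalDegree_mul_le_of (he _) (hg _))

theorem totalDegree_cv (e : Pt) (i : Fin 3) : (cv e i).totalDegree ≤ 0 := by simp [cv]

theorem totalDegree_gr (f : Poly) (i : Fin 3) : (gr f i).totalDegree ≤ f.totalDegree :=
  (totalDegree_pderiv_le i f).trans (Nat.sub_le _ _)

theorem totalDegree_hs (f : Poly) (i j : Fin 3) : (hs f i j).totalDegree ≤ f.totalDegree :=
  (totalDegree_gr _ i).trans (totalDegree_gr f j)

theorem totalDegree_th (f : Poly) (i j k : Fin 3) : (th f i j k).totalDegree ≤ f.totalDegree :=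
  (totalDegree_gr _ i).trans (totalDegree_hs f j k)

theorem totalDegree_fn (f : Poly) (e e' : Pt) : (fn f e e').totalDegree ≤ f.totalDegree := by
  have := totalDegree_lin1_le (totalDegree_gr f) (totalDegree_crs_le (totalDegree_cv e)
    (totalDegree_cv e'))
  simpa [fn] using this

theorem totalDegree_frame (f : Poly) (e : Pt) (i : Fin 3) :
    (crs (cv e) (gr f) i).totalDegree ≤ f.totalDegree := by
  have := totalDegree_crs_le (totalDegree_cv e) (totalDegree_gr f) i
  simpa using this

theorem totalDegree_sff (f : Poly) (e e' : Pt) : (sff f e e').totalDegree ≤ 3 * f.totalDegree := by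
  have := totalDegree_bil_le (totalDegree_hs f) (totalDegree_frame f e) (totalDegree_frame f e')
  simp only [sff]; omega

theorem totalDegree_tff (f : Poly) (e e' e'' : Pt) :
    (tff f e e' e'').totalDegree ≤ 4 * f.totalDegree := by
  have := totalDegree_tri_le (totalDegree_th f) (totalDegree_frame f e) (totalDegree_frame f e')
    (totalDegree_frame f e'')
  simp only [tff]; omega

theorem totalDegree_natCast_mul_le {f : Poly} {a : ℕ} (k : ℝ) (hf : f.totalDegree ≤ a) :
    (MvPolynomial.C k * f).totalDegree ≤ a := by
  simpa using totalDegree_mul_le_of (f := MvPolynomial.C k) (a := 0) (by simp) hf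

theorem totalDegree_frem₁ (f : Poly) (e e' : Pt) :
    (frem₁ f e e').totalDegree ≤ 10 * f.totalDegree := by
  have h3 : (3 : Poly) = MvPolynomial.C 3 := (map_ofNat MvPolynomial.C 3).symm
  have h2 : (2 : Poly) = MvPolynomial.C 2 := (map_ofNat MvPolynomial.C 2).symm
  have e1 : 10 * f.totalDegree =
    3 * f.totalDegree + (3 * f.totalDegree + 4 * f.totalDegree) := by ring
  rw [frem₁, rem₁, e1, h3, h2]
  refine totalDegree_sub_le_of (totalDegree_mul_le_of (totalDegree_sff _ _ _)
    (totalDegree_sub_le_of (totalDegree_mul_le_of ?_ (totalDegree_tff _ _ _ _))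
      (totalDegree_mul_le_of (totalDegree_sff _ _ _) (totalDegree_tff _ _ _ _))))
    (totalDegree_mul_le_of ?_ (totalDegree_sub_le_of
      (totalDegree_mul_le_of ?_ (totalDegree_tff _ _ _ _))
      (totalDegree_mul_le_of ?_ (totalDegree_tff _ _ _ _)))) <;>
  exact totalDegree_natCast_mul_le _ (totalDegree_sff _ _ _)

theorem totalDegree_frem₂ (f : Poly) (e e' : Pt) :
    (frem₂ f e e').totalDegree ≤ 10 * f.totalDegree := by
  have h3 : (3 : Poly) = MvPolynomial.C 3 := (map_ofNat MvPolynomial.C 3).symm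
  have h2 : (2 : Poly) = MvPolynomial.C 2 := (map_ofNat MvPolynomial.C 2).symm
  have e1 : 10 * f.totalDegree =
    3 * f.totalDegree + (3 * f.totalDegree + 4 * f.totalDegree) := by ring
  have e2 : 10 * f.totalDegree =
    3 * f.totalDegree + 3 * f.totalDegree + 4 * f.totalDegree := by ring
  rw [frem₂, rem₂, h3, h2]
  refine totalDegree_sub_le_of ?_ ?_
  · rw [e2, pow_two]
    exact totalDegree_mul_le_of (totalDegree_mul_le_of (totalDegree_sff _ _ _)
      (totalDegree_sff _ _ _)) (totalDegree_tff _ _ _ _)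
  · rw [e1]
    refine totalDegree_mul_le_of (totalDegree_sff _ _ _) (totalDegree_sub_le_of
      (totalDegree_mul_le_of ?_ (totalDegree_tff _ _ _ _))
      (totalDegree_mul_le_of ?_ (totalDegree_tff _ _ _ _))) <;>
    exact totalDegree_natCast_mul_le _ (totalDegree_sff _ _ _)

end degree

section evaluation

/-- Gradient at a point. -/
noncomputable def gv (f : Poly) (x : Pt) : Pt := fun i => MvPolynomial.eval x (gr f i)

/-- Hessian at a point. -/
noncomputable def hv (f : Poly) (x : Pt) : Fin 3 → Fin 3 → ℝ :=
  fun i j => MvPolynomial.eval x (hs f i j)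

/-- Third derivatives at a point. -/
noncomputable def tv (f : Poly) (x : Pt) : Fin 3 → Fin 3 → Fin 3 → ℝ :=
  fun i j k => MvPolynomial.eval x (th f i j k)

theorem eval_cv (x v : Pt) : (fun i => MvPolynomial.eval x (cv v i)) = v := by
  funext i; simp [cv]

theorem eval_frame (f : Poly) (x e : Pt) :
    (fun i => MvPolynomial.eval x (crs (cv e) (gr f) i)) = crs e (gv f x) := by
  rw [map_crs, eval_cv]; rfl

theorem eval_dd (f : Poly) (x v : Pt) : MvPolynomial.eval x (dd v f) = lin1 (gv f x) v := by
  rw [dd, map_lin1, eval_cv]; rfl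

theorem eval_dd_dd (f : Poly) (x v : Pt) :
    MvPolynomial.eval x (dd v (dd v f)) = bil (hv f x) v v := by
  rw [dd_dd, map_bil, eval_cv]; rfl

theorem eval_dd_dd_dd (f : Poly) (x v : Pt) :
    MvPolynomial.eval x (dd v (dd v (dd v f))) = tri (tv f x) v v v := by
  rw [dd_dd_dd, map_tri, eval_cv]; rfl

theorem eval_fn (f : Poly) (x e e' : Pt) :
    MvPolynomial.eval x (fn f e e') = lin1 (gv f x) (crs e e') := by
  rw [fn, map_lin1, map_crs, eval_cv, eval_cv]; rfl

theorem eval_sff (f : Poly) (x e e' : Pt) :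
    MvPolynomial.eval x (sff f e e') = bil (hv f x) (crs e (gv f x)) (crs e' (gv f x)) := by
  rw [sff, map_bil, eval_frame, eval_frame]; rfl

theorem eval_tff (f : Poly) (x e e' e'' : Pt) : MvPolynomial.eval x (tff f e e' e'') =
    tri (tv f x) (crs e (gv f x)) (crs e' (gv f x)) (crs e'' (gv f x)) := by
  rw [tff, map_tri, eval_frame, eval_frame, eval_frame]; rfl

theorem eval_frem₁ (f : Poly) (x e e' : Pt) : MvPolynomial.eval x (frem₁ f e e') =
    rem₁ (bil (hv f x) (crs e (gv f x)) (crs e (gv f x)))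
      (bil (hv f x) (crs e (gv f x)) (crs e' (gv f x)))
      (bil (hv f x) (crs e' (gv f x)) (crs e' (gv f x)))
      (tri (tv f x) (crs e (gv f x)) (crs e (gv f x)) (crs e (gv f x)))
      (tri (tv f x) (crs e (gv f x)) (crs e (gv f x)) (crs e' (gv f x)))
      (tri (tv f x) (crs e (gv f x)) (crs e' (gv f x)) (crs e' (gv f x))) := by
  simp [frem₁, rem₁, eval_sff, eval_tff]

theorem eval_frem₂ (f : Poly) (x e e' : Pt) : MvPolynomial.eval x (frem₂ f e e') =
    rem₂ (bil (hv f x) (crs e (gv f x)) (crs e (gv f x)))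
      (bil (hv f x) (crs e (gv f x)) (crs e' (gv f x)))
      (bil (hv f x) (crs e' (gv f x)) (crs e' (gv f x)))
      (tri (tv f x) (crs e (gv f x)) (crs e (gv f x)) (crs e (gv f x)))
      (tri (tv f x) (crs e (gv f x)) (crs e (gv f x)) (crs e' (gv f x)))
      (tri (tv f x) (crs e' (gv f x)) (crs e' (gv f x)) (crs e' (gv f x))) := by
  simp [frem₂, rem₂, eval_sff, eval_tff]

theorem hv_symm (f : Poly) (x : Pt) (i j : Fin 3) : hv f x i j = hv f x j i := by
  simp only [hv, hs_symm f i j]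

theorem tv_symm₁ (f : Poly) (x : Pt) (i j k : Fin 3) : tv f x i j k = tv f x j i k := by
  simp only [tv, th_symm₁ f i j k]

theorem tv_symm₂ (f : Poly) (x : Pt) (i j k : Fin 3) : tv f x i j k = tv f x i k j := by
  simp only [tv, th_symm₂ f i j k]

end evaluation

/-- A point where two distinct lines in the zero set meet kills the remainders. -/
theorem eval_mul_frem_eq_zero {f : Poly} (e e' : Pt) {l l' : Set Pt} (hl : IsLine l)
    (hl' : IsLine l') (hne : l ≠ l') (hf : VanishOn f l) (hf' : VanishOn f l') {x : Pt}
    (hx : x ∈ l) (hx' : x ∈ l') :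
    MvPolynomial.eval x (fn f e e' * sff f e e * frem₁ f e e') = 0 ∧
      MvPolynomial.eval x (fn f e e' * sff f e e * frem₂ f e e') = 0 := by
  by_cases hn : MvPolynomial.eval x (fn f e e') = 0
  · simp [hn]
  by_cases hα : MvPolynomial.eval x (sff f e e) = 0
  · simp [hα]
  obtain ⟨v, hv0, rfl⟩ := hl.exists_dir hx
  obtain ⟨w, hw0, rfl⟩ := hl'.exists_dir hx'
  rw [eval_fn] at hn
  rw [eval_sff] at hα
  have h := rem_eq_zero_of_two_lines (e := e) (e' := e') (g := gv f x) (H := hv f x) (tv f x)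
    (hv_symm f x) (tv_symm₁ f x) (tv_symm₂ f x) hn hα hv0 hw0
    (by rw [← eval_dd]; exact hf.eval_dd _ hx) (by rw [← eval_dd]; exact hf'.eval_dd _ hx')
    (by rw [← eval_dd_dd]; exact hf.eval_dd.eval_dd _ hx)
    (by rw [← eval_dd_dd]; exact hf'.eval_dd.eval_dd _ hx')
    (by rw [← eval_dd_dd_dd]; exact hf.eval_dd.eval_dd.eval_dd _ hx)
    (by rw [← eval_dd_dd_dd]; exact hf'.eval_dd.eval_dd.eval_dd _ hx')
    (fun c d hc hd h => hne (by rw [← lineSet_smul x v hc, h, lineSet_smul x w hd]))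
  rw [map_mul, map_mul _ _ (frem₂ f e e'), eval_frem₁, eval_frem₂, h.1, h.2]
  simp

section plane

theorem lin1_crs_right (e e' g : Fin 3 → ℝ) : lin1 e (crs e' g) = lin1 g (crs e e') := by
  simp [lin1, crs, Fin.sum_univ_three]; ring

theorem lin1_crs_right' (e e' g : Fin 3 → ℝ) : lin1 e' (crs e g) = -lin1 g (crs e e') := by
  simp [lin1, crs, Fin.sum_univ_three]; ring

theorem lin1_add_smul (g u v : Fin 3 → ℝ) (s t : ℝ) :
    lin1 g (s • u + t • v) = s * lin1 g u + t * lin1 g v := by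
  simp [lin1, Fin.sum_univ_three]; ring

/-- A surface with vanishing second fundamental form is a plane. -/
theorem totalDegree_le_one_of_dvd_sff {f : Poly} (hf : Irreducible f) {e e' p : Pt}
    (h1 : f ∣ sff f e e) (h2 : f ∣ sff f e e') (h3 : f ∣ sff f e' e')
    (hp : MvPolynomial.eval p f = 0) (hn : MvPolynomial.eval p (fn f e e') ≠ 0) :
    f.totalDegree ≤ 1 := by
  set h : Poly := lin1 (cv (gv f p)) (fun i => MvPolynomial.X i - MvPolynomial.C (p i)) with hh
  have heval : ∀ v : Pt, MvPolynomial.eval (p + v) h = lin1 (gv f p) v := by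
    intro v
    rw [hh, map_lin1, eval_cv]
    congr 1
    funext i
    simp
  rw [eval_fn] at hn
  have h0 : h ≠ 0 := by
    intro h0
    apply hn
    rw [← heval, h0, map_zero]
  have hdeg : h.totalDegree ≤ 1 := by
    have := totalDegree_lin1_le (g := cv (gv f p)) (a := 0) (b := 1)
      (u := fun i => MvPolynomial.X i - MvPolynomial.C (p i)) (totalDegree_cv _)
      (fun i => totalDegree_sub_le_of (by simp) (by simp))
    simpa [hh] using this
  let V : ℝ → Pt := fun s => (1 : ℝ) • crs e (gv f p) + s • crs e' (gv f p)
  have hV : ∀ s, lin1 (gv f p) (V s) = 0 := by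
    intro s
    simp only [V]
    rw [lin1_add_smul, lin1_crs_self, lin1_crs_self]; ring
  have hV1 : ∀ s, lin1 e' (V s) = -lin1 (gv f p) (crs e e') := by
    intro s
    simp only [V]
    rw [lin1_add_smul, lin1_crs_right', lin1_crs_left]; ring
  have hV2 : ∀ s, lin1 e (V s) = s * lin1 (gv f p) (crs e e') := by
    intro s
    simp only [V]
    rw [lin1_add_smul, lin1_crs_right e e', lin1_crs_left]; ring
  have hV0 : ∀ s, V s ≠ 0 := by
    intro s h
    have := hV1 s
    rw [h] at this
    apply hn
    simp [lin1] at this ⊢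
    linarith
  refine (totalDegree_le_of_dvd (dvd_of_infinite_lines hf
    (Set.infinite_range_of_injective (f := fun s : ℝ => lineSet p (V s)) ?_) ?_) h0).trans hdeg
  · intro s s' heq
    have hmem : p + (1 : ℝ) • V s' ∈ lineSet p (V s) := by
      simp only at heq
      rw [heq]
      exact mem_lineSet _
    obtain ⟨t, ht⟩ := hmem
    have ht' : V s' = t • V s := by simpa using (add_left_cancel ht).symm
    have e1 := hV1 s'
    have e2 := hV2 s'
    have hsm : ∀ g : Pt, lin1 g (t • V s) = t * lin1 g (V s) := by
      intro g
      have := lin1_add_smul g (V s) 0 t 0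
      simpa using this
    rw [ht', hsm, hV1] at e1
    rw [ht', hsm, hV2] at e2
    have ht1 : t = 1 := mul_right_cancel₀ hn (by linarith)
    rw [ht1, one_mul] at e2
    exact mul_right_cancel₀ hn e2
  · rintro l ⟨s, rfl⟩
    refine ⟨⟨_, _, hV0 s, rfl⟩, ?_, ?_⟩
    · obtain ⟨A, B, hAB⟩ := relation_of_dvd_sff h1 h2 h3 (V s)
      refine vanishOn_of_relation₂ hAB ?_ hp ?_
      · rw [map_pow, eval_fn]
        exact pow_ne_zero _ hn
      · rw [eval_dd, hV]
    · rintro x ⟨t, rfl⟩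
      simp only
      rw [heval]
      have := lin1_add_smul (gv f p) (V s) 0 t 0
      simp only [smul_zero, add_zero] at this
      rw [this, hV]; ring

end plane

section frames

theorem sff_add (f : Poly) (e e' : Pt) :
    sff f (e + e') (e + e') = sff f e e + 2 * sff f e e' + sff f e' e' := by
  have h : crs (cv (e + e')) (gr f) =
      fun i => 1 * crs (cv e) (gr f) i + 1 * crs (cv e') (gr f) i := by
    funext i
    fin_cases i <;> simp [crs, cv] <;> ring
  simp only [sff]
  rw [h, bil_comb _ (hs_symm f)]
  ring

theorem fn_add (f : Poly) (e e' : Pt) : fn f (e + e') e' = fn f e e' := by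
  simp [fn, lin1, crs, cv, Fin.sum_univ_three]; ring

theorem fn_swap (f : Poly) (e e' : Pt) : fn f e' e = -fn f e e' := by
  simp [fn, lin1, crs, cv, Fin.sum_univ_three]; ring

theorem fn_single (f : Poly) (k : Fin 3) :
    fn f (Pi.single (k + 1) 1) (Pi.single (k + 2) 1) = gr f k := by
  fin_cases k <;> simp [fn, lin1, crs, cv, Fin.sum_univ_three]

theorem exists_frame {f : Poly} (hf : Irreducible f) (hd : 2 ≤ f.totalDegree)
    {M : Finset (Set Pt)} (hM : ∀ l ∈ M, IsLine l ∧ VanishOn f l)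
    (hcard : f.totalDegree * f.totalDegree < #M) :
    ∃ e e' : Pt, ¬ f ∣ fn f e e' ∧ ¬ f ∣ sff f e e := by
  obtain ⟨k, hk⟩ := exists_pderiv_ne_zero (f := f) (by omega)
  set e : Pt := Pi.single (k + 1) 1
  set e' : Pt := Pi.single (k + 2) 1
  have hn : ¬ f ∣ fn f e e' := by
    rw [fn_single]
    intro h
    have h1 := totalDegree_le_of_dvd h hk
    have h2 := totalDegree_pderiv_le k f
    simp only [gr] at h1
    omega
  by_contra! hc
  have h1 := hc e e' hn
  have h2 := hc e' e (by rw [fn_swap, dvd_neg]; exact hn)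
  have h3 := hc (e + e') e' (by rw [fn_add]; exact hn)
  rw [sff_add] at h3
  have h4 : f ∣ sff f e e' := by
    have h5 : f ∣ 2 * sff f e e' := by
      have := dvd_sub (dvd_sub h3 h1) h2
      convert this using 1; ring
    have h6 : sff f e e' = MvPolynomial.C (1 / 2) * (2 * sff f e e') := by
      rw [← mul_assoc, show (2 : Poly) = MvPolynomial.C 2 from (map_ofNat MvPolynomial.C 2).symm,
        ← MvPolynomial.C_mul]
      norm_num
    rw [h6]
    exact h5.mul_left _
  have : ∃ l ∈ M, ¬ VanishOn (fn f e e') l := by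
    by_contra! hv
    have := card_lines_le hf hn (L := M) fun l hl => ⟨(hM l hl).1, (hM l hl).2, hv l hl⟩
    have := this.trans (Nat.mul_le_mul_left _ (totalDegree_fn f e e'))
    omega
  obtain ⟨l, hl, hnv⟩ := this
  simp only [VanishOn, not_forall] at hnv
  obtain ⟨p, hpl, hp⟩ := hnv
  have := totalDegree_le_one_of_dvd_sff hf h1 h4 h2 ((hM l hl).2 p hpl) hp
  omega

end frames

theorem lin1_smul_right (g v : Fin 3 → ℝ) (t : ℝ) : lin1 g (t • v) = t * lin1 g v := by
  simpa using lin1_add_smul g v 0 t 0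

/-- The linear functional attached to a vector. -/
noncomputable def functional (e : Pt) : Pt →ₗ[ℝ] ℝ where
  toFun := lin1 e
  map_add' u v := by simpa using lin1_add_smul e u v 1 1
  map_smul' t v := by simpa using lin1_smul_right e v t

/-- Near a point where the derivative along the projection direction does not vanish, the zero set
is a graph. -/
theorem eq_of_projections_eq {f : Poly} {e e' : Pt} {U : Set Pt} (hU : Convex ℝ U)
    (hn : ∀ x ∈ U, MvPolynomial.eval x (fn f e e') ≠ 0) {x y : Pt} (hx : x ∈ U) (hy : y ∈ U)
    (hfx : MvPolynomial.eval x f = 0) (hfy : MvPolynomial.eval y f = 0)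
    (h1 : lin1 e' x = lin1 e' y) (h2 : lin1 e x = lin1 e y) : x = y := by
  set φ := restr y (x - y) f with hφ
  have h0 : φ.eval 0 = 0 := by rw [hφ, eval_restr]; simpa using hfy
  have h1' : φ.eval 1 = 0 := by rw [hφ, eval_restr]; simpa using hfx
  obtain ⟨t, ht, hd⟩ := exists_hasDerivAt_eq_zero (f := fun t => φ.eval t)
    (f' := fun t => φ.derivative.eval t) (zero_lt_one' ℝ) φ.continuous.continuousOn
    (by simp only [h0, h1']) (fun t _ => φ.hasDerivAt t)
  rw [hφ, derivative_restr, eval_restr, eval_dd] at hd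
  have hz : y + t • (x - y) ∈ U := by
    have := hU hy hx (a := 1 - t) (b := t) (by linarith [ht.2]) ht.1.le (by ring)
    convert this using 1
    module
  have hnz := hn _ hz
  rw [eval_fn] at hnz
  have hs : ∀ g : Pt, lin1 g (x - y) = lin1 g x - lin1 g y := by
    intro g
    have := lin1_add_smul g x y 1 (-1)
    rw [one_smul, neg_one_smul, ← sub_eq_add_neg] at this
    rw [this]; ring
  have := frame_eq e e' _ hd
  rw [hs e, hs e', h1, h2, sub_self, sub_self, neg_zero, zero_smul, zero_smul, add_zero] at this
  exact sub_eq_zero.1 ((smul_eq_zero.1 this).resolve_left hnz)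

theorem continuous_gv (f : Poly) : Continuous (gv f) :=
  continuous_pi fun i => MvPolynomial.continuous_eval (gr f i)

theorem continuous_crs (e : Pt) : Continuous fun g : Pt => crs e g := by
  refine continuous_pi fun i => ?_
  fin_cases i <;> simp [crs] <;> fun_prop

/-- An irreducible surface all of whose third order contact lines lie in it, having a point with
two lines, is a quadric. -/
theorem totalDegree_le_two_of_dvd_frem {f : Poly} (hf : Irreducible f) {e e' : Pt}
    (h1 : f ∣ frem₁ f e e') (h2 : f ∣ frem₂ f e e') {l l' : Set Pt} (hl : IsLine l)
    (hl' : IsLine l') (hne : l ≠ l') (hfl : VanishOn f l) (hfl' : VanishOn f l') {p : Pt}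
    (hp : p ∈ l) (hp' : p ∈ l') (hn : MvPolynomial.eval p (fn f e e') ≠ 0)
    (hα : MvPolynomial.eval p (sff f e e) ≠ 0) : f.totalDegree ≤ 2 := by
  let n : Pt → ℝ := fun x => MvPolynomial.eval x (fn f e e')
  let α : Pt → ℝ := fun x => MvPolynomial.eval x (sff f e e)
  let β : Pt → ℝ := fun x => MvPolynomial.eval x (sff f e e')
  let γ : Pt → ℝ := fun x => MvPolynomial.eval x (sff f e' e')
  have hnc : Continuous n := MvPolynomial.continuous_eval _
  have hαc : Continuous α := MvPolynomial.continuous_eval _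
  have hβc : Continuous β := MvPolynomial.continuous_eval _
  have hγc : Continuous γ := MvPolynomial.continuous_eval _
  let D : Pt → ℝ := fun x => (β x / α x) ^ 2 - γ x / α x
  have hDc : ContinuousAt D p := by
    refine ContinuousAt.sub (ContinuousAt.pow (hβc.continuousAt.div hαc.continuousAt hα) 2)
      (hγc.continuousAt.div hαc.continuousAt hα)
  let dir : ℝ → Pt → Pt := fun ε x => (n x)⁻¹ •
    ((-(β x / α x) + ε * √(D x)) • crs e (gv f x) + (1 : ℝ) • crs e' (gv f x))
  have hdirc : ∀ ε, ContinuousAt (dir ε) p := by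
    intro ε
    refine ContinuousAt.smul (hnc.continuousAt.inv₀ hn) (ContinuousAt.add (ContinuousAt.smul
      (ContinuousAt.add (hβc.continuousAt.div hαc.continuousAt hα).neg
        (continuousAt_const.mul (Real.continuous_sqrt.continuousAt.comp hDc))) ?_)
      (ContinuousAt.const_smul ?_ (1 : ℝ)))
    · exact ((continuous_crs e).comp (continuous_gv f)).continuousAt
    · exact ((continuous_crs e').comp (continuous_gv f)).continuousAt
  have hdir1 : ∀ ε x, n x ≠ 0 → lin1 e (dir ε x) = 1 := by
    intro ε x hx
    simp only [dir]
    rw [lin1_smul_right, lin1_add_smul, lin1_crs_left, lin1_crs_right e e', ← eval_fn]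
    simp only [n] at hx ⊢
    field_simp; simp
  have hdir2 : ∀ ε x, n x ≠ 0 → -lin1 e' (dir ε x) = -(β x / α x) + ε * √(D x) := by
    intro ε x hx
    simp only [dir]
    rw [lin1_smul_right, lin1_add_smul, lin1_crs_left, lin1_crs_right' e e', ← eval_fn]
    simp only [n] at hx ⊢
    field_simp; simp
  have hdir3 : ∀ ε x, lin1 (gv f x) (dir ε x) = 0 := by
    intro ε x
    simp only [dir]
    rw [lin1_smul_right, lin1_add_smul, lin1_crs_self, lin1_crs_self]; ring
  have hruled : ∀ ε x, ε ^ 2 = 1 → n x ≠ 0 → α x ≠ 0 → 0 ≤ D x → MvPolynomial.eval x f = 0 →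
      VanishOn f (lineSet x (dir ε x)) := by
    intro ε x hε hnx hαx hD hfx
    obtain ⟨A, B, E, hrel⟩ := relation_of_dvd_rem h1 h2 (dir ε x)
    refine vanishOn_of_relation hrel ?_ hfx (by rw [eval_dd, hdir3]) ?_
    · rw [map_mul, map_pow, map_pow]
      exact mul_ne_zero (pow_ne_zero _ hαx) (pow_ne_zero _ hnx)
    · rw [eval_dd_dd]
      have hb := bil_frame_real e e' (gv f x) (hv f x) (hv_symm f x) (hdir3 ε x)
      rw [hdir1 ε x hnx, hdir2 ε x hnx, ← eval_fn, ← eval_sff, ← eval_sff, ← eval_sff] at hb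
      change n x ^ 2 * _ = α x * _ + 2 * β x * _ * _ + γ x * _ at hb
      have hs := Real.sq_sqrt hD
      have hzero : α x * (-(β x / α x) + ε * √(D x)) ^ 2 +
          2 * β x * (-(β x / α x) + ε * √(D x)) * 1 + γ x * 1 ^ 2 = 0 := by
        have e1 : α x * (-(β x / α x) + ε * √(D x)) ^ 2 +
          2 * β x * (-(β x / α x) + ε * √(D x)) * 1 + γ x * 1 ^ 2 =
          α x * (β x / α x) ^ 2 - 2 * (α x * (β x / α x)) * ε * √(D x) +
            α x * (ε ^ 2 * √(D x) ^ 2) +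
          2 * β x * (-(β x / α x) + ε * √(D x)) + γ x := by ring
        rw [e1, hε, hs, mul_div_cancel₀ _ hαx]
        simp only [D]
        field_simp
        ring
      rw [hzero] at hb
      exact (mul_eq_zero.1 hb).resolve_left (pow_ne_zero _ hnx)
  have hDp : 0 < D p := by
    obtain ⟨v, hv0, rfl⟩ := hl.exists_dir hp
    obtain ⟨w, hw0, rfl⟩ := hl'.exists_dir hp'
    have hv1 : lin1 (gv f p) v = 0 := by rw [← eval_dd]; exact hfl.eval_dd _ hp
    have hw1 : lin1 (gv f p) w = 0 := by rw [← eval_dd]; exact hfl'.eval_dd _ hp'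
    have hv2 : bil (hv f p) v v = 0 := by
      rw [← eval_dd_dd]; exact hfl.eval_dd.eval_dd _ hp
    have hw2 : bil (hv f p) w w = 0 := by
      rw [← eval_dd_dd]; exact hfl'.eval_dd.eval_dd _ hp'
    have hn' := hn
    have hα' := hα
    rw [eval_fn] at hn'
    rw [eval_sff] at hα'
    have hμ := lin1_ne_zero_of_asymptotic (hv_symm f p) hn' hα' hv0 hv1 hv2
    have hν := lin1_ne_zero_of_asymptotic (hv_symm f p) hn' hα' hw0 hw1 hw2
    have hdet := det_ne_zero_of_not_parallel hn' hv1 hw1 hμ hν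
      (fun c d hc hd h => hne (by rw [← lineSet_smul p v hc, h, lineSet_smul p w hd]))
    have bv := bil_frame_real e e' (gv f p) (hv f p) (hv_symm f p) hv1
    have bw := bil_frame_real e e' (gv f p) (hv f p) (hv_symm f p) hw1
    rw [hv2, mul_zero, ← eval_sff, ← eval_sff, ← eval_sff] at bv
    rw [hw2, mul_zero, ← eval_sff, ← eval_sff, ← eval_sff] at bw
    change 0 = α p * _ + 2 * β p * _ * _ + γ p * _ at bv
    change 0 = α p * _ + 2 * β p * _ * _ + γ p * _ at bw
    generalize -lin1 e' v = a at *
    generalize -lin1 e' w = b at *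
    generalize lin1 e v = c at *
    generalize lin1 e w = d at *
    have hst : a / c ≠ b / d := by
      rw [Ne, div_eq_div_iff hμ hν]; exact hdet
    have hαp : α p ≠ 0 := hα
    have q1 : (a / c) ^ 2 + 2 * (β p / α p) * (a / c) + γ p / α p = 0 := by
      field_simp; linarith
    have q2 : (b / d) ^ 2 + 2 * (β p / α p) * (b / d) + γ p / α p = 0 := by
      field_simp; linarith
    have hsum : a / c + b / d + 2 * (β p / α p) = 0 := by
      have := sub_ne_zero.2 hst
      apply mul_left_cancel₀ this
      linear_combination q1 - q2
    have e1 : D p = ((a / c - b / d) / 2) ^ 2 := by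
      have : β p / α p = -((a / c + b / d) / 2) := by linarith
      have e3 : γ p / α p = -((a / c) ^ 2 + 2 * (β p / α p) * (a / c)) := by linarith
      simp only [D]
      rw [e3, this]; ring
    rw [e1]
    have := sub_ne_zero.2 hst
    positivity
  obtain ⟨r, hr, hball⟩ := Metric.eventually_nhds_iff_ball.1
    (hnc.continuousAt.eventually_ne (show n p ≠ 0 from hn))
  have hev : ∀ᶠ x in 𝓝 p, n x ≠ 0 ∧ α x ≠ 0 ∧ 0 < D x :=
    (hnc.continuousAt.eventually_ne hn).and ((hαc.continuousAt.eventually_ne hα).and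
      (hDc.eventually (lt_mem_nhds hDp)))
  refine totalDegree_le_two_of_double_ruling hf (p0 := p) (hfl p hp) (-functional e')
    (functional e) (dir 1) (dir (-1)) (hdirc 1) (hdirc (-1)) ?_ ?_ ?_
    ⟨Metric.ball p r, Metric.ball_mem_nhds p hr, ?_⟩
  · filter_upwards [hev] with x hx
    exact ⟨hdir1 1 x hx.1, hdir1 (-1) x hx.1⟩
  · change -lin1 e' (dir 1 p) ≠ -lin1 e' (dir (-1) p)
    rw [hdir2 1 p hn, hdir2 (-1) p hn]
    have := Real.sqrt_pos.2 hDp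
    intro h
    linarith
  · filter_upwards [hev] with x hx hfx
    exact ⟨hruled 1 x (by norm_num) hx.1 hx.2.1 hx.2.2.le hfx,
      hruled (-1) x (by norm_num) hx.1 hx.2.1 hx.2.2.le hfx⟩
  · intro x hx y hy hfx hfy e1 e2
    refine eq_of_projections_eq (convex_ball p r) hball hx hy hfx hfy ?_ e2
    exact neg_injective e1

/-- A surface of degree at least three contains few lines that meet many other lines of the
surface. -/
theorem card_rich_lines_le {f : Poly} (hf : Irreducible f) (hd : 3 ≤ f.totalDegree)
    {M : Finset (Set Pt)} (hM : ∀ l ∈ M, IsLine l ∧ VanishOn f l ∧ ∃ T : Finset Pt,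
      14 * f.totalDegree < #T ∧ ∀ x ∈ T, x ∈ l ∧ ∃ l', IsLine l' ∧ l' ≠ l ∧ x ∈ l' ∧
        VanishOn f l') : #M ≤ 14 * f.totalDegree ^ 2 := by
  by_contra! hcard
  have hrich : ∀ h : Poly, h.totalDegree ≤ 14 * f.totalDegree →
      (∀ x l l', IsLine l → IsLine l' → l ≠ l' → VanishOn f l → VanishOn f l' → x ∈ l → x ∈ l' →
        MvPolynomial.eval x h = 0) → f ∣ h := by
    intro h hdeg hx
    by_contra hfh
    have := card_lines_le hf hfh (L := M) fun l hl => ?_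
    · have := this.trans (Nat.mul_le_mul_left _ hdeg)
      have e1 : f.totalDegree * (14 * f.totalDegree) = 14 * f.totalDegree ^ 2 := by ring
      omega
    · obtain ⟨h1, h2, T, hT, hTx⟩ := hM l hl
      refine ⟨h1, h2, h1.vanishOn_of_card (T := T) (fun x hxT => ?_) (by omega)⟩
      obtain ⟨h3, l', h4, h5, h6, h7⟩ := hTx x hxT
      exact ⟨h3, hx x l l' h1 h4 h5.symm h2 h7 h3 h6⟩
  obtain ⟨e, e', hn, hα⟩ := exists_frame hf (by omega) (M := M)
    (fun l hl => ⟨(hM l hl).1, (hM l hl).2.1⟩) (by nlinarith)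
  have hprime := hf.prime
  have hdeg0 : (fn f e e' * sff f e e).totalDegree ≤ 4 * f.totalDegree := by
    have := totalDegree_mul_le_of (totalDegree_fn f e e') (totalDegree_sff f e e)
    omega
  have hnα : ¬ f ∣ fn f e e' * sff f e e := fun h => (hprime.dvd_or_dvd h).elim hn hα
  have hr1 : f ∣ frem₁ f e e' := by
    refine (hprime.dvd_or_dvd (hrich (fn f e e' * sff f e e * frem₁ f e e') ?_ ?_)).resolve_left hnα
    · have := totalDegree_mul_le_of hdeg0 (totalDegree_frem₁ f e e')
      omega
    · intro x l l' hl hl' hne h1 h2 h3 h4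
      exact (eval_mul_frem_eq_zero e e' hl hl' hne h1 h2 h3 h4).1
  have hr2 : f ∣ frem₂ f e e' := by
    refine (hprime.dvd_or_dvd (hrich (fn f e e' * sff f e e * frem₂ f e e') ?_ ?_)).resolve_left hnα
    · have := totalDegree_mul_le_of hdeg0 (totalDegree_frem₂ f e e')
      omega
    · intro x l l' hl hl' hne h1 h2 h3 h4
      exact (eval_mul_frem_eq_zero e e' hl hl' hne h1 h2 h3 h4).2
  refine hnα (hrich _ (by omega) ?_)
  intro x l l' hl hl' hne h1 h2 h3 h4
  by_contra hx
  rw [map_mul, mul_eq_zero, not_or] at hx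
  have := totalDegree_le_two_of_dvd_frem hf hr1 hr2 hl hl' hne h1 h2 h3 h4 hx.1 hx.2
  omega

open scoped Classical in
theorem sum_offDiag_le {α β : Type*} (A : Finset α) (B : Finset β) (r : α → β → Prop)
    (h : ∀ a ∈ A, ∀ a' ∈ A, ∀ b b', r a b → r a b' → r a' b → r a' b' → b ≠ b' → a = a') :
    ∑ a ∈ A, #{b ∈ B | r a b}.offDiag ≤ #B.offDiag := by
  rw [← Finset.card_biUnion]
  · refine Finset.card_le_card fun x hx => ?_
    simp only [mem_biUnion, mem_offDiag, mem_filter] at hx ⊢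
    obtain ⟨a, -, h1, h2, h3⟩ := hx
    exact ⟨h1.1, h2.1, h3⟩
  · intro a ha a' ha' hne
    refine Finset.disjoint_left.2 fun x hx hx' => hne ?_
    simp only [mem_offDiag, mem_filter] at hx hx'
    exact h a ha a' ha' x.1 x.2 hx.1.2 hx.2.1.2 hx'.1.2 hx'.2.1.2 hx.2.2

open scoped Classical in
theorem card_mul_le_mul {α β : Type*} {A : Finset α} {B : Finset β} {r : α → β → Prop} {k c n : ℕ}
    (hA : ∀ a ∈ A, k ≤ c * #{b ∈ B | r a b}) (hB : ∀ b ∈ B, #{a ∈ A | r a b} ≤ n) :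
    #A * k ≤ c * (#B * n) := by
  calc #A * k = ∑ a ∈ A, k := by simp
    _ ≤ ∑ a ∈ A, c * #{b ∈ B | r a b} := Finset.sum_le_sum hA
    _ = c * ∑ b ∈ B, #{a ∈ A | r a b} := by
      rw [← Finset.mul_sum]
      congr 1
      exact Finset.sum_card_bipartiteAbove_eq_sum_card_bipartiteBelow r
    _ ≤ c * ∑ b ∈ B, n := by gcongr with b hb; exact hB b hb
    _ = c * (#B * n) := by simp

open scoped Classical in
/-- The number of lines of a family through a point. -/
noncomputable def mult (L : Finset (Set Pt)) (x : Pt) : ℕ := #{l ∈ L | x ∈ l}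

theorem mult_mono {L L' : Finset (Set Pt)} (h : L ⊆ L') (x : Pt) : mult L x ≤ mult L' x := by
  classical
  exact Finset.card_le_card (Finset.filter_subset_filter _ h)

/-- Counting pairs of lines through rich points. -/
theorem card_mul_sq_le {L : Finset (Set Pt)} (hL : ∀ l ∈ L, IsLine l) {S : Finset Pt} {k : ℕ}
    (hk : 2 ≤ k) (hS : ∀ x ∈ S, k ≤ mult L x) : #S * k ^ 2 ≤ 2 * #L ^ 2 := by
  classical
  have h := sum_offDiag_le S {l ∈ L | IsLine l} (fun x l => x ∈ l ∧ IsLine l) (by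
    intro a _ a' _ b b' h1 h2 h3 h4 hne
    by_contra hc
    exact hne (h1.2.eq_of_mem h2.2 h1.1 h3.1 h2.1 h4.1 hc))
  have h2 : ∀ x ∈ S, k ^ 2 ≤ 2 * #{l ∈ {l ∈ L | IsLine l} | x ∈ l ∧ IsLine l}.offDiag := by
    intro x hx
    have h3 : #{l ∈ {l ∈ L | IsLine l} | x ∈ l ∧ IsLine l} = mult L x := by
      unfold mult
      congr 1
      ext l
      simp only [mem_filter]
      exact ⟨fun h => ⟨h.1.1, h.2.1⟩, fun h => ⟨⟨h.1, hL l h.1⟩, h.2, hL l h.1⟩⟩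
    rw [offDiag_card, h3]
    have := hS x hx
    obtain ⟨m, hm⟩ : ∃ m, mult L x = m + k := ⟨_, (Nat.sub_add_cancel this).symm⟩
    obtain ⟨j, rfl⟩ : ∃ j, k = j + 2 := ⟨_, (Nat.sub_add_cancel hk).symm⟩
    rw [hm]
    zify [Nat.le_mul_self (m + (j + 2))]
    nlinarith [mul_nonneg (Int.natCast_nonneg m) (Int.natCast_nonneg j),
      sq_nonneg (m : ℤ), sq_nonneg (j : ℤ)]
  have h4 : #({l ∈ L | IsLine l}.offDiag) ≤ #L ^ 2 := by
    rw [offDiag_card, sq]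
    refine (Nat.sub_le _ _).trans ?_
    gcongr <;> exact filter_subset _ _
  calc #S * k ^ 2 = ∑ x ∈ S, k ^ 2 := by simp
    _ ≤ ∑ x ∈ S, 2 * #{l ∈ {l ∈ L | IsLine l} | x ∈ l ∧ IsLine l}.offDiag := Finset.sum_le_sum h2
    _ ≤ 2 * #L ^ 2 := by 
      rw [← Finset.mul_sum]
      refine Nat.mul_le_mul_left 2 (le_trans (Finset.sum_le_sum fun x _ => le_of_eq ?_)
        (h.trans h4))
      congr!

/-- Cauchy–Schwarz bound for the number of very rich points. -/
theorem mul_card_le_or_sq_le {L : Finset (Set Pt)} (hL : ∀ l ∈ L, IsLine l) {S : Finset Pt} {k : ℕ}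
    (hS : ∀ x ∈ S, k ≤ mult L x) : k * #S ≤ 2 * #L ∨ k ^ 2 ≤ 2 * #L := by
  classical
  by_contra! hc
  have h := sum_offDiag_le L S (fun l x => x ∈ l) (by
    intro a ha a' ha' b b' h1 h2 h3 h4 hne
    exact (hL a ha).eq_of_mem (hL a' ha') h1 h2 h3 h4 hne)
  have hI : ∑ l ∈ L, #{x ∈ S | x ∈ l} = ∑ x ∈ S, mult L x :=
    (Finset.sum_card_bipartiteAbove_eq_sum_card_bipartiteBelow (fun x l => x ∈ l)).symm
  have hI2 : k * #S ≤ ∑ x ∈ S, mult L x := by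
    calc k * #S = ∑ x ∈ S, k := by simp [mul_comm]
      _ ≤ _ := Finset.sum_le_sum hS
  have hcs := sq_sum_le_card_mul_sum_sq (s := L) (f := fun l => #{x ∈ S | x ∈ l})
  have h5 : ∑ l ∈ L, #{x ∈ S | x ∈ l} ^ 2 ≤ ∑ l ∈ L, #{x ∈ S | x ∈ l} + #S ^ 2 := by
    have : #S.offDiag ≤ #S ^ 2 := by rw [offDiag_card, sq]; exact Nat.sub_le _ _
    refine le_trans ?_ (Nat.add_le_add_left (h.trans this) _)
    rw [← Finset.sum_add_distrib]
    refine Finset.sum_le_sum fun l _ => ?_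
    rw [offDiag_card, sq]
    omega
  rw [hI] at hcs h5
  set J := ∑ x ∈ S, mult L x
  have h6 : J ^ 2 ≤ #L * (J + #S ^ 2) := hcs.trans (Nat.mul_le_mul_left _ h5)
  have h7 : 2 * #L < J := by omega
  have h8 : J ^ 2 ≤ 2 * (#L * #S ^ 2) := by nlinarith
  have h9 : (k * #S) ^ 2 ≤ J ^ 2 := Nat.pow_le_pow_left hI2 2
  have h10 : 0 < #S := by
    rcases Nat.eq_zero_or_pos (#S) with h0 | h0
    · simp [h0] at hc
    · exact h0
  have : 0 < #S ^ 2 := by positivity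
  nlinarith

/-- A line outside the zero set of `F` meets at most `deg F + 1` cells of the complement. -/
theorem IsLine.card_cells_le {l : Set Pt} (hl : IsLine l) {F : Poly} (hF : ¬ VanishOn F l)
    {lab : Pt → ℕ} (hlab : ∀ x y, (∀ z ∈ segment ℝ x y, MvPolynomial.eval z F ≠ 0) → lab x = lab y)
    {T : Finset ℕ} (hT : ∀ c ∈ T, ∃ x ∈ l, MvPolynomial.eval x F ≠ 0 ∧ lab x = c) :
    #T ≤ F.totalDegree + 1 := by
  classical
  obtain ⟨p, v, hv, rfl⟩ := hl
  rw [vanishOn_lineSet] at hF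
  set q := restr p v F with hq
  have hT' : ∀ c ∈ T, ∃ t : ℝ, q.eval t ≠ 0 ∧ lab (p + t • v) = c := by
    intro c hc
    obtain ⟨x, ⟨t, rfl⟩, h1, h2⟩ := hT c hc
    exact ⟨t, by rw [hq, eval_restr]; exact h1, h2⟩
  choose! t ht htl using hT'
  have key : ∀ c ∈ T, ∀ c' ∈ T, t c ≤ t c' →
      #{r ∈ q.roots.toFinset | r < t c} = #{r ∈ q.roots.toFinset | r < t c'} → c = c' := by
    intro c hc c' hc' hle hcard
    have hsub : {r ∈ q.roots.toFinset | r < t c} ⊆ {r ∈ q.roots.toFinset | r < t c'} := by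
      intro r hr
      rw [mem_filter] at hr ⊢
      exact ⟨hr.1, hr.2.trans_le hle⟩
    have heq := Finset.eq_of_subset_of_card_le hsub hcard.ge
    rw [← htl c hc, ← htl c' hc']
    apply hlab
    rintro z ⟨a, b, ha, hb, hab, rfl⟩ hz
    have hz' : q.eval (a * t c + b * t c') = 0 := by
      rw [hq, eval_restr, ← hz]
      have : a • (p + t c • v) + b • (p + t c' • v) = (a + b) • p + (a * t c + b * t c') • v := by
        module
      rw [this, hab, one_smul]
    have hlt : a * t c + b * t c' < t c' := by
      refine lt_of_le_of_ne ?_ fun h => ht c' hc' (h ▸ hz')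
      have : a * t c ≤ a * t c' := by gcongr
      calc a * t c + b * t c' ≤ a * t c' + b * t c' := by gcongr
        _ = t c' := by rw [← add_mul, hab, one_mul]
    have hmem : a * t c + b * t c' ∈ {r ∈ q.roots.toFinset | r < t c'} := by
      simp [hF, hz', hlt]
    rw [← heq, mem_filter] at hmem
    have : b * t c ≤ b * t c' := by gcongr
    have h1 : a * t c + b * t c = t c := by rw [← add_mul, hab, one_mul]
    linarith [hmem.2]
  have hmaps : ∀ c ∈ T, #{r ∈ q.roots.toFinset | r < t c} ∈ Finset.range (F.totalDegree + 1) := by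
    intro c _
    rw [Finset.mem_range, Nat.lt_succ_iff]
    exact (Finset.card_filter_le _ _).trans ((Multiset.toFinset_card_le _).trans
      ((Polynomial.card_roots' q).trans (natDegree_restr_le p v F)))
  have := Finset.card_le_card_of_injOn _ hmaps (by
    intro c hc c' hc' h
    rcases le_total (t c) (t c') with h' | h'
    · exact key c hc c' hc' h' h
    · exact (key c' hc' c hc h' h.symm).symm)
  simpa using this

/-- `G` is a set of representatives of the irreducible factors of `F`. -/
structure IsFactorSet (G : Finset Poly) (F : Poly) : Prop where
  irr : ∀ g ∈ G, Irreducible g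
  eq_of_dvd : ∀ g ∈ G, ∀ g' ∈ G, g ∣ g' → g = g'
  sum_le : ∑ g ∈ G, g.totalDegree ≤ F.totalDegree
  eval_eq_zero : ∀ x, MvPolynomial.eval x F = 0 → ∃ g ∈ G, MvPolynomial.eval x g = 0

theorem totalDegree_prod_eq {G : Finset Poly} (hG : ∀ g ∈ G, g ≠ 0) :
    (∏ g ∈ G, g).totalDegree = ∑ g ∈ G, g.totalDegree := by
  classical
  induction G using Finset.induction_on with
  | empty => simp
  | insert g G hg ih =>
    rw [prod_insert hg, sum_insert hg, MvPolynomial.totalDegree_mul_of_isDomain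
      (hG g (mem_insert_self _ _)) (prod_ne_zero_iff.2 fun a ha => hG a (mem_insert_of_mem ha)),
      ih fun a ha => hG a (mem_insert_of_mem ha)]

theorem exists_isFactorSet {F : Poly} (hF : F ≠ 0) : ∃ G, IsFactorSet G F := by
  classical
  let _ : StrongNormalizationMonoid Poly := UniqueFactorizationMonoid.strongNormalizationMonoid
  have hmem : ∀ g, g ∈ (UniqueFactorizationMonoid.normalizedFactors F).toFinset →
      Irreducible g ∧ g ∣ F := fun g hg =>
    ⟨UniqueFactorizationMonoid.irreducible_of_normalized_factor g (Multiset.mem_toFinset.1 hg),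
      UniqueFactorizationMonoid.dvd_of_mem_normalizedFactors (Multiset.mem_toFinset.1 hg)⟩
  refine ⟨(UniqueFactorizationMonoid.normalizedFactors F).toFinset, fun g hg => (hmem g hg).1,
    ?_, ?_, ?_⟩
  · intro g hg g' hg' h
    rw [Multiset.mem_toFinset] at hg hg'
    have h1 := UniqueFactorizationMonoid.normalize_normalized_factor g hg
    have h2 := UniqueFactorizationMonoid.normalize_normalized_factor g' hg'
    rw [← h1, ← h2]
    exact normalize_eq_normalize h (((UniqueFactorizationMonoid.irreducible_of_normalized_factor g
      hg).dvd_symm (UniqueFactorizationMonoid.irreducible_of_normalized_factor g' hg') h))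
  · rw [← totalDegree_prod_eq fun g hg => (hmem g hg).1.ne_zero]
    refine totalDegree_le_of_dvd ?_ hF
    refine dvd_trans ?_ (UniqueFactorizationMonoid.prod_normalizedFactors hF).dvd
    rw [Finset.prod_eq_multiset_prod, Multiset.map_id']
    exact Multiset.prod_dvd_prod_of_le (Multiset.dedup_le _)
  · intro x hx
    have h1 := (UniqueFactorizationMonoid.prod_normalizedFactors hF).symm.dvd
    have h2 : MvPolynomial.eval x (UniqueFactorizationMonoid.normalizedFactors F).prod = 0 := by
      obtain ⟨k, hk⟩ := h1
      rw [hk, map_mul, hx, zero_mul]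
    rw [map_multiset_prod, Multiset.prod_eq_zero_iff, Multiset.mem_map] at h2
    obtain ⟨g, hg, hg0⟩ := h2
    exact ⟨g, Multiset.mem_toFinset.2 hg, hg0⟩

theorem IsFactorSet.exists_vanishOn {G : Finset Poly} {F : Poly} (hG : IsFactorSet G F)
    {l : Set Pt} (hl : IsLine l) (h : VanishOn F l) : ∃ g ∈ G, VanishOn g l := by
  apply hl.vanishOn_prod (f := fun g => g)
  intro x hx
  obtain ⟨g, hg, hg0⟩ := hG.eval_eq_zero x (h x hx)
  rw [map_prod]
  exact Finset.prod_eq_zero hg hg0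

/-- The lines of `Z(F)` on which a family of factors not vanishing there vanishes. -/
theorem IsFactorSet.card_zeros_le {G : Finset Poly} {F : Poly} (hG : IsFactorSet G F)
    {l : Set Pt} (hl : IsLine l) {T : Finset Pt}
    (hT : ∀ x ∈ T, x ∈ l ∧ ∃ g ∈ G, MvPolynomial.eval x g = 0 ∧ ¬ VanishOn g l) :
    #T ≤ F.totalDegree := by
  classical
  by_contra! hlt
  have h0 : VanishOn (∏ g ∈ G with ¬ VanishOn g l, g) l := by
    refine hl.vanishOn_of_card (T := T) ?_ (lt_of_le_of_lt ?_ hlt)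
    · intro x hx
      obtain ⟨hxl, g, hg, hg0, hgl⟩ := hT x hx
      refine ⟨hxl, ?_⟩
      rw [map_prod]
      exact Finset.prod_eq_zero (mem_filter.2 ⟨hg, hgl⟩) hg0
    · rw [totalDegree_prod_eq fun g hg => (hG.irr g (mem_filter.1 hg).1).ne_zero]
      exact (Finset.sum_le_sum_of_subset (filter_subset _ _)).trans hG.sum_le
  obtain ⟨g, hg, hgl⟩ := hl.vanishOn_prod (f := fun g => g) h0
  exact (mem_filter.1 hg).2 hgl

/-- Lines in two components, or rich lines in a component of degree at least three, are few. -/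
theorem IsFactorSet.card_bad_le {G : Finset Poly} {F : Poly} (hG : IsFactorSet G F)
    {M : Finset (Set Pt)} (hM : ∀ l ∈ M, IsLine l ∧ VanishOn F l ∧
      (∀ g ∈ G, g.totalDegree ≤ 2 → VanishOn g l → ∃ g' ∈ G, VanishOn g' l ∧ g' ≠ g) ∧
      ∃ T : Finset Pt, 15 * F.totalDegree < #T ∧ ∀ x ∈ T, x ∈ l ∧ ∃ l', IsLine l' ∧ l' ≠ l ∧
        x ∈ l' ∧ VanishOn F l') : #M ≤ 15 * F.totalDegree ^ 2 := by
  classical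
  let M₁ : Finset (Set Pt) := (G ×ˢ G).biUnion fun p =>
    {l ∈ M | p.1 ≠ p.2 ∧ VanishOn p.1 l ∧ VanishOn p.2 l}
  let M₂ : Finset (Set Pt) := G.biUnion fun g =>
    {l ∈ M | 3 ≤ g.totalDegree ∧ VanishOn g l ∧ ∀ g' ∈ G, VanishOn g' l → g' = g}
  have hsub : M ⊆ M₁ ∪ M₂ := by
    intro l hl
    obtain ⟨hl1, hl2, hl3, -⟩ := hM l hl
    obtain ⟨g, hg, hgl⟩ := hG.exists_vanishOn hl1 hl2
    rw [mem_union, mem_biUnion, mem_biUnion]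
    by_cases hu : ∃ g' ∈ G, VanishOn g' l ∧ g' ≠ g
    · obtain ⟨g', hg', hgl', hne⟩ := hu
      exact Or.inl ⟨(g', g), mem_product.2 ⟨hg', hg⟩, mem_filter.2 ⟨hl, hne, hgl', hgl⟩⟩
    · refine Or.inr ⟨g, hg, mem_filter.2 ⟨hl, ?_, hgl, ?_⟩⟩
      · by_contra hd
        exact hu (hl3 g hg (by omega) hgl)
      · intro g' hg' hgl'
        by_contra hne
        exact hu ⟨g', hg', hgl', hne⟩
  have h₁ : #M₁ ≤ F.totalDegree ^ 2 := by
    calc #M₁ ≤ ∑ p ∈ G ×ˢ G, p.1.totalDegree * p.2.totalDegree := by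
          refine card_biUnion_le.trans (Finset.sum_le_sum fun p hp => ?_)
          rw [mem_product] at hp
          by_cases hne : p.1 = p.2
          · simp [hne]
          · refine card_lines_le (hG.irr _ hp.1)
              (fun h => hne (hG.eq_of_dvd _ hp.1 _ hp.2 h)) fun l hl => ?_
            rw [mem_filter] at hl
            exact ⟨(hM l hl.1).1, hl.2.2⟩
      _ = (∑ g ∈ G, g.totalDegree) ^ 2 := by rw [sq, Finset.sum_mul_sum, Finset.sum_product]
      _ ≤ F.totalDegree ^ 2 := Nat.pow_le_pow_left hG.sum_le 2
  have h₂ : #M₂ ≤ 14 * F.totalDegree ^ 2 := by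
    calc #M₂ ≤ ∑ g ∈ G, 14 * g.totalDegree ^ 2 := by
          refine card_biUnion_le.trans (Finset.sum_le_sum fun g hg => ?_)
          by_cases hd : 3 ≤ g.totalDegree
          · refine card_rich_lines_le (hG.irr g hg) hd fun l hl => ?_
            rw [mem_filter] at hl
            obtain ⟨hlM, -, hgl, hu⟩ := hl
            obtain ⟨hl1, hl2, -, T, hT, hTl⟩ := hM l hlM
            obtain ⟨q, hq⟩ : ∃ q : Pt → Prop, ∀ x, q x ↔
                ∀ g' ∈ G, MvPolynomial.eval x g' = 0 → g' = g := ⟨_, fun _ => Iff.rfl⟩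
            refine ⟨hl1, hgl, {x ∈ T | q x}, ?_, ?_⟩
            · have h3 : #{x ∈ T | q x} + #{x ∈ T | ¬ q x} = #T :=
                Finset.card_filter_add_card_filter_not _
              have h4 : #{x ∈ T | ¬ q x} ≤
                  F.totalDegree := by
                refine hG.card_zeros_le hl1 fun x hx => ?_
                rw [mem_filter, hq] at hx
                push Not at hx
                obtain ⟨hxT, g', hg', h0, hne⟩ := hx
                exact ⟨(hTl x hxT).1, g', hg', h0, fun h => hne (hu g' hg' h)⟩
              have h5 : g.totalDegree ≤ F.totalDegree :=
                (Finset.single_le_sum (f := fun g : Poly => g.totalDegree)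
                  (fun _ _ => Nat.zero_le _) hg).trans hG.sum_le
              omega
            · intro x hx
              rw [mem_filter, hq] at hx
              obtain ⟨hxl, l', hl', hne, hxl', hF'⟩ := hTl x hx.1
              refine ⟨hxl, l', hl', hne, hxl', ?_⟩
              obtain ⟨g', hg', hgl'⟩ := hG.exists_vanishOn hl' hF'
              rwa [← hx.2 g' hg' (hgl' x hxl')]
          · rw [Finset.filter_false_of_mem fun l _ h => hd h.1]
            simp
      _ = 14 * ∑ g ∈ G, g.totalDegree ^ 2 := by rw [Finset.mul_sum]
      _ ≤ 14 * (∑ g ∈ G, g.totalDegree) ^ 2 := by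
          gcongr
          rw [sq (∑ g ∈ G, _), Finset.sum_mul]
          refine Finset.sum_le_sum fun g hg => ?_
          rw [sq]
          exact Nat.mul_le_mul_left _ (Finset.single_le_sum (f := fun g : Poly => g.totalDegree)
            (fun _ _ => Nat.zero_le _) hg)
      _ ≤ 14 * F.totalDegree ^ 2 := by gcongr; exact hG.sum_le
  have := (card_le_card hsub).trans (card_union_le _ _)
  omega

theorem exists_split {α : Type*} (S : Finset α) (q : α → Prop) : ∃ S₁ S₂ : Finset α,
    #S = #S₁ + #S₂ ∧ (∀ x, x ∈ S₁ ↔ x ∈ S ∧ q x) ∧ ∀ x, x ∈ S₂ ↔ x ∈ S ∧ ¬ q x := by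
  classical
  exact ⟨{x ∈ S | q x}, {x ∈ S | ¬ q x}, (Finset.card_filter_add_card_filter_not _).symm,
    fun x => mem_filter, fun x => mem_filter⟩

theorem mult_add {L L₁ L₂ : Finset (Set Pt)} {q : Set Pt → Prop}
    (h₁ : ∀ l, l ∈ L₁ ↔ l ∈ L ∧ q l) (h₂ : ∀ l, l ∈ L₂ ↔ l ∈ L ∧ ¬ q l) (x : Pt) :
    mult L x = mult L₁ x + mult L₂ x := by
  classical
  unfold mult
  rw [← Finset.card_filter_add_card_filter_not q]
  congr 2 <;> ext l <;> simp only [mem_filter, h₁, h₂] <;> tauto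

theorem exists_ne_of_two_le_mult {L : Finset (Set Pt)} {x : Pt} (h : 2 ≤ mult L x) (l : Set Pt) :
    ∃ l' ∈ L, l' ≠ l ∧ x ∈ l' := by
  classical
  obtain ⟨l', hl', hne⟩ := Finset.exists_mem_ne h l
  rw [mem_filter] at hl'
  exact ⟨l', hl'.1, hne, hl'.2⟩

open scoped Classical in
/-- Counting rich points lying on many isolated lines of planes and quadrics. -/
theorem card_isolated_le {L LZ Gd : Finset (Set Pt)} {n B k : ℕ} {P : Set Pt → Set Pt → Prop}
    {Q : Pt → Set Pt → Prop} (hline : ∀ l ∈ LZ, IsLine l) (hn : #L ≤ n) (hGL : Gd ⊆ L)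
    (hGZ : Gd ⊆ LZ) (hB : ∀ l ∈ Gd, #{l' ∈ LZ | P l l'} ≤ B) {S : Finset Pt}
    (hP : ∀ x ∈ S, ∀ l ∈ Gd, x ∈ l → Q x l → ∀ l' ∈ LZ, x ∈ l' → P l l')
    (h1 : ∀ x ∈ S, k ≤ 16 * #{l ∈ Gd | x ∈ l ∧ Q x l}) (h2 : ∀ x ∈ S, 3 * k < 4 * mult LZ x)
    (h3 : ∀ x ∈ S, 2 ≤ mult LZ x) : #S * k ^ 2 ≤ 43 * (n * B) := by
  let PP : Finset (Set Pt × Set Pt) := {p ∈ Gd ×ˢ LZ | p.1 ≠ p.2 ∧ P p.1 p.2}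
  have hPP : #PP ≤ n * B := by
    calc #PP = ∑ l ∈ Gd, #{p ∈ PP | p.1 = l} := by
          refine Finset.card_eq_sum_card_fiberwise fun p hp => ?_
          exact (mem_product.1 (mem_filter.1 hp).1).1
      _ ≤ ∑ l ∈ Gd, B := by
          refine Finset.sum_le_sum fun l hl => le_trans ?_ (hB l hl)
          refine Finset.card_le_card_of_injOn Prod.snd (fun p hp => ?_) fun p hp q hq h => ?_
          · simp only [PP, coe_filter, mem_filter, mem_product, Set.mem_ofPred_eq] at hp ⊢
            exact ⟨hp.1.1.2, hp.2 ▸ hp.1.2.2⟩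
          · simp only [coe_filter, Set.mem_ofPred_eq] at hp hq
            exact Prod.ext (hp.2.trans hq.2.symm) h
      _ ≤ n * B := by
          rw [Finset.sum_const, smul_eq_mul]
          exact Nat.mul_le_mul_right _ ((card_le_card hGL).trans hn)
  obtain ⟨r, hr⟩ : ∃ r : Pt → Set Pt × Set Pt → Prop, ∀ x p, r x p ↔ x ∈ p.1 ∧ x ∈ p.2 :=
    ⟨_, fun _ _ => Iff.rfl⟩
  have key := card_mul_le_mul (A := S) (B := PP) (r := r) (k := k ^ 2)
    (c := 43) (n := 1) (fun x hx => ?_) fun p hp => ?_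
  · exact key.trans (by rw [mul_one]; exact Nat.mul_le_mul_left _ hPP)
  · set i := #{l ∈ Gd | x ∈ l ∧ Q x l} with hi
    have hcard : i * (mult LZ x - 1) ≤ #{p ∈ PP | r x p} := by
      calc i * (mult LZ x - 1) = ∑ l ∈ {l ∈ Gd | x ∈ l ∧ Q x l}, (mult LZ x - 1) := by simp [hi]
        _ = ∑ l ∈ {l ∈ Gd | x ∈ l ∧ Q x l}, #(({l' ∈ LZ | x ∈ l'}).erase l) := by
            refine Finset.sum_congr rfl fun l hl => ?_
            rw [mem_filter] at hl
            rw [card_erase_of_mem (mem_filter.2 ⟨hGZ hl.1, hl.2.1⟩)]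
            rfl
        _ = #({l ∈ Gd | x ∈ l ∧ Q x l}.sigma fun l => ({l' ∈ LZ | x ∈ l'}).erase l) :=
            (Finset.card_sigma _ _).symm
        _ ≤ _ := by
            refine Finset.card_le_card_of_injOn (fun s => (s.1, s.2)) (fun s hs => ?_)
              fun s _ t _ h => ?_
            · simp only [coe_sigma, Set.mem_sigma_iff, mem_coe, mem_filter, mem_erase] at hs
              simp only [PP, mem_coe, mem_filter, mem_product, hr]
              exact ⟨⟨⟨hs.1.1, hs.2.2.1⟩, hs.2.1.symm,
                hP x hx s.1 hs.1.1 hs.1.2.1 hs.1.2.2 s.2 hs.2.2.1 hs.2.2.2⟩, hs.1.2.1, hs.2.2.2⟩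
            · simp only [Prod.mk.injEq] at h
              exact Sigma.ext h.1 (heq_of_eq h.2)
    have h1' := h1 x hx
    have h2' := h2 x hx
    obtain ⟨j, hj⟩ : ∃ j, mult LZ x = j + 1 := ⟨mult LZ x - 1, by have := h3 x hx; omega⟩
    have h3' := h3 x hx
    have h4 : 3 * k ≤ 8 * j := by omega
    rw [hj, Nat.add_sub_cancel] at hcard
    have h5 : k * (3 * k) ≤ 16 * i * (8 * j) := Nat.mul_le_mul h1' h4
    nlinarith
  · refine Finset.card_le_one.2 fun x hx y hy => ?_
    simp only [PP, mem_filter, mem_product, hr] at hx hy hp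
    by_contra hne
    exact hp.2.1 ((hline _ (hGZ hp.1.1)).eq_of_mem (hline _ hp.1.2) hx.2.1 hy.2.1 hx.2.2 hy.2.2 hne)

open scoped Classical in
/-- Rich points on the zero set of a polynomial. -/
theorem card_surface_le {L : Finset (Set Pt)} (hL : ∀ l ∈ L, IsLine l) {B : ℕ}
    (hB : ∀ g : Poly, Irreducible g → g.totalDegree ≤ 2 → #{l ∈ L | VanishOn g l} ≤ B)
    {F : Poly} (hF : F ≠ 0) {S : Finset Pt} (hSF : ∀ x ∈ S, MvPolynomial.eval x F = 0) {k W : ℕ}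
    (hk : 2 ≤ k) (hS : ∀ x ∈ S, k ≤ mult L x)
    (hW : ∀ L' ⊆ L, #L' ≤ 15 * F.totalDegree ^ 2 → ∀ k' : ℕ, 2 ≤ k' → ∀ S' : Finset Pt,
      (∀ x ∈ S', k' ≤ mult L' x) → #S' * k' ^ 2 ≤ W) :
    #S * k ^ 2 ≤ 80 * (#L * F.totalDegree * k) + 43 * (#L * B) + 16 * W := by
  obtain ⟨G, hG⟩ := exists_isFactorSet hF
  set E := F.totalDegree with hE
  set n := #L with hn
  obtain ⟨LZ, LN, hLc, hLZ, hLN⟩ := exists_split L (VanishOn F)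
  have hLZL : LZ ⊆ L := fun l hl => ((hLZ l).1 hl).1
  obtain ⟨S₁, S₂, hSc, hS₁, hS₂⟩ := exists_split S fun x => k ≤ 4 * mult LN x
  have b₁ : #S₁ * k ≤ 4 * (n * E) := by
    refine (card_mul_le_mul (A := S₁) (B := LN) (r := fun x l => x ∈ l) (k := k) (c := 4) (n := E)
      (fun x hx => ((hS₁ x).1 hx).2) fun l hl => ?_).trans (by gcongr; omega)
    by_contra! hlt
    refine ((hLN l).1 hl).2 ((hL l ((hLN l).1 hl).1).vanishOn_of_card (fun x hx => ?_) hlt)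
    rw [mem_filter] at hx
    exact ⟨hx.2, hSF x ((hS₁ x).1 hx.1).1⟩
  have m₂ : ∀ x ∈ S₂, 3 * k < 4 * mult LZ x := by
    intro x hx
    have h1 := hS x ((hS₂ x).1 hx).1
    have h2 := ((hS₂ x).1 hx).2
    have h3 := mult_add hLZ hLN x
    omega
  obtain ⟨PL, NP, hPc, hPL, hNP⟩ := exists_split LZ fun l => #{x ∈ S₂ | x ∈ l} ≤ 15 * E
  obtain ⟨S₃, S₄, hSc', hS₃, hS₄⟩ := exists_split S₂ fun x => k ≤ 4 * mult PL x
  have b₃ : #S₃ * k ≤ 4 * (n * (15 * E)) := by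
    refine (card_mul_le_mul (A := S₃) (B := PL) (r := fun x l => x ∈ l) (k := k) (c := 4)
      (n := 15 * E) (fun x hx => ((hS₃ x).1 hx).2) fun l hl => ?_).trans (by gcongr; omega)
    refine (card_le_card ?_).trans ((hPL l).1 hl).2
    exact filter_subset_filter _ fun x hx => ((hS₃ x).1 hx).1
  have m₄ : ∀ x ∈ S₄, k < 2 * mult NP x := by
    intro x hx
    have h1 := m₂ x ((hS₄ x).1 hx).1
    have h2 := ((hS₄ x).1 hx).2
    have h3 := mult_add hPL hNP x
    omega
  obtain ⟨Gd, Bd, hGc, hGd, hBd⟩ := exists_split NP fun l => ∃ g ∈ G, g.totalDegree ≤ 2 ∧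
    VanishOn g l ∧ ∀ g' ∈ G, VanishOn g' l → g' = g
  have hGZ : Gd ⊆ LZ := fun l hl => ((hNP l).1 ((hGd l).1 hl).1).1
  have hBZ : Bd ⊆ LZ := fun l hl => ((hNP l).1 ((hBd l).1 hl).1).1
  have cB : #Bd ≤ 15 * E ^ 2 := by
    refine hG.card_bad_le fun l hl => ⟨hL l (hLZL (hBZ hl)), ((hLZ l).1 (hBZ hl)).2, ?_, ?_⟩
    · intro g hg hd hgl
      by_contra! hc
      exact ((hBd l).1 hl).2 ⟨g, hg, hd, hgl, hc⟩
    · have h1 := ((hNP l).1 ((hBd l).1 hl).1).2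
      refine ⟨{x ∈ S₂ | x ∈ l}, by omega, fun x hx => ?_⟩
      rw [mem_filter] at hx
      obtain ⟨l', hl', hne, hxl'⟩ := exists_ne_of_two_le_mult (L := LZ) (x := x)
        (by have := m₂ x hx.1; omega) l
      exact ⟨hx.2, l', hL l' (hLZL hl'), hne, hxl', ((hLZ l').1 hl').2⟩
  obtain ⟨S₅, S₆, hSc'', hS₅, hS₆⟩ := exists_split S₄ fun x => 2 ≤ mult Bd x ∧ k ≤ 4 * mult Bd x
  have b₅ : #S₅ * k ^ 2 ≤ 16 * W := by
    have h1 := hW Bd (hBZ.trans hLZL) cB (max 2 ((k + 3) / 4)) (le_max_left _ _) S₅ fun x hx => by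
      have := ((hS₅ x).1 hx).2
      refine max_le this.1 ?_
      omega
    have h2 : k ≤ 4 * max 2 ((k + 3) / 4) := by
      have := le_max_right 2 ((k + 3) / 4)
      omega
    have h3 : k ^ 2 ≤ (4 * max 2 ((k + 3) / 4)) ^ 2 := Nat.pow_le_pow_left h2 2
    calc #S₅ * k ^ 2 ≤ #S₅ * (4 * max 2 ((k + 3) / 4)) ^ 2 := Nat.mul_le_mul_left _ h3
      _ = 16 * (#S₅ * max 2 ((k + 3) / 4) ^ 2) := by ring
      _ ≤ 16 * W := Nat.mul_le_mul_left _ h1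
  have m₆ : ∀ x ∈ S₆, k ≤ 8 * mult Gd x := by
    intro x hx
    have h1 := m₄ x ((hS₆ x).1 hx).1
    have h2 := ((hS₆ x).1 hx).2
    have h3 := mult_add hGd hBd x
    omega
  obtain ⟨Q, hQ⟩ : ∃ Q : Pt → Set Pt → Prop, ∀ x l, Q x l ↔
      ∀ g ∈ G, MvPolynomial.eval x g = 0 → VanishOn g l := ⟨_, fun _ _ => Iff.rfl⟩
  obtain ⟨R, hR⟩ : ∃ R : Pt → Set Pt → Prop, ∀ x l, R x l ↔ x ∈ l ∧ ¬ Q x l :=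
    ⟨_, fun _ _ => Iff.rfl⟩
  obtain ⟨P, hP⟩ : ∃ P : Set Pt → Set Pt → Prop, ∀ l l', P l l' ↔
      ∃ g ∈ G, g.totalDegree ≤ 2 ∧ VanishOn g l ∧ VanishOn g l' ∧
        ∀ g' ∈ G, VanishOn g' l → g' = g := ⟨_, fun _ _ => Iff.rfl⟩
  obtain ⟨S₇, S₈, hSc''', hS₇, hS₈⟩ :=
    exists_split S₆ fun x => k ≤ 16 * #{l ∈ Gd | R x l}
  have hGL : Gd ⊆ L := hGZ.trans hLZL
  have b₇ : #S₇ * k ≤ 16 * (n * E) := by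
    refine (card_mul_le_mul (A := S₇) (B := Gd) (r := R) (k := k) (c := 16)
      (n := E) (fun x hx => ((hS₇ x).1 hx).2) fun l hl => ?_).trans ?_
    · refine hG.card_zeros_le (hL l (hGL hl)) fun x hx => ?_
      rw [mem_filter, hR, hQ] at hx
      push Not at hx
      exact hx.2
    · have := card_le_card hGL
      gcongr
  have b₈ : #S₈ * k ^ 2 ≤ 43 * (n * B) := by
    have hmem : ∀ x ∈ S₈, x ∈ S₂ := fun x hx =>
      ((hS₄ x).1 ((hS₆ x).1 ((hS₈ x).1 hx).1).1).1
    refine card_isolated_le (L := L) (LZ := LZ) (Gd := Gd) (Q := Q)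
      (P := P) (fun l hl => hL l (hLZL hl)) le_rfl hGL hGZ ?_ ?_ ?_
      (fun x hx => m₂ x (hmem x hx)) (fun x hx => by have := m₂ x (hmem x hx); omega)
    · intro l hl
      obtain ⟨g, hg, hd, hgl, hu⟩ := ((hGd l).1 hl).2
      refine (card_le_card fun l' hl' => ?_).trans (hB g (hG.irr g hg) hd)
      rw [mem_filter] at hl' ⊢
      rw [hP] at hl'
      obtain ⟨h1, g', hg', -, -, h2, h3⟩ := hl'
      rw [h3 g hg hgl]
      exact ⟨hLZL h1, h2⟩
    · intro x hx l hl hxl hQl l' hl' hxl'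
      obtain ⟨g, hg, hd, hgl, hu⟩ := ((hGd l).1 hl).2
      obtain ⟨g', hg', hgl'⟩ := hG.exists_vanishOn (hL l' (hLZL hl')) ((hLZ l').1 hl').2
      have := hu g' hg' ((hQ x l).1 hQl g' hg' (hgl' x hxl'))
      exact (hP _ _).2 ⟨g, hg, hd, hgl, this ▸ hgl', hu⟩
    · intro x hx
      have h1 := m₆ x ((hS₈ x).1 hx).1
      have h2 := ((hS₈ x).1 hx).2
      have h3 : mult Gd x = #{l ∈ Gd | x ∈ l ∧ Q x l} + #{l ∈ Gd | R x l} := by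
        unfold mult
        rw [← Finset.card_filter_add_card_filter_not (Q x)]
        congr 2 <;> ext l <;> simp only [mem_filter, hR] <;> tauto
      omega
  have e : #S = #S₁ + #S₃ + #S₅ + #S₇ + #S₈ := by omega
  have c₁ := Nat.mul_le_mul_right k b₁
  have c₃ := Nat.mul_le_mul_right k b₃
  have c₇ := Nat.mul_le_mul_right k b₇
  rw [e]
  nlinarith

open scoped Classical in
/-- Polynomial partitioning applied to the rich points of a family of lines. -/
theorem exists_cells {L : Finset (Set Pt)} (hL : ∀ l ∈ L, IsLine l) {S : Finset Pt} {k : ℕ}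
    (hk : 2 ≤ k) (hS : ∀ x ∈ S, k ≤ mult L x) (I : ℕ) :
    ∃ F : Poly, F ≠ 0 ∧ F.totalDegree ≤ 18 * 2 ^ I ∧ ∃ s M : ℕ → ℕ,
      #{x ∈ S | ¬ MvPolynomial.eval x F = 0} ≤ ∑ c ∈ Finset.range (2 ^ (3 * I)), s c ∧
      ∑ c ∈ Finset.range (2 ^ (3 * I)), M c ≤ #L * (19 * 2 ^ I) ∧
      ∀ c, 2 ^ (3 * I) * s c ≤ #S ∧ s c * k ^ 2 ≤ 2 * M c ^ 2 ∧
        (k * s c ≤ 2 * M c ∨ k ^ 2 ≤ 2 * M c) := by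
  obtain ⟨F, hF, hdeg, lab, hlab, hseg, hcell⟩ := exists_partition S I
  obtain ⟨R, hR⟩ : ∃ R : ℕ → Set Pt → Prop, ∀ c l, R c l ↔
      ∃ x ∈ l, MvPolynomial.eval x F ≠ 0 ∧ lab x = c := ⟨_, fun _ _ => Iff.rfl⟩
  obtain ⟨Q, hQ⟩ : ∃ Q : ℕ → Pt → Prop, ∀ c x, Q c x ↔
      MvPolynomial.eval x F ≠ 0 ∧ lab x = c := ⟨_, fun _ _ => Iff.rfl⟩
  have hmult : ∀ c, ∀ x ∈ {x ∈ S | Q c x}, k ≤ mult {l ∈ L | R c l} x := by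
    intro c x hx
    rw [mem_filter, hQ] at hx
    refine (hS x hx.1).trans (card_le_card fun l hl => ?_)
    rw [mem_filter] at hl ⊢
    exact ⟨mem_filter.2 ⟨hl.1, (hR c l).2 ⟨x, hl.2, hx.2⟩⟩, hl.2⟩
  have hline : ∀ c, ∀ l ∈ {l ∈ L | R c l}, IsLine l := fun c l hl => hL l (mem_filter.1 hl).1
  refine ⟨F, hF, hdeg, fun c => #{x ∈ S | Q c x}, fun c => #{l ∈ L | R c l}, ?_, ?_,
    fun c => ⟨?_, card_mul_sq_le (hline c) hk (hmult c), mul_card_le_or_sq_le (hline c) (hmult c)⟩⟩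
  · refine (card_le_card fun x hx => ?_).trans card_biUnion_le
    rw [mem_filter] at hx
    rw [mem_biUnion]
    exact ⟨lab x, Finset.mem_range.2 (hlab x), mem_filter.2 ⟨hx.1, (hQ _ _).2 ⟨hx.2, rfl⟩⟩⟩
  · calc ∑ c ∈ Finset.range (2 ^ (3 * I)), #{l ∈ L | R c l}
        = ∑ l ∈ L, #{c ∈ Finset.range (2 ^ (3 * I)) | R c l} :=
          Finset.sum_card_bipartiteAbove_eq_sum_card_bipartiteBelow R
      _ ≤ ∑ l ∈ L, (19 * 2 ^ I) := by
          refine Finset.sum_le_sum fun l hl => ?_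
          by_cases hv : VanishOn F l
          · rw [Finset.filter_false_of_mem]
            · simp
            · intro c _ h
              obtain ⟨x, hx, h0, -⟩ := (hR c l).1 h
              exact h0 (hv x hx)
          · have := (hL l hl).card_cells_le hv hseg
              (T := {c ∈ Finset.range (2 ^ (3 * I)) | R c l}) fun c hc =>
                (hR c l).1 (mem_filter.1 hc).2
            have : 1 ≤ 2 ^ I := Nat.one_le_two_pow
            omega
      _ = #L * (19 * 2 ^ I) := by simp
  · refine le_trans (Nat.mul_le_mul_left _ (card_le_card fun x hx => ?_)) (hcell c)
    rw [mem_filter] at hx ⊢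
    exact ⟨hx.1, (hQ c x).1 hx.2⟩

theorem sq_sum_mul_le {ι : Type*} (T : Finset ι) (a m : ι → ℕ) {p q : ℕ} (hp : 0 < p)
    (h : ∀ c ∈ T, a c ^ 2 * p ≤ q * m c ^ 2) : (∑ c ∈ T, a c) ^ 2 * p ≤ q * (∑ c ∈ T, m c) ^ 2 := by
  have hp' : (0 : ℝ) < p := by exact_mod_cast hp
  have h1 : ∀ c ∈ T, (a c : ℝ) ≤ √(q / p) * m c := by
    intro c hc
    have h2 : (a c : ℝ) ^ 2 * p ≤ q * (m c : ℝ) ^ 2 := by exact_mod_cast h c hc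
    refine le_of_sq_le_sq ?_ (by positivity)
    rw [mul_pow, Real.sq_sqrt (by positivity), div_mul_eq_mul_div, le_div_iff₀ hp']
    exact h2
  have h3 : (∑ c ∈ T, (a c : ℝ)) ≤ √(q / p) * ∑ c ∈ T, (m c : ℝ) := by
    rw [Finset.mul_sum]
    exact Finset.sum_le_sum h1
  have h4 : (∑ c ∈ T, (a c : ℝ)) ^ 2 ≤ (√(q / p) * ∑ c ∈ T, (m c : ℝ)) ^ 2 := by
    gcongr
  rw [mul_pow, Real.sq_sqrt (by positivity), div_mul_eq_mul_div, le_div_iff₀ hp'] at h4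
  exact_mod_cast h4

open scoped Classical in
/-- Guth–Katz bound on the number of `k`-rich points. -/
theorem card_rich_points_le {U : Finset (Set Pt)} (hU : ∀ l ∈ U, IsLine l) {B : ℕ}
    (hB : ∀ g : Poly, Irreducible g → g.totalDegree ≤ 2 → #{l ∈ U | VanishOn g l} ≤ B)
    (hpt : ∀ x, mult U x ≤ B) (hcard : #U ≤ B ^ 2) (N : ℕ) :
    ∀ L ⊆ U, #L ≤ N → ∀ k, 2 ≤ k → ∀ S : Finset Pt, (∀ x ∈ S, k ≤ mult L x) →
      #S * k ^ 2 ≤ 20000000 * (#L * B) := by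
  induction N using Nat.strong_induction_on with
  | _ N ih =>
  intro L hLU hLN k hk S hS
  rcases S.eq_empty_or_nonempty with rfl | ⟨x₀, hx₀⟩
  · simp
  have hL : ∀ l ∈ L, IsLine l := fun l hl => hU l (hLU hl)
  have hkB : k ≤ B := (hS x₀ hx₀).trans ((mult_mono hLU x₀).trans (hpt x₀))
  have hnB : #L ≤ B ^ 2 := (card_le_card hLU).trans hcard
  have hn0 : 0 < #L := lt_of_lt_of_le (by omega) ((hS x₀ hx₀).trans (card_filter_le _ _))
  have combine : ∀ F : Poly, F ≠ 0 → 960 * F.totalDegree ^ 2 ≤ #L → F.totalDegree * k ≤ 500 * B →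
      4 * (#{x ∈ S | ¬ MvPolynomial.eval x F = 0} * k ^ 2) ≤ #S * k ^ 2 + 3800 * (#L * B) →
      #S * k ^ 2 ≤ 20000000 * (#L * B) := by
    intro F hF h1 h2 h3
    have hon := card_surface_le hL (B := B) (fun g hg hd =>
      (card_le_card (filter_subset_filter _ hLU)).trans (hB g hg hd)) hF
      (S := {x ∈ S | MvPolynomial.eval x F = 0}) (fun x hx => (mem_filter.1 hx).2) hk
      (fun x hx => hS x (mem_filter.1 hx).1) (W := 20000000 * (15 * F.totalDegree ^ 2 * B)) (by
        intro L' hL' hc k' hk' S' hS'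
        refine (ih (#L') (by omega) L' (hL'.trans hLU) le_rfl k' hk' S' hS').trans ?_
        gcongr)
    have hsplit : #{x ∈ S | MvPolynomial.eval x F = 0} +
        #{x ∈ S | ¬ MvPolynomial.eval x F = 0} = #S := Finset.card_filter_add_card_filter_not _
    have h4 : #L * F.totalDegree * k ≤ 500 * (#L * B) := by
      calc #L * F.totalDegree * k = #L * (F.totalDegree * k) := by ring
        _ ≤ #L * (500 * B) := Nat.mul_le_mul_left _ h2
        _ = _ := by ring
    have h5 : 960 * F.totalDegree ^ 2 * B ≤ #L * B := Nat.mul_le_mul_right _ h1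
    have h6 : #{x ∈ S | MvPolynomial.eval x F = 0} * k ^ 2 +
        #{x ∈ S | ¬ MvPolynomial.eval x F = 0} * k ^ 2 = #S * k ^ 2 := by
      rw [← hsplit, add_mul]
    generalize #{x ∈ S | MvPolynomial.eval x F = 0} * k ^ 2 = a at *
    generalize #{x ∈ S | ¬ MvPolynomial.eval x F = 0} * k ^ 2 = b at *
    have h7 : 16 * (20000000 * (15 * F.totalDegree ^ 2 * B)) =
      5000000 * (960 * F.totalDegree ^ 2 * B) := by ring
    omega
  set n := #L with hn
  rcases mul_card_le_or_sq_le hL hS with hbig | hkn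
  · calc #S * k ^ 2 = k * #S * k := by ring
      _ ≤ 2 * n * B := Nat.mul_le_mul hbig hkB
      _ ≤ 20000000 * (n * B) := by rw [mul_assoc]; omega
  rcases le_or_gt 14000 k with hk0 | hk0
  · have hex : ∃ I, 152 * n ≤ 4 ^ I * k ^ 2 := by
      obtain ⟨I, hI⟩ := pow_unbounded_of_one_lt (152 * n) (by norm_num : (1 : ℕ) < 4)
      exact ⟨I, hI.le.trans (Nat.le_mul_of_pos_right _ (by positivity))⟩
    obtain ⟨I, hI1, hI2⟩ : ∃ I, 152 * n ≤ 4 ^ I * k ^ 2 ∧ 4 ^ I * k ^ 2 ≤ 608 * n := by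
      refine ⟨Nat.find hex, Nat.find_spec hex, ?_⟩
      rcases Nat.eq_zero_or_pos (Nat.find hex) with h0 | h0
      · rw [h0, pow_zero, one_mul]; omega
      · obtain ⟨j, hj⟩ : ∃ j, Nat.find hex = j + 1 := ⟨_, (Nat.succ_pred_eq_of_pos h0).symm⟩
        have := Nat.find_min hex (m := j) (by omega)
        rw [hj, pow_succ]
        push Not at this
        nlinarith
    obtain ⟨F, hF, hdeg, s, M, hs, hM, hc⟩ := exists_cells hL hk hS I
    have hD : 0 < 2 ^ I := by positivity
    have h8 : 2 ^ (3 * I) = (2 ^ I) ^ 3 := by rw [← pow_mul, mul_comm]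
    have h4 : 4 ^ I = (2 ^ I) ^ 2 := by rw [← pow_mul, mul_comm, pow_mul]; norm_num
    rw [h8] at hs hM hc
    rw [h4] at hI1 hI2
    generalize 2 ^ I = D at *
    have hDk : D * k ≤ 25 * B := by
      refine (Nat.pow_le_pow_iff_left two_ne_zero).1 ?_
      nlinarith
    refine combine F hF ?_ ?_ ?_
    · have h1 : 14000 ^ 2 ≤ k ^ 2 := Nat.pow_le_pow_left hk0 2
      have h2 : D ^ 2 * 14000 ^ 2 ≤ 608 * n := (Nat.mul_le_mul_left _ h1).trans hI2
      have h3 : F.totalDegree ^ 2 ≤ (18 * D) ^ 2 := Nat.pow_le_pow_left hdeg 2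
      rw [mul_pow] at h3
      norm_num at h2 h3
      omega
    · calc F.totalDegree * k ≤ 18 * D * k := Nat.mul_le_mul_right _ hdeg
        _ = 18 * (D * k) := by ring
        _ ≤ 500 * B := by omega
    · have h1 : ∀ c ∈ Finset.range (D ^ 3), s c * (D ^ 3 * k ^ 2) ≤
          M c * (2 * D ^ 3 * k + 2 * #S) := by
        intro c _
        obtain ⟨h2, -, h3 | h3⟩ := hc c
        · calc s c * (D ^ 3 * k ^ 2) = k * s c * (D ^ 3 * k) := by ring
            _ ≤ 2 * M c * (D ^ 3 * k) := Nat.mul_le_mul_right _ h3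
            _ = M c * (2 * D ^ 3 * k) := by ring
            _ ≤ _ := Nat.mul_le_mul_left _ (Nat.le_add_right _ _)
        · calc s c * (D ^ 3 * k ^ 2) = D ^ 3 * s c * k ^ 2 := by ring
            _ ≤ #S * (2 * M c) := Nat.mul_le_mul h2 h3
            _ = M c * (2 * #S) := by ring
            _ ≤ _ := Nat.mul_le_mul_left _ (Nat.le_add_left _ _)
      have h2 := Finset.sum_le_sum h1
      rw [← Finset.sum_mul, ← Finset.sum_mul] at h2
      have h3 : #{x ∈ S | ¬ MvPolynomial.eval x F = 0} * (D ^ 3 * k ^ 2) ≤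
          n * (19 * D) * (2 * D ^ 3 * k + 2 * #S) :=
        (Nat.mul_le_mul_right _ hs).trans (h2.trans (Nat.mul_le_mul_right _ hM))
      set b := #{x ∈ S | ¬ MvPolynomial.eval x F = 0}
      have h5 : b * k ^ 2 * D ^ 2 ≤ 38 * n * k * D ^ 3 + 38 * n * #S := by
        refine Nat.le_of_mul_le_mul_right ?_ hD
        calc b * k ^ 2 * D ^ 2 * D = b * (D ^ 3 * k ^ 2) := by ring
          _ ≤ _ := h3
          _ = _ := by ring
      have h6 : 4 * (b * k ^ 2) ≤ 152 * n * k * D + #S * k ^ 2 := by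
        refine Nat.le_of_mul_le_mul_right ?_ (pow_pos hD 2)
        calc 4 * (b * k ^ 2) * D ^ 2 = 4 * (b * k ^ 2 * D ^ 2) := by ring
          _ ≤ 4 * (38 * n * k * D ^ 3 + 38 * n * #S) := Nat.mul_le_mul_left _ h5
          _ = 152 * n * k * D * D ^ 2 + 152 * n * #S := by ring
          _ ≤ 152 * n * k * D * D ^ 2 + D ^ 2 * k ^ 2 * #S := by gcongr
          _ = _ := by ring
      have h7 : 152 * n * k * D ≤ 3800 * (n * B) := by
        calc 152 * n * k * D = 152 * n * (D * k) := by ring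
          _ ≤ 152 * n * (25 * B) := Nat.mul_le_mul_left _ hDk
          _ = _ := by ring
      omega
  · rcases lt_or_ge n 311040 with hsmall | hlarge
    · calc #S * k ^ 2 ≤ 2 * n ^ 2 := card_mul_sq_le hL hk hS
        _ = 2 * n * n := by ring
        _ ≤ 2 * n * 311040 * 1 := by rw [mul_one]; gcongr
        _ ≤ 2 * n * 311040 * B := Nat.mul_le_mul_left _ (by omega)
        _ = 622080 * (n * B) := by ring
        _ ≤ _ := Nat.mul_le_mul_right _ (by norm_num)
    have hex : ∃ I, n < 311040 * 4 ^ (I + 1) := by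
      obtain ⟨I, hI⟩ := pow_unbounded_of_one_lt n (by norm_num : (1 : ℕ) < 4)
      exact ⟨I, by rw [pow_succ]; omega⟩
    obtain ⟨I, hI1, hI2⟩ : ∃ I, 311040 * 4 ^ I ≤ n ∧ n < 311040 * 4 ^ (I + 1) := by
      refine ⟨Nat.find hex, ?_, Nat.find_spec hex⟩
      rcases Nat.eq_zero_or_pos (Nat.find hex) with h0 | h0
      · rw [h0, pow_zero, mul_one]; exact hlarge
      · obtain ⟨j, hj⟩ : ∃ j, Nat.find hex = j + 1 := ⟨_, (Nat.succ_pred_eq_of_pos h0).symm⟩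
        have := Nat.find_min hex (m := j) (by omega)
        rw [hj]
        omega
    obtain ⟨F, hF, hdeg, s, M, hs, hM, hc⟩ := exists_cells hL hk hS I
    have hD : 0 < 2 ^ I := by positivity
    have h8 : 2 ^ (3 * I) = (2 ^ I) ^ 3 := by rw [← pow_mul, mul_comm]
    have h4 : 4 ^ I = (2 ^ I) ^ 2 := by rw [← pow_mul, mul_comm, pow_mul]; norm_num
    rw [h8] at hs hM hc
    rw [pow_succ] at hI2
    rw [h4] at hI1 hI2
    generalize 2 ^ I = D at *
    have hDB : 557 * D ≤ B := by
      refine (Nat.pow_le_pow_iff_left two_ne_zero).1 ?_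
      nlinarith
    by_cases hoff : 4 * #{x ∈ S | ¬ MvPolynomial.eval x F = 0} ≤ #S
    · refine combine F hF ?_ ?_ ?_
      · have h3 : F.totalDegree ^ 2 ≤ (18 * D) ^ 2 := Nat.pow_le_pow_left hdeg 2
        rw [mul_pow] at h3
        norm_num at h3
        omega
      · calc F.totalDegree * k ≤ 18 * D * 14000 := Nat.mul_le_mul hdeg hk0.le
          _ ≤ 500 * B := by omega
      · rw [← mul_assoc]
        exact (Nat.mul_le_mul_right _ hoff).trans (Nat.le_add_right _ _)
    · push Not at hoff
      have h1 := sq_sum_mul_le (Finset.range (D ^ 3)) s M (p := D ^ 3 * k ^ 2) (q := 2 * #S)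
        (by positivity) (by
          intro c _
          obtain ⟨h2, h3, -⟩ := hc c
          calc s c ^ 2 * (D ^ 3 * k ^ 2) = D ^ 3 * s c * (s c * k ^ 2) := by ring
            _ ≤ #S * (2 * M c ^ 2) := Nat.mul_le_mul h2 h3
            _ = _ := by ring)
      set b := #{x ∈ S | ¬ MvPolynomial.eval x F = 0}
      have h2 : b ^ 2 * (D ^ 3 * k ^ 2) ≤ 2 * #S * (n * (19 * D)) ^ 2 :=
        (Nat.mul_le_mul_right _ (Nat.pow_le_pow_left hs 2)).trans
          (h1.trans (Nat.mul_le_mul_left _ (Nat.pow_le_pow_left hM 2)))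
      have hS0 : 0 < #S := card_pos.2 ⟨x₀, hx₀⟩
      have h3 : #S ^ 2 ≤ (4 * b) ^ 2 := Nat.pow_le_pow_left hoff.le 2
      have h5 : #S * k ^ 2 * D ≤ 11552 * n ^ 2 := by
        refine Nat.le_of_mul_le_mul_right ?_ (mul_pos hS0 (pow_pos hD 2))
        calc #S * k ^ 2 * D * (#S * D ^ 2) = #S ^ 2 * (D ^ 3 * k ^ 2) := by ring
          _ ≤ (4 * b) ^ 2 * (D ^ 3 * k ^ 2) := Nat.mul_le_mul_right _ h3
          _ = 16 * (b ^ 2 * (D ^ 3 * k ^ 2)) := by ring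
          _ ≤ 16 * (2 * #S * (n * (19 * D)) ^ 2) := Nat.mul_le_mul_left _ h2
          _ = _ := by ring
      have h6 : n ≤ 1116 * (B * D) := by
        refine (Nat.pow_le_pow_iff_left two_ne_zero).1 ?_
        calc n ^ 2 = n * n := sq n
          _ ≤ B ^ 2 * (311040 * (D ^ 2 * 4)) := Nat.mul_le_mul hnB hI2.le
          _ ≤ B ^ 2 * (1116 ^ 2 * D ^ 2) := Nat.mul_le_mul_left _ (by omega)
          _ = _ := by ring
      refine Nat.le_of_mul_le_mul_right ?_ hD
      calc #S * k ^ 2 * D ≤ 11552 * n ^ 2 := h5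
        _ = 11552 * n * n := by ring
        _ ≤ 11552 * n * (1116 * (B * D)) := Nat.mul_le_mul_left _ h6
        _ = 12892032 * (n * B) * D := by ring
        _ ≤ _ := by gcongr; norm_num

/-- The Euclidean plane. -/
abbrev Plane := EuclideanSpace ℝ (Fin 2)

/-- The direction of the line of rigid motions carrying `p` to `q`. -/
noncomputable def esDir (p q : Plane) : Pt := ![-(q 1 - p 1) / 2, (q 0 - p 0) / 2, 1]

/-- The Elekes–Sharir line of rigid motions carrying `p` to `q`. -/
noncomputable def esLine (p q : Plane) : Set Pt :=
  lineSet ![(p 0 + q 0) / 2, (p 1 + q 1) / 2, 0] (esDir p q)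

/-- A vector field whose value at each point is tangent to the Elekes–Sharir line of `p` there. -/
noncomputable def fld (p : Plane) (x : Pt) : Pt :=
  ![-(x 1 - p 1) + x 2 * (x 0 - p 0), (x 0 - p 0) + x 2 * (x 1 - p 1), 1 + x 2 ^ 2]

theorem esDir_ne_zero (p q : Plane) : esDir p q ≠ 0 := fun h => by
  simpa [esDir] using congrFun h 2

theorem isLine_esLine (p q : Plane) : IsLine (esLine p q) := ⟨_, _, esDir_ne_zero p q, rfl⟩

theorem fld_eq_of_mem {p q : Plane} {x : Pt} (hx : x ∈ esLine p q) :
    fld p x = (1 + x 2 ^ 2) • esDir p q := by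
  obtain ⟨t, rfl⟩ := hx
  ext i
  fin_cases i <;> simp [fld, esDir] <;> ring

theorem right_eq_of_mem_esLine {p q q' : Plane} {x : Pt} (hx : x ∈ esLine p q)
    (hx' : x ∈ esLine p q') : q = q' := by
  have h := (fld_eq_of_mem hx).symm.trans (fld_eq_of_mem hx')
  have h0 : (1 + x 2 ^ 2) ≠ 0 := by positivity
  have h1 := smul_right_injective _ h0 h
  have e0 := congrFun h1 0
  have e1 := congrFun h1 1
  simp only [esDir, Matrix.cons_val_zero, Matrix.cons_val_one] at e0 e1
  ext i
  fin_cases i <;> simp only [Fin.zero_eta, Fin.mk_one] <;> linarith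

theorem esLine_injective {p q p' q' : Plane} (h : esLine p q = esLine p' q') :
    p = p' ∧ q = q' := by
  have hx : (![(p 0 + q 0) / 2, (p 1 + q 1) / 2, 0] : Pt) ∈ esLine p' q' :=
    h ▸ self_mem_lineSet _ _
  have hy : (![(p 0 + q 0) / 2, (p 1 + q 1) / 2, 0] : Pt) + (1 : ℝ) • esDir p q ∈ esLine p' q' :=
    h ▸ ⟨1, rfl⟩
  obtain ⟨t, ht⟩ := hx
  obtain ⟨s, hs⟩ := hy
  have a0 := congrFun ht 0
  have a1 := congrFun ht 1
  have a2 := congrFun ht 2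
  have b0 := congrFun hs 0
  have b1 := congrFun hs 1
  have b2 := congrFun hs 2
  simp [esDir] at a0 a1 a2 b0 b1 b2
  subst a2 b2
  constructor <;> ext i <;> fin_cases i <;> simp only [Fin.zero_eta, Fin.mk_one] <;> linarith

theorem exists_mem_esLine {p q p' q' : Plane} (h : dist p p' = dist q q')
    (hne : q - q' ≠ p - p') : ∃ x, x ∈ esLine p q ∧ x ∈ esLine p' q' := by
  have h2 : (p 0 - p' 0) ^ 2 + (p 1 - p' 1) ^ 2 = (q 0 - q' 0) ^ 2 + (q 1 - q' 1) ^ 2 := by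
    have := congrArg (· ^ 2) h
    simpa [EuclideanSpace.dist_eq, Real.sq_sqrt, Fin.sum_univ_two, add_nonneg, sq_nonneg,
      Real.dist_eq, sq_abs] using this
  set a := p 0 - p' 0 with ha
  set b := p 1 - p' 1 with hb
  set c := q 0 - q' 0 with hc
  set d := q 1 - q' 1 with hd
  have hw : (c - a) ^ 2 + (d - b) ^ 2 ≠ 0 := by
    intro h0
    apply hne
    have e0 : c - a = 0 := by nlinarith [sq_nonneg (c - a), sq_nonneg (d - b)]
    have e1 : d - b = 0 := by nlinarith [sq_nonneg (c - a), sq_nonneg (d - b)]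
    ext i
    fin_cases i <;> simp <;> linarith
  set n := (c - a) ^ 2 + (d - b) ^ 2 with hn
  obtain ⟨t, ht⟩ : ∃ t, t = ((a + c) * (d - b) - (b + d) * (c - a)) / n := ⟨_, rfl⟩
  have h0 : a + c = t * (d - b) := by
    rw [ht]; field_simp; rw [hn]; linear_combination (-(c - a)) * h2
  have h1 : b + d = -t * (c - a) := by
    rw [ht]; field_simp; rw [hn]; linear_combination (-(d - b)) * h2
  refine ⟨_, ⟨t, rfl⟩, ⟨t, ?_⟩⟩
  ext i
  fin_cases i
  · simp [esDir]; linear_combination (-1/2) * h0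
  · simp [esDir]; linear_combination (-1/2) * h1
  · simp [esDir]

open scoped Classical in
/-- The Elekes–Sharir lines of a finite set of points. -/
noncomputable def esLines (P : Finset Plane) : Finset (Set Pt) :=
  (P ×ˢ P).image fun z => esLine z.1 z.2

theorem mem_esLines {P : Finset Plane} {l : Set Pt} :
    l ∈ esLines P ↔ ∃ p ∈ P, ∃ q ∈ P, l = esLine p q := by
  simp only [esLines, mem_image, mem_product, Prod.exists]
  constructor
  · rintro ⟨p, q, ⟨hp, hq⟩, rfl⟩; exact ⟨p, hp, q, hq, rfl⟩
  · rintro ⟨p, hp, q, hq, rfl⟩; exact ⟨p, q, ⟨hp, hq⟩, rfl⟩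

theorem card_esLines (P : Finset Plane) : #(esLines P) = #P ^ 2 := by
  classical
  rw [esLines, card_image_of_injective, card_product, sq]
  rintro ⟨p, q⟩ ⟨p', q'⟩ h
  obtain ⟨h1, h2⟩ := esLine_injective h
  exact Prod.ext h1 h2

open scoped Classical in
theorem mult_esLines (P : Finset Plane) (x : Pt) :
    mult (esLines P) x = #{z ∈ P ×ˢ P | x ∈ esLine z.1 z.2} := by
  rw [mult, esLines, filter_image, card_image_of_injective]
  rintro ⟨p, q⟩ ⟨p', q'⟩ h
  obtain ⟨h1, h2⟩ := esLine_injective h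
  exact Prod.ext h1 h2

theorem mult_esLines_le (P : Finset Plane) (x : Pt) : mult (esLines P) x ≤ #P := by
  classical
  rw [mult_esLines]
  refine card_le_card_of_injOn Prod.fst (fun z hz => ?_) ?_
  · have := hz
    simp only [coe_filter, mem_product, Set.mem_ofPred_eq, mem_coe] at this ⊢
    exact this.1.1
  · rintro ⟨p, q⟩ hz ⟨p', q'⟩ hz' h
    simp only [coe_filter, mem_product, Set.mem_ofPred_eq] at hz hz' h
    subst h
    rw [right_eq_of_mem_esLine hz.2 hz'.2]

/-- The polynomial form of the vector field `fld p`. -/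
noncomputable def fldPoly (p : Plane) : Fin 3 → Poly :=
  ![-(MvPolynomial.X 1 - MvPolynomial.C (p 1)) +
      MvPolynomial.X 2 * (MvPolynomial.X 0 - MvPolynomial.C (p 0)),
    (MvPolynomial.X 0 - MvPolynomial.C (p 0)) +
      MvPolynomial.X 2 * (MvPolynomial.X 1 - MvPolynomial.C (p 1)),
    1 + MvPolynomial.X 2 ^ 2]

theorem eval_fldPoly (p : Plane) (x : Pt) :
    (fun i => MvPolynomial.eval x (fldPoly p i)) = fld p x := by
  ext i
  fin_cases i <;> simp [fldPoly, fld]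

theorem totalDegree_fldPoly (p : Plane) (i : Fin 3) : (fldPoly p i).totalDegree ≤ 2 := by
  have hX : ∀ j : Fin 3, (MvPolynomial.X j : Poly).totalDegree ≤ 1 := fun j => by simp
  have hl : ∀ (j : Fin 3) (a : ℝ), (MvPolynomial.X j - MvPolynomial.C a : Poly).totalDegree ≤ 1 :=
    fun j a => totalDegree_sub_le_of (hX j) (by simp)
  have hm : ∀ (j : Fin 3) (a : ℝ), (MvPolynomial.X 2 * (MvPolynomial.X j - MvPolynomial.C a) :
      Poly).totalDegree ≤ 2 := fun j a => totalDegree_mul_le_of (a := 1) (b := 1) (hX 2) (hl j a)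
  fin_cases i
  · refine (MvPolynomial.totalDegree_add _ _).trans (max_le ?_ (hm _ _))
    rw [MvPolynomial.totalDegree_neg]
    exact (hl _ _).trans one_le_two
  · exact (MvPolynomial.totalDegree_add _ _).trans
      (max_le ((hl _ _).trans one_le_two) (hm _ _))
  · refine (MvPolynomial.totalDegree_add _ _).trans (max_le (by simp) ?_)
    rw [sq]
    exact totalDegree_mul_le_of (a := 1) (b := 1) (hX 2) (hX 2)

/-- The derivative of `g` along the vector field `fld p`. -/
noncomputable def along (g : Poly) (p : Plane) : Poly := lin1 (gr g) (fldPoly p)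

theorem eval_along (g : Poly) (p : Plane) (x : Pt) :
    MvPolynomial.eval x (along g p) = lin1 (gv g x) (fld p x) := by
  rw [along, map_lin1, eval_fldPoly]; rfl

theorem VanishOn.along {g : Poly} {p q : Plane} (h : VanishOn g (esLine p q)) :
    VanishOn (along g p) (esLine p q) := by
  intro x hx
  rw [esLine] at h
  have h1 := h.eval_dd x hx
  rw [ErdosDistance.eval_dd] at h1
  rw [eval_along, fld_eq_of_mem hx, lin1_smul_right]
  rw [h1, mul_zero]

theorem eq_zero_of_linear_ode₁ {φ c A : Polynomial ℝ} (hc : c.eval 0 ≠ 0)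
    (h : c * Polynomial.derivative φ = A * φ) (h0 : φ.eval 0 = 0) : φ = 0 := by
  have h1 : (Polynomial.derivative φ).eval 0 = 0 := by
    have := congrArg (Polynomial.eval 0) h
    simp only [Polynomial.eval_mul, h0, mul_zero] at this
    exact (mul_eq_zero.1 this).resolve_left hc
  refine eq_zero_of_linear_ode₂ (A := Polynomial.derivative A)
    (B := A - Polynomial.derivative c) hc ?_ h0 h1
  have := congrArg Polynomial.derivative h
  rw [Polynomial.derivative_mul, Polynomial.derivative_mul] at this
  linear_combination this

theorem fld_along_line (p : Plane) (x : Pt) (s : ℝ) :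
    fld p (x + s • fld p x) = (1 + 2 * s * x 2 + s ^ 2 * (1 + x 2 ^ 2)) • fld p x := by
  ext i
  fin_cases i <;> simp [fld] <;> ring

theorem vanishOn_of_dvd_along {g : Poly} {p : Plane} (h : g ∣ along g p) {x : Pt}
    (hx : MvPolynomial.eval x g = 0) : VanishOn g (lineSet x (fld p x)) := by
  obtain ⟨k, hk⟩ := h
  rw [vanishOn_lineSet]
  refine eq_zero_of_linear_ode₁ (c := 1 + Polynomial.C (2 * x 2) * Polynomial.X +
    Polynomial.C (1 + x 2 ^ 2) * Polynomial.X ^ 2) (A := restr x (fld p x) k) (by simp) ?_ ?_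
  · rw [derivative_restr]
    refine Polynomial.funext fun s => ?_
    have h1 := congrArg (MvPolynomial.eval (x + s • fld p x)) hk
    rw [eval_along, fld_along_line, lin1_smul_right, map_mul] at h1
    simp only [Polynomial.eval_mul, eval_restr, eval_dd, Polynomial.eval_add, Polynomial.eval_one,
      Polynomial.eval_C, Polynomial.eval_X, Polynomial.eval_pow]
    linear_combination h1
  · rw [eval_restr, zero_smul, add_zero, hx]

theorem fld_lineMap (p q : Plane) (a : ℝ) (x : Pt) :
    fld (p + a • (q - p)) x = fld p x + a • (fld q x - fld p x) := by
  ext i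
  fin_cases i <;> simp [fld] <;> ring

theorem dvd_along_lineMap {g : Poly} {p q : Plane} (hp : g ∣ along g p) (hq : g ∣ along g q)
    (a : ℝ) : g ∣ along g (p + a • (q - p)) := by
  have h : along g (p + a • (q - p)) =
      along g p + MvPolynomial.C a * (along g q - along g p) := by
    refine MvPolynomial.funext fun x => ?_
    have h1 := lin1_add_smul (gv g x) (fld q x) (fld p x) 1 (-1)
    have h2 := lin1_add_smul (gv g x) (fld p x) (fld q x - fld p x) 1 a
    have e : (1 : ℝ) • fld q x + (-1 : ℝ) • fld p x = fld q x - fld p x := by module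
    rw [e] at h1
    rw [h1, one_smul, ← fld_lineMap] at h2
    simp only [map_add, map_mul, map_sub, MvPolynomial.eval_C, eval_along, h2]
    ring
  rw [h]
  exact dvd_add hp (Dvd.dvd.mul_left (dvd_sub hq hp) _)

theorem fld_zero (p : Plane) (x : Pt) : fld p x 0 = -(x 1 - p 1) + x 2 * (x 0 - p 0) := rfl

theorem fld_one (p : Plane) (x : Pt) : fld p x 1 = (x 0 - p 0) + x 2 * (x 1 - p 1) := rfl

theorem fld_two (p : Plane) (x : Pt) : fld p x 2 = 1 + x 2 ^ 2 := rfl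

/-- A surface is tangent to at most one of the vector fields `fld p`. -/
theorem eq_of_dvd_along {g : Poly} (hg : g ≠ 0) {p q : Plane} (hp : g ∣ along g p)
    (hq : g ∣ along g q) {x : Pt} (hx : MvPolynomial.eval x g = 0) : p = q := by
  by_contra hpq
  have key : ∀ y : Pt, MvPolynomial.eval y g = 0 → ∀ s a : ℝ,
      MvPolynomial.eval (y + s • (fld p y + a • (fld q y - fld p y))) g = 0 := by
    intro y hy s a
    rw [← fld_lineMap]
    exact vanishOn_of_dvd_along (dvd_along_lineMap hp hq a) hy _ ⟨s, rfl⟩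
  have side : ∀ b : ℝ, MvPolynomial.eval (x + b • (fld q x - fld p x)) g = 0 := by
    intro b
    have h0 : Polynomial.X * restr (x + b • (fld q x - fld p x)) (fld p x) g = 0 := by
      refine Polynomial.funext fun s => ?_
      rw [Polynomial.eval_mul, Polynomial.eval_X, Polynomial.eval_zero, eval_restr]
      by_cases hs : s = 0
      · rw [hs, zero_mul]
      · have h1 := key x hx s (b / s)
        have e : x + s • (fld p x + (b / s) • (fld q x - fld p x)) =
            x + b • (fld q x - fld p x) + s • fld p x := by
          rw [smul_add, smul_smul, mul_div_cancel₀ _ hs]; abel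
        rw [← e, h1, mul_zero]
    have h1 := (mul_eq_zero.1 h0).resolve_left Polynomial.X_ne_zero
    have h2 := congrArg (Polynomial.eval 0) h1
    simpa [eval_restr] using h2
  have hn : (q 0 - p 0) ^ 2 + (q 1 - p 1) ^ 2 ≠ 0 := by
    intro h0
    apply hpq
    have e0 : q 0 - p 0 = 0 := by nlinarith [sq_nonneg (q 0 - p 0), sq_nonneg (q 1 - p 1)]
    have e1 : q 1 - p 1 = 0 := by nlinarith [sq_nonneg (q 0 - p 0), sq_nonneg (q 1 - p 1)]
    ext i
    fin_cases i <;> simp <;> linarith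
  have all : g * (MvPolynomial.X 2 - MvPolynomial.C (x 2)) = 0 := by
    refine MvPolynomial.funext fun z => ?_
    simp only [map_mul, map_sub, MvPolynomial.eval_X, MvPolynomial.eval_C, map_zero]
    by_cases hz : z 2 - x 2 = 0
    · rw [hz, mul_zero]
    have hτ : 1 + x 2 ^ 2 ≠ 0 := by positivity
    obtain ⟨s, hs⟩ : ∃ s, s * (1 + x 2 ^ 2) = z 2 - x 2 := ⟨_, div_mul_cancel₀ _ hτ⟩
    have hs0 : s ≠ 0 := by rintro rfl; apply hz; rw [← hs, zero_mul]
    obtain ⟨w₀, hw0⟩ : ∃ w, w = (q 1 - p 1) - x 2 * (q 0 - p 0) := ⟨_, rfl⟩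
    obtain ⟨w₁, hw1⟩ : ∃ w, w = -(q 0 - p 0) - x 2 * (q 1 - p 1) := ⟨_, rfl⟩
    have hm : w₀ ^ 2 + w₁ ^ 2 ≠ 0 := by
      have : w₀ ^ 2 + w₁ ^ 2 = (1 + x 2 ^ 2) * ((q 0 - p 0) ^ 2 + (q 1 - p 1) ^ 2) := by
        rw [hw0, hw1]; ring
      rw [this]
      exact mul_ne_zero hτ hn
    obtain ⟨d₀, hd0⟩ : ∃ d, d = z 0 - x 0 - s * fld p x 0 := ⟨_, rfl⟩
    obtain ⟨d₁, hd1⟩ : ∃ d, d = z 1 - x 1 - s * fld p x 1 := ⟨_, rfl⟩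
    obtain ⟨b, hb⟩ : ∃ b, b = (d₁ * w₀ - d₀ * w₁) / (s * (w₀ ^ 2 + w₁ ^ 2)) := ⟨_, rfl⟩
    obtain ⟨c, hc⟩ : ∃ c, c = (d₀ * w₀ + d₁ * w₁) / (w₀ ^ 2 + w₁ ^ 2) := ⟨_, rfl⟩
    have h0 : d₀ = c * w₀ - s * b * w₁ := by rw [hc, hb]; field_simp; ring
    have h1 : d₁ = c * w₁ + s * b * w₀ := by rw [hc, hb]; field_simp; ring
    obtain ⟨a, ha⟩ : ∃ a, s * a = c - b - s * x 2 * b := ⟨_, mul_div_cancel₀ _ hs0⟩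
    have h2 := key _ (side b) s a
    have e : x + b • (fld q x - fld p x) + s • (fld p (x + b • (fld q x - fld p x)) +
        a • (fld q (x + b • (fld q x - fld p x)) - fld p (x + b • (fld q x - fld p x)))) = z := by
      subst hw0 hw1
      ext i
      fin_cases i <;> simp only [Fin.zero_eta, Fin.mk_one, Fin.reduceFinMk, Pi.add_apply,
        Pi.sub_apply, Pi.smul_apply, smul_eq_mul, fld_zero, fld_one, fld_two] at hd0 hd1 ⊢
      · linear_combination (-1) * h0 + hd0 + (q 1 - p 1 - x 2 * (q 0 - p 0)) * ha
      · linear_combination (-1) * h1 + hd1 + (-(q 0 - p 0) - x 2 * (q 1 - p 1)) * ha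
      · linear_combination hs
    rw [e] at h2
    rw [h2, zero_mul]
  rcases mul_eq_zero.1 all with h | h
  · exact hg h
  · have := congrArg (MvPolynomial.eval ![0, 0, x 2 + 1]) h
    simp at this

theorem totalDegree_along_le {g : Poly} (hg : g.totalDegree ≤ 2) (p : Plane) :
    (along g p).totalDegree ≤ 3 :=
  totalDegree_lin1_le (a := 1) (b := 2)
    (fun i => (totalDegree_pderiv_le i g).trans (by omega)) (totalDegree_fldPoly p)

open scoped Classical in
/-- Few Elekes–Sharir lines lie on a plane or a quadric. -/
theorem card_esLines_vanishOn_le (P : Finset Plane) {g : Poly} (hg : Irreducible g)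
    (hdeg : g.totalDegree ≤ 2) : #{l ∈ esLines P | VanishOn g l} ≤ 7 * #P := by
  obtain ⟨T, hT⟩ : ∃ T : Plane → Finset (Set Pt), ∀ p l, l ∈ T p ↔
      (∃ q ∈ P, l = esLine p q) ∧ VanishOn g l :=
    ⟨fun p => {l ∈ P.image fun q => esLine p q | VanishOn g l}, fun p l => by
      simp [eq_comm]⟩
  have hT1 : ∀ p, ¬ g ∣ along g p → #(T p) ≤ 6 := by
    intro p hp
    refine (card_lines_le hg hp fun l hl => ?_).trans
      (Nat.mul_le_mul hdeg (totalDegree_along_le hdeg p))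
    obtain ⟨⟨q, -, rfl⟩, hv⟩ := (hT _ _).1 hl
    exact ⟨isLine_esLine p q, hv, hv.along⟩
  have hT2 : ∀ p, #(T p) ≤ #P := by
    intro p
    refine (card_le_card fun l hl => ?_).trans (card_image_le (s := P) (f := fun q => esLine p q))
    obtain ⟨⟨q, hq, rfl⟩, -⟩ := (hT _ _).1 hl
    exact mem_image_of_mem _ hq
  have hsub : {l ∈ esLines P | VanishOn g l} ⊆ P.biUnion T := by
    intro l hl
    rw [mem_filter, mem_esLines] at hl
    obtain ⟨⟨p, hp, q, hq, rfl⟩, hv⟩ := hl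
    exact mem_biUnion.2 ⟨p, hp, (hT _ _).2 ⟨⟨q, hq, rfl⟩, hv⟩⟩
  rcases eq_empty_or_nonempty {l ∈ esLines P | VanishOn g l} with he | ⟨l, hl⟩
  · rw [he]; simp
  rw [mem_filter] at hl
  obtain ⟨x, hx⟩ : l.Nonempty := by
    obtain ⟨p, -, q, -, rfl⟩ := mem_esLines.1 hl.1
    exact (isLine_esLine p q).nonempty
  have hx0 := hl.2 x hx
  refine (card_le_card hsub).trans (card_biUnion_le.trans ?_)
  rw [← sum_filter_add_sum_filter_not P fun p => g ∣ along g p]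
  have s1 : ∑ p ∈ P with g ∣ along g p, #(T p) ≤ #P := by
    have h1 : #{p ∈ P | g ∣ along g p} ≤ 1 := card_le_one.2 fun p hp q hq =>
      eq_of_dvd_along hg.ne_zero (mem_filter.1 hp).2 (mem_filter.1 hq).2 hx0
    calc _ ≤ #{p ∈ P | g ∣ along g p} * #P := by
          rw [← smul_eq_mul]; exact sum_le_card_nsmul _ _ _ fun p _ => hT2 p
      _ ≤ 1 * #P := Nat.mul_le_mul_right _ h1
      _ = #P := one_mul _
  have s2 : ∑ p ∈ P with ¬ g ∣ along g p, #(T p) ≤ #P * 6 := by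
    calc _ ≤ #{p ∈ P | ¬ g ∣ along g p} * 6 := by
          rw [← smul_eq_mul]
          exact sum_le_card_nsmul _ _ _ fun p hp => hT1 p (mem_filter.1 hp).2
      _ ≤ #P * 6 := Nat.mul_le_mul_right _ (card_filter_le _ _)
  omega

/-- The Guth–Katz bound for rich points of the Elekes–Sharir lines. -/
theorem card_rich_esLines_le (P : Finset Plane) {k : ℕ} (hk : 2 ≤ k) {S : Finset Pt}
    (hS : ∀ x ∈ S, k ≤ mult (esLines P) x) :
    #S * k ^ 2 ≤ 140000000 * #P ^ 3 := by
  have h := card_rich_points_le (U := esLines P) (B := 7 * #P) (fun l hl => by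
      obtain ⟨p, -, q, -, rfl⟩ := mem_esLines.1 hl
      exact isLine_esLine p q)
    (fun g hg hd => card_esLines_vanishOn_le P hg hd)
    (fun x => (mult_esLines_le P x).trans (by omega))
    (by rw [card_esLines, mul_pow]; omega) _ _ subset_rfl le_rfl k hk S hS
  rw [card_esLines] at h
  linarith [h]

open scoped Classical in
theorem sum_mult_sq_le (P : Finset Plane) {X : Finset Pt} (hX : ∀ x ∈ X, 2 ≤ mult (esLines P) x) :
    ∑ x ∈ X, mult (esLines P) x ^ 2 ≤ Nat.log 2 #P * (560000000 * #P ^ 3) := by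
  have hmaps : ∀ x ∈ X, Nat.log 2 (mult (esLines P) x) ∈ Finset.Icc 1 (Nat.log 2 #P) := by
    intro x hx
    rw [mem_Icc]
    exact ⟨Nat.log_pos one_lt_two (hX x hx), Nat.log_mono_right (mult_esLines_le P x)⟩
  rw [← sum_fiberwise_of_maps_to hmaps]
  refine (sum_le_card_nsmul _ _ (560000000 * #P ^ 3) fun j hj => ?_).trans (by simp)
  rw [mem_Icc] at hj
  have h1 := card_rich_esLines_le P (k := 2 ^ j) (Nat.le_self_pow (by omega) 2)
    (S := {x ∈ X | Nat.log 2 (mult (esLines P) x) = j}) fun x hx => by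
      rw [mem_filter] at hx
      rw [← hx.2]
      exact Nat.pow_log_le_self 2 (by have := hX x hx.1; omega)
  calc _ ≤ #{x ∈ X | Nat.log 2 (mult (esLines P) x) = j} * (4 * (2 ^ j) ^ 2) := by
        rw [← smul_eq_mul]
        refine sum_le_card_nsmul _ _ _ fun x hx => ?_
        rw [mem_filter] at hx
        have h2 := Nat.lt_pow_succ_log_self one_lt_two (mult (esLines P) x)
        rw [hx.2, pow_succ] at h2
        calc _ ≤ (2 ^ j * 2) ^ 2 := Nat.pow_le_pow_left h2.le 2
          _ = _ := by ring
    _ ≤ _ := by linarith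

open scoped Classical in
/-- The number of quadruples of points spanning two congruent segments. -/
theorem card_congruent_le (P : Finset Plane) :
    #{z ∈ (P ×ˢ P) ×ˢ (P ×ˢ P) | dist z.1.1 z.1.2 = dist z.2.1 z.2.2} ≤
      #P ^ 3 + Nat.log 2 #P * (560000000 * #P ^ 3) := by
  obtain ⟨Z, hZ⟩ : ∃ Z : Finset ((Plane × Plane) × (Plane × Plane)), ∀ p p' q q',
      ((p, p'), (q, q')) ∈ Z ↔ ((p ∈ P ∧ p' ∈ P) ∧ (q ∈ P ∧ q' ∈ P)) ∧ dist p p' = dist q q' ∧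
        q - q' ≠ p - p' :=
    ⟨{z ∈ (P ×ˢ P) ×ˢ (P ×ˢ P) | dist z.1.1 z.1.2 = dist z.2.1 z.2.2 ∧
      z.2.1 - z.2.2 ≠ z.1.1 - z.1.2}, by simp⟩
  obtain ⟨T, hT⟩ : ∃ T : Finset ((Plane × Plane) × (Plane × Plane)), ∀ p p' q q',
      ((p, p'), (q, q')) ∈ T ↔ ((p ∈ P ∧ p' ∈ P) ∧ (q ∈ P ∧ q' ∈ P)) ∧ q - q' = p - p' :=
    ⟨{z ∈ (P ×ˢ P) ×ˢ (P ×ˢ P) | z.2.1 - z.2.2 = z.1.1 - z.1.2}, by simp⟩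
  have hTcard : #T ≤ #P ^ 3 := by
    calc #T ≤ #((P ×ˢ P) ×ˢ P) := by
          refine card_le_card_of_injOn (fun z => (z.1, z.2.1)) ?_ ?_
          · rintro ⟨⟨p, p'⟩, ⟨q, q'⟩⟩ hz
            have := (hT _ _ _ _).1 hz
            simp only [mem_coe, mem_product]
            exact ⟨this.1.1, this.1.2.1⟩
          · rintro ⟨⟨p, p'⟩, ⟨q, q'⟩⟩ hz ⟨⟨r, r'⟩, ⟨s, s'⟩⟩ hw h
            have h1 := ((hT _ _ _ _).1 hz).2
            have h2 := ((hT _ _ _ _).1 hw).2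
            simp only [Prod.mk.injEq] at h ⊢
            obtain ⟨⟨rfl, rfl⟩, rfl⟩ := h
            exact ⟨⟨rfl, rfl⟩, rfl, sub_right_injective (h1.trans h2.symm)⟩
      _ = #P ^ 3 := by rw [card_product, card_product]; ring
  have hpt : ∀ z : (Plane × Plane) × (Plane × Plane), ∃ x : Pt, z ∈ Z →
      x ∈ esLine z.1.1 z.2.1 ∧ x ∈ esLine z.1.2 z.2.2 := by
    rintro ⟨⟨p, p'⟩, ⟨q, q'⟩⟩
    by_cases hz : ((p, p'), (q, q')) ∈ Z
    · obtain ⟨-, h1, h2⟩ := (hZ _ _ _ _).1 hz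
      obtain ⟨x, hx⟩ := exists_mem_esLine h1 h2
      exact ⟨x, fun _ => hx⟩
    · exact ⟨0, fun h => (hz h).elim⟩
  choose c hc using hpt
  have hXm : ∀ x ∈ Z.image c, 2 ≤ mult (esLines P) x := by
    intro x hx
    obtain ⟨⟨⟨p, p'⟩, ⟨q, q'⟩⟩, hz, rfl⟩ := mem_image.1 hx
    obtain ⟨⟨⟨hp, hp'⟩, hq, hq'⟩, -, h2⟩ := (hZ _ _ _ _).1 hz
    obtain ⟨m1, m2⟩ := hc _ hz
    rw [mult_esLines]
    refine one_lt_card.2 ⟨(p, q), ?_, (p', q'), ?_, ?_⟩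
    · exact mem_filter.2 ⟨mem_product.2 ⟨hp, hq⟩, m1⟩
    · exact mem_filter.2 ⟨mem_product.2 ⟨hp', hq'⟩, m2⟩
    · intro h
      obtain ⟨rfl, rfl⟩ := Prod.mk.inj h
      exact h2 (by rw [sub_self, sub_self])
  have hZcard : #Z ≤ ∑ x ∈ Z.image c, mult (esLines P) x ^ 2 := by
    rw [card_eq_sum_card_image c Z]
    refine sum_le_sum fun x _ => ?_
    rw [mult_esLines, sq, ← card_product]
    refine card_le_card_of_injOn (fun z => ((z.1.1, z.2.1), (z.1.2, z.2.2))) ?_ ?_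
    · rintro ⟨⟨p, p'⟩, ⟨q, q'⟩⟩ hz
      obtain ⟨hz₁, rfl⟩ := mem_filter.1 hz
      obtain ⟨⟨⟨hp, hp'⟩, hq, hq'⟩, -⟩ := (hZ _ _ _ _).1 hz₁
      obtain ⟨m1, m2⟩ := hc _ hz₁
      exact mem_product.2 ⟨mem_filter.2 ⟨mem_product.2 ⟨hp, hq⟩, m1⟩,
        mem_filter.2 ⟨mem_product.2 ⟨hp', hq'⟩, m2⟩⟩
    · rintro ⟨⟨p, p'⟩, ⟨q, q'⟩⟩ - ⟨⟨r, r'⟩, ⟨s, s'⟩⟩ - h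
      simp only [Prod.mk.injEq] at h ⊢
      tauto
  calc _ ≤ #(T ∪ Z) := by
        refine card_le_card ?_
        rintro ⟨⟨p, p'⟩, ⟨q, q'⟩⟩ hz
        simp only [mem_filter, mem_product] at hz
        rw [mem_union, hT, hZ]
        tauto
    _ ≤ #T + #Z := card_union_le _ _
    _ ≤ _ := add_le_add hTcard (hZcard.trans (sum_mult_sq_le P hXm))

open scoped Classical in
theorem card_pow_le (P : Finset Plane) :
    #P ^ 4 ≤ #((P ×ˢ P).image fun z => dist z.1 z.2) *
      (#P ^ 3 + Nat.log 2 #P * (560000000 * #P ^ 3)) := by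
  set D := (P ×ˢ P).image fun z => dist z.1 z.2 with hD
  have h1 : #P ^ 2 = ∑ d ∈ D, #{z ∈ P ×ˢ P | dist z.1 z.2 = d} := by
    rw [sq, ← card_product]
    exact card_eq_sum_card_image _ _
  have h2 : ∑ d ∈ D, #{z ∈ P ×ˢ P | dist z.1 z.2 = d} ^ 2 ≤
      #{z ∈ (P ×ˢ P) ×ˢ (P ×ˢ P) | dist z.1.1 z.1.2 = dist z.2.1 z.2.2} := by
    rw [card_eq_sum_card_fiberwise (f := fun z => dist z.1.1 z.1.2) (t := D)]
    · refine sum_le_sum fun d _ => ?_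
      rw [sq, ← card_product]
      refine card_le_card ?_
      rintro ⟨z, w⟩ h
      simp only [mem_filter, mem_product] at h ⊢
      exact ⟨⟨⟨h.1.1, h.2.1⟩, h.1.2.trans h.2.2.symm⟩, h.1.2⟩
    · rintro ⟨z, w⟩ h
      exact mem_image_of_mem _ (mem_product.1 (mem_filter.1 h).1).1
  calc #P ^ 4 = (#P ^ 2) ^ 2 := by ring
    _ ≤ #D * ∑ d ∈ D, #{z ∈ P ×ˢ P | dist z.1 z.2 = d} ^ 2 := by
        rw [h1]; exact sq_sum_le_card_mul_sum_sq
    _ ≤ _ := Nat.mul_le_mul_left _ (h2.trans (card_congruent_le P))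

end ErdosDistance

/-- **Erdős distance set problem** (Corollary 6.10, Guth–Katz). -/
theorem erdos_distance_problem : ∃ c : ℝ, 0 < c ∧ ∀ N : ℕ, 1 < N →
    ∀ P : Finset (EuclideanSpace ℝ (Fin 2)), P.card = N →
      c * (N : ℝ) / Real.log N ≤ ({d : ℝ | ∃ p ∈ P, ∃ q ∈ P, d = dist p q}.ncard : ℝ) := by
  classical
  refine ⟨1 / 2000000000, by norm_num, fun N hN P hP => ?_⟩
  have hset : {d : ℝ | ∃ p ∈ P, ∃ q ∈ P, d = dist p q} =
      ((P ×ˢ P).image fun z => dist z.1 z.2 : Finset ℝ) := by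
    ext d
    simp only [Set.mem_ofPred_eq, Finset.coe_image, Set.mem_image, Finset.mem_coe,
      Finset.mem_product, Prod.exists]
    constructor
    · rintro ⟨p, hp, q, hq, rfl⟩; exact ⟨p, q, ⟨hp, hq⟩, rfl⟩
    · rintro ⟨p, q, ⟨hp, hq⟩, rfl⟩; exact ⟨p, hp, q, hq, rfl⟩
  rw [hset, Set.ncard_coe_finset]
  have h := ErdosDistance.card_pow_le P
  rw [hP] at h
  set m := ((P ×ˢ P).image fun z => dist z.1 z.2).card
  have h1 : N ≤ m * (1 + Nat.log 2 N * 560000000) := by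
    refine Nat.le_of_mul_le_mul_left (c := N ^ 3) ?_ (by positivity)
    calc N ^ 3 * N = N ^ 4 := by ring
      _ ≤ _ := h
      _ = _ := by ring
  have hlog : 1 ≤ Nat.log 2 N := Nat.log_pos one_lt_two hN
  have h2 : N ≤ m * (Nat.log 2 N * 1000000000) := h1.trans (Nat.mul_le_mul_left _ (by omega))
  have h3 : (N : ℝ) ≤ m * (Nat.log 2 N * 1000000000) := by exact_mod_cast h2
  have hNlog : 0 < Real.log N := Real.log_pos (by exact_mod_cast hN)
  have h4 : (Nat.log 2 N : ℝ) ≤ 2 * Real.log N := by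
    have h5 : (2 : ℝ) ^ Nat.log 2 N ≤ N := by
      exact_mod_cast Nat.pow_log_le_self 2 (by omega : N ≠ 0)
    have h6 := Real.log_le_log (by positivity) h5
    rw [Real.log_pow] at h6
    have h7 := Real.log_two_gt_d9
    have h8 : (0 : ℝ) ≤ Nat.log 2 N := Nat.cast_nonneg _
    nlinarith
  rw [div_le_iff₀ hNlog]
  have h9 : (m : ℝ) * (Nat.log 2 N * 1000000000) ≤ m * (2 * Real.log N * 1000000000) := by gcongr
  linarith
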